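/- Let d ≥ 5 and let P be a prime centrally symmetric simplicial d-polytope with g_2(P) = C(d,2) − d and natural embedding p, and assume additionally that every d vertices of P, no two of which are antipodal, are affinely independent. Then for every vertex u of P, the framework (st(u) ∪ st(−u), p), whose graph is the union of the graphs (1-skeleta) of st(u) and st(−u), is infinitesimally rigid in ℝ^d. -/

import Mathlib

open Finset
open scoped Classical

noncomputable section

/-- A finite graph: a finite vertex set together with a finite set of edges,
where each edge is (intended to be) a 2-element subset of the vertex set. -/
structure FinGraph (ι : Type) where
  verts : Finset ι
  edges : Finset (Finset ι)

/-- Every edge is a 2-element subset of the vertex set. -/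
def FinGraph.Good {ι : Type} (G : FinGraph ι) : Prop :=
  ∀ e ∈ G.edges, e ⊆ G.verts ∧ e.card = 2

/-- The standard inner (dot) product on `ℝ^d`. -/
def dotR {d : ℕ} (x y : Fin d → ℝ) : ℝ := ∑ i, x i * y i

/-- An infinitesimal motion of the framework `(G, p)`. -/
def IsMotion {ι : Type} {d : ℕ} (G : FinGraph ι) (p m : ι → Fin d → ℝ) : Prop :=
  ∀ e ∈ G.edges, ∀ u ∈ e, ∀ v ∈ e, dotR (p u - p v) (m u - m v) = 0

/-- The framework `(G, p)` is infinitesimally rigid in `ℝ^d`: every infinitesimal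
motion is the restriction of a motion `x ↦ A x + b` of `ℝ^d` with `A` skew-symmetric. -/
def IsInfRigid {ι : Type} (d : ℕ) (G : FinGraph ι) (p : ι → Fin d → ℝ) : Prop :=
  ∀ m : ι → Fin d → ℝ, IsMotion G p m →
    ∃ (A : Matrix (Fin d) (Fin d) ℝ) (b : Fin d → ℝ),
      A.transpose = -A ∧ ∀ v ∈ G.verts, m v = A.mulVec (p v) + b

/-- A stress on the framework `(G, p)`. -/
def IsStress {ι : Type} {d : ℕ} (G : FinGraph ι) (p : ι → Fin d → ℝ)
    (ω : Finset ι → ℝ) : Prop :=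
  ∀ v ∈ G.verts,
    (∑ e ∈ G.edges.filter (fun e => v ∈ e), ∑ u ∈ e.erase v, ω e • (p v - p u)) = 0

/-- A centrally symmetric framework with free involution `ν` satisfying `p (ν v) = -(p v)`. -/
def IsCSFramework {ι : Type} {d : ℕ} (G : FinGraph ι) (p : ι → Fin d → ℝ) (ν : ι → ι) : Prop :=
  (∀ v ∈ G.verts, ν (ν v) = v) ∧
  (∀ v ∈ G.verts, ν v ∈ G.verts) ∧
  (∀ v ∈ G.verts, ν v ≠ v) ∧
  (∀ e ∈ G.edges, e.image ν ∈ G.edges) ∧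
  (∀ e ∈ G.edges, e.image ν ≠ e) ∧
  (∀ v ∈ G.verts, p (ν v) = -(p v))

/-- The convex body spanned by a finite point set. -/
def polyBody {d : ℕ} (V : Finset (Fin d → ℝ)) : Set (Fin d → ℝ) :=
  convexHull ℝ (V : Set (Fin d → ℝ))

/-- `(f, c)` is a supporting functional for `conv V` exposing the face `F`. -/
def IsSupport {d : ℕ} (V : Finset (Fin d → ℝ)) (f : (Fin d → ℝ) →ₗ[ℝ] ℝ) (c : ℝ)
    (F : Set (Fin d → ℝ)) : Prop :=
  (∀ y ∈ polyBody V, f y ≤ c) ∧ F = {y ∈ polyBody V | f y = c}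

/-- A proper face of the polytope `conv V`. -/
def IsProperFace {d : ℕ} (V : Finset (Fin d → ℝ)) (F : Set (Fin d → ℝ)) : Prop :=
  (∃ f c, IsSupport V f c F) ∧ F ≠ polyBody V

/-- A simplicial `d`-polytope in `ℝ^d`, recorded by its vertex set `V`: the polytope is
`conv V`, it is `d`-dimensional, every element of `V` is a vertex, and every proper face
is a simplex (the convex hull of its affinely independent vertex set). -/
structure SPolytope (d : ℕ) where
  V : Finset (Fin d → ℝ)
  span_top : affineSpan ℝ (V : Set (Fin d → ℝ)) = ⊤
  extreme : ∀ v ∈ V, v ∉ convexHull ℝ ((V.erase v : Finset (Fin d → ℝ)) : Set (Fin d → ℝ))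
  simplicial : ∀ F : Set (Fin d → ℝ), IsProperFace V F →
    AffineIndependent ℝ
      (fun x : {y : Fin d → ℝ // y ∈ (V : Set (Fin d → ℝ)) ∩ F} => (x : Fin d → ℝ)) ∧
    F = convexHull ℝ ((V : Set (Fin d → ℝ)) ∩ F)

/-- `s` is a face of the boundary complex `∂P`. -/
def BFace {d : ℕ} (P : SPolytope d) (s : Finset (Fin d → ℝ)) : Prop :=
  s ⊆ P.V ∧ ∃ F : Set (Fin d → ℝ), IsProperFace P.V F ∧ (s : Set (Fin d → ℝ)) ⊆ F

/-- The number of vertices of `∂P`. -/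
def f0 {d : ℕ} (P : SPolytope d) : ℕ := P.V.card

/-- The edges of `∂P`. -/
def edgeFinset {d : ℕ} (P : SPolytope d) : Finset (Finset (Fin d → ℝ)) :=
  P.V.powerset.filter fun e => e.card = 2 ∧ BFace P e

/-- The number of edges of `∂P`. -/
def f1 {d : ℕ} (P : SPolytope d) : ℕ := (edgeFinset P).card

/-- `g₂(P) = f₁ - d f₀ + C(d+1, 2)`. -/
def g2 {d : ℕ} (P : SPolytope d) : ℤ :=
  (f1 P : ℤ) - (d : ℤ) * (f0 P : ℤ) + ((d + 1).choose 2 : ℤ)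

/-- `P` is centrally symmetric. -/
def IsCS {d : ℕ} (P : SPolytope d) : Prop := ∀ v ∈ P.V, -v ∈ P.V

/-- A missing face of `∂P`. -/
def IsMissingFace {d : ℕ} (P : SPolytope d) (σ : Finset (Fin d → ℝ)) : Prop :=
  σ ⊆ P.V ∧ ¬ BFace P σ ∧ ∀ τ ⊂ σ, BFace P τ

/-- `P` is prime: `∂P` has no missing facet, i.e. no missing face of cardinality `d`. -/
def IsPrimePoly {d : ℕ} (P : SPolytope d) : Prop :=
  ¬ ∃ σ : Finset (Fin d → ℝ), IsMissingFace P σ ∧ σ.card = d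

/-- The graph (1-skeleton) of `∂P` as a framework graph. -/
def fullGraph {d : ℕ} (P : SPolytope d) : FinGraph (Fin d → ℝ) :=
  ⟨P.V, edgeFinset P⟩

/-- The graph (1-skeleton) of the star of the face `τ` in `∂P`. -/
def starGraph {d : ℕ} (P : SPolytope d) (τ : Finset (Fin d → ℝ)) : FinGraph (Fin d → ℝ) :=
  ⟨P.V.filter fun v => BFace P (insert v τ),
   P.V.powerset.filter fun e => e.card = 2 ∧ BFace P (e ∪ τ)⟩

/-- Adjacency in the graph of `∂P`. -/
def Adj {d : ℕ} (P : SPolytope d) (u v : Fin d → ℝ) : Prop :=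
  u ≠ v ∧ BFace P {u, v}

/-- `σ` is a face of the link of the face `τ` in `∂P`. -/
def LinkFace {d : ℕ} (P : SPolytope d) (τ σ : Finset (Fin d → ℝ)) : Prop :=
  Disjoint σ τ ∧ BFace P (σ ∪ τ)

/-- `P` is a `d`-dimensional cross-polytope: its vertex set is `{±b₁, …, ±b_d}`
for some basis `b₁, …, b_d` of `ℝ^d`. -/
def IsCrossPolytope {d : ℕ} (P : SPolytope d) : Prop :=
  ∃ b : Fin d → (Fin d → ℝ), LinearIndependent ℝ b ∧
    (P.V : Set (Fin d → ℝ)) = Set.range b ∪ Set.range (fun i => -(b i))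

/-- A facet of `P`: a proper face with `d` vertices. -/
def IsFacet {d : ℕ} (P : SPolytope d) (F : Set (Fin d → ℝ)) : Prop :=
  IsProperFace P.V F ∧ ((P.V : Set (Fin d → ℝ)) ∩ F).ncard = d

/-- `x` lies beyond exactly one facet of `P`: it is strictly separated from `P` by the
affine hull of one facet `F`, and not separated from `P` by the affine hull of any
other facet. -/
def BeyondExactlyOne {d : ℕ} (P : SPolytope d) (x : Fin d → ℝ) : Prop :=
  ∃ F : Set (Fin d → ℝ), IsFacet P F ∧
    (∀ f c, IsSupport P.V f c F → c < f x) ∧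
    (∀ F' : Set (Fin d → ℝ), IsFacet P F' → F' ≠ F →
      ∀ f c, IsSupport P.V f c F' → f x < c)

/-- `P` is obtained from a `d`-dimensional cross-polytope by symmetric stacking: there is
a sequence of cs simplicial `d`-polytopes starting at a cross-polytope and ending at `P`,
each obtained from the previous one as `conv (P_k ∪ {v, -v})` for a point `v` lying
beyond exactly one facet of `P_k`. -/
def SymmetricStackingFrom {d : ℕ} (P : SPolytope d) : Prop :=
  ∃ (m : ℕ) (Q : Fin (m + 1) → SPolytope d),
    (∀ k, IsCS (Q k)) ∧
    IsCrossPolytope (Q 0) ∧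
    Q (Fin.last m) = P ∧
    ∀ k : Fin m, ∃ v : Fin d → ℝ,
      BeyondExactlyOne (Q (Fin.castSucc k)) v ∧
      polyBody (Q (Fin.succ k)).V =
        convexHull ℝ (polyBody (Q (Fin.castSucc k)).V ∪ {v, -v})

/-- `P` is a stacked `d`-polytope: obtained from a `d`-simplex by repeatedly adding a
point beyond exactly one facet. -/
def IsStacked {d : ℕ} (P : SPolytope d) : Prop :=
  ∃ (m : ℕ) (R : Fin (m + 1) → SPolytope d),
    (R 0).V.card = d + 1 ∧
    R (Fin.last m) = P ∧
    ∀ k : Fin m, ∃ v : Fin d → ℝ,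
      BeyondExactlyOne (R (Fin.castSucc k)) v ∧
      polyBody (R (Fin.succ k)).V =
        convexHull ℝ (polyBody (R (Fin.castSucc k)).V ∪ {v})

/-- Every `d` vertices of `P`, no two of which are antipodal, are affinely independent. -/
def GenPos {d : ℕ} (P : SPolytope d) : Prop :=
  ∀ S : Finset (Fin d → ℝ), S ⊆ P.V → S.card = d →
    (∀ x ∈ S, ∀ y ∈ S, x ≠ -y) →
    AffineIndependent ℝ (fun s : {x : Fin d → ℝ // x ∈ S} => (s : Fin d → ℝ))

/-- The graph of the cone `v₀ * S` over a simplicial complex `S` (a set of finsets):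
the vertices of `S` together with `v₀`, and the edges of `S` together with all edges
from `v₀` to vertices of `S`. -/
def coneGraph {d : ℕ} (P : SPolytope d) (v0 : Fin d → ℝ)
    (S : Set (Finset (Fin d → ℝ))) : FinGraph (Fin d → ℝ) :=
  ⟨insert v0 (P.V.filter fun u => ({u} : Finset (Fin d → ℝ)) ∈ S),
   (P.V.powerset.filter fun e => e.card = 2 ∧ e ∈ S) ∪
     (P.V.filter fun u => ({u} : Finset (Fin d → ℝ)) ∈ S).image
       fun u => ({v0, u} : Finset (Fin d → ℝ))⟩

set_option linter.unusedSectionVars false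
set_option linter.unusedVariables false

namespace R18

section LA
variable {ι U : Type} [DecidableEq ι] [AddCommGroup U] [Module ℝ U] [FiniteDimensional ℝ U]

lemma exists_dual {p : ι → U} {s : Finset ι} (h : LinearIndepOn ℝ p (s : Set ι)) (c : ι → ℝ) :
    ∃ φ : Module.Dual ℝ U, ∀ x ∈ s, φ (p x) = c x := by
  have h' : LinearIndependent ℝ (fun x : (s : Set ι) => p x) := h
  obtain ⟨φ, hφ⟩ := LinearMap.exists_extend ((Module.Basis.span h').constr ℝ (fun x : (s : Set ι) => c x))
  refine ⟨φ, fun x hx => ?_⟩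
  have h1 := LinearMap.congr_fun hφ (Module.Basis.span h' ⟨x, hx⟩)
  rw [Module.Basis.constr_basis] at h1
  simpa [Module.Basis.span_apply] using h1

lemma finrank_span_indep {p : ι → U} {s : Finset ι} (h : LinearIndepOn ℝ p (s : Set ι)) :
    Module.finrank ℝ (Submodule.span ℝ (p '' (s : Set ι))) = s.card := by
  have h' : LinearIndependent ℝ (fun x : (s : Set ι) => p x) := h
  have := finrank_span_eq_card (R := ℝ) h'
  rw [Set.image_eq_range]
  rw [this]; simp

lemma span_le_ker {p : ι → U} {s : Finset ι} {F : Module.Dual ℝ U}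
    (hF : ∀ x ∈ s, F (p x) = 0) :
    Submodule.span ℝ (p '' (s : Set ι)) ≤ LinearMap.ker F := by
  rw [Submodule.span_le]
  rintro _ ⟨x, hx, rfl⟩
  exact hF x hx

lemma card_lt_of_kill {p : ι → U} {s : Finset ι} (h : LinearIndepOn ℝ p (s : Set ι))
    {F : Module.Dual ℝ U} (hF0 : F ≠ 0) (hF : ∀ x ∈ s, F (p x) = 0) :
    s.card + 1 ≤ Module.finrank ℝ U := by
  have h1 := finrank_span_indep h
  have h2 := Submodule.finrank_mono (span_le_ker hF)
  have h3 : LinearMap.ker F < ⊤ := lt_top_iff_ne_top.2 (fun hh => hF0 (LinearMap.ker_eq_top.1 hh))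
  have h4 := Submodule.finrank_lt h3.ne
  omega

lemma indep_insert {p : ι → U} {s : Finset ι} (h : LinearIndepOn ℝ p (s : Set ι)) {x : ι}
    {F : Module.Dual ℝ U} (hF : ∀ y ∈ s, F (p y) = 0) (hx : F (p x) ≠ 0) :
    LinearIndepOn ℝ p ((insert x s : Finset ι) : Set ι) := by
  rw [Finset.coe_insert]
  refine LinearIndepOn.insert h (fun hm => hx ?_)
  exact span_le_ker hF hm

lemma span_eq_top_of_card {p : ι → U} {s : Finset ι} (h : LinearIndepOn ℝ p (s : Set ι))
    (hc : s.card = Module.finrank ℝ U) : Submodule.span ℝ (p '' (s : Set ι)) = ⊤ :=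
  Submodule.eq_top_of_finrank_eq (by rw [finrank_span_indep h, hc])

lemma dual_eq_zero_of_full {p : ι → U} {s : Finset ι} (h : LinearIndepOn ℝ p (s : Set ι))
    (hc : s.card = Module.finrank ℝ U) {F : Module.Dual ℝ U} (hF : ∀ x ∈ s, F (p x) = 0) :
    F = 0 := by
  have := span_le_ker hF
  rw [span_eq_top_of_card h hc, top_le_iff] at this
  exact LinearMap.ker_eq_top.1 this

lemma eq_smul_of_corank_one {p : ι → U} {s : Finset ι} (h : LinearIndepOn ℝ p (s : Set ι))
    (hc : s.card + 1 = Module.finrank ℝ U) {F H : Module.Dual ℝ U} (hF0 : F ≠ 0)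
    (hF : ∀ x ∈ s, F (p x) = 0) (hH : ∀ x ∈ s, H (p x) = 0) : ∃ c : ℝ, H = c • F := by
  have h3 : LinearMap.ker F < ⊤ := lt_top_iff_ne_top.2 (fun hh => hF0 (LinearMap.ker_eq_top.1 hh))
  have h4 := Submodule.finrank_lt h3.ne
  have hker : Submodule.span ℝ (p '' (s : Set ι)) = LinearMap.ker F := by
    refine Submodule.eq_of_le_of_finrank_le (span_le_ker hF) ?_
    rw [finrank_span_indep h]; omega
  obtain ⟨y, hy⟩ : ∃ y, F y ≠ 0 := by
    by_contra hcon; push Not at hcon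
    exact hF0 (LinearMap.ext hcon)
  refine ⟨H y / F y, LinearMap.ext fun x => ?_⟩
  have hx : x - (F x / F y) • y ∈ LinearMap.ker F := by
    simp [hy]
  rw [← hker] at hx
  have := span_le_ker hH hx
  simp at this
  simp
  field_simp at this ⊢
  linarith

lemma exists_not_multiple {p : ι → U} {s : Finset ι} (hc : s.card + 2 ≤ Module.finrank ℝ U)
    (F : Module.Dual ℝ U) :
    ∃ F' : Module.Dual ℝ U, (∀ x ∈ s, F' (p x) = 0) ∧ ∀ c : ℝ, F' ≠ c • F := by
  by_contra hcon
  push Not at hcon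
  have h1 : (Submodule.span ℝ (p '' (s : Set ι))).dualAnnihilator ≤ Submodule.span ℝ {F} := by
    intro H hH
    obtain ⟨c, hc⟩ := hcon H (fun x hx => by
      rw [Submodule.mem_dualAnnihilator] at hH
      exact hH _ (Submodule.subset_span ⟨x, hx, rfl⟩))
    rw [Submodule.mem_span_singleton]
    exact ⟨c, hc.symm⟩
  have h2 := Submodule.finrank_mono h1
  have h3 : Module.finrank ℝ (Submodule.span ℝ {F}) ≤ 1 := by
    simpa using finrank_span_le_card (R := ℝ) ({F} : Set (Module.Dual ℝ U))
  have h4 := Subspace.finrank_add_finrank_dualAnnihilator_eq (Submodule.span ℝ (p '' (s : Set ι)))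
  have h5 : Module.finrank ℝ (Submodule.span ℝ (p '' (s : Set ι))) ≤ s.card := by
    have := finrank_span_finset_le_card (R := ℝ) (s.image p)
    rw [Finset.coe_image] at this
    exact this.trans Finset.card_image_le
  omega

lemma exists_dual_kill {p : ι → U} {s : Finset ι} (hc : s.card + 1 ≤ Module.finrank ℝ U) :
    ∃ F : Module.Dual ℝ U, (∀ x ∈ s, F (p x) = 0) ∧ F ≠ 0 := by
  have h5 : Module.finrank ℝ (Submodule.span ℝ (p '' (s : Set ι))) ≤ s.card := by
    have := finrank_span_finset_le_card (R := ℝ) (s.image p)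
    rw [Finset.coe_image] at this
    exact this.trans Finset.card_image_le
  have hlt : Submodule.span ℝ (p '' (s : Set ι)) < ⊤ := by
    refine lt_top_iff_ne_top.2 fun h => ?_
    rw [h, finrank_top] at h5
    omega
  obtain ⟨F, hF0, hF⟩ := Submodule.exists_le_ker_of_lt_top _ hlt
  exact ⟨F, fun x hx => hF (Submodule.subset_span ⟨x, hx, rfl⟩), hF0⟩

end LA

section Conf
variable {ι U : Type} [DecidableEq ι] [AddCommGroup U] [Module ℝ U]

def Fc (X : Finset ι) (p : ι → U) (s : Finset ι) : Prop :=
  s ⊆ X ∧ ∃ F : Module.Dual ℝ U, F ≠ 0 ∧ (∀ x ∈ X, 0 ≤ F (p x)) ∧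
    ∀ x ∈ X, (F (p x) = 0 ↔ x ∈ s)

structure Cfg (X : Finset ι) (p : ι → U) : Prop where
  span : ∀ F : Module.Dual ℝ U, (∀ x ∈ X, F (p x) = 0) → F = 0
  simp : ∀ F : Module.Dual ℝ U, F ≠ 0 → (∀ x ∈ X, 0 ≤ F (p x)) →
    LinearIndepOn ℝ p ((X.filter fun x => F (p x) = 0 : Finset ι) : Set ι)
  vert : ∀ x ∈ X, Fc X p {x}

variable [FiniteDimensional ℝ U] {X : Finset ι} {p : ι → U}

lemma big_K (X : Finset ι) (a b : ι → ℝ) (s : Finset ι) (ha : ∀ x ∈ X, x ∉ s → 0 < a x) :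
    ∃ K : ℝ, 0 < K ∧ ∀ x ∈ X, x ∉ s → 0 < K * a x + b x := by
  refine ⟨1 + ∑ x ∈ X \ s, |b x| / a x, ?_, ?_⟩
  · have : 0 ≤ ∑ x ∈ X \ s, |b x| / a x := Finset.sum_nonneg fun x hx => by
      rw [Finset.mem_sdiff] at hx
      have := ha x hx.1 hx.2
      positivity
    linarith
  · intro x hx hxs
    have h0 := ha x hx hxs
    have h1 : |b x| / a x ≤ ∑ x ∈ X \ s, |b x| / a x :=
      Finset.single_le_sum (f := fun x => |b x| / a x) (fun y hy => by
        rw [Finset.mem_sdiff] at hy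
        have := ha y hy.1 hy.2
        positivity) (Finset.mem_sdiff.2 ⟨hx, hxs⟩)
    have h2 : |b x| = |b x| / a x * a x := by field_simp
    have h3 := neg_abs_le (b x)
    nlinarith [mul_le_mul_of_nonneg_right h1 h0.le]

lemma Cfg.indep (hC : Cfg X p) {F : Module.Dual ℝ U} (hF : F ≠ 0) (hpos : ∀ x ∈ X, 0 ≤ F (p x))
    {s : Finset ι} (hs : s ⊆ X) (h0 : ∀ x ∈ s, F (p x) = 0) :
    LinearIndepOn ℝ p (s : Set ι) :=
  (hC.simp F hF hpos).mono (by
    intro x hx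
    simp only [Finset.coe_filter, Set.mem_ofPred_eq]
    exact ⟨hs hx, h0 x hx⟩)

lemma Cfg.Fc_of_sub (hC : Cfg X p) {F : Module.Dual ℝ U} (hF : F ≠ 0)
    (hpos : ∀ x ∈ X, 0 ≤ F (p x))
    {s : Finset ι} (hs : s ⊆ X) (h0 : ∀ x ∈ s, F (p x) = 0) : Fc X p s := by
  obtain ⟨φ, hφ⟩ := exists_dual (hC.simp F hF hpos) (fun x => if x ∈ s then 0 else 1)
  obtain ⟨K, hK, hK'⟩ := big_K X (fun x => F (p x)) (fun x => φ (p x))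
    (X.filter fun x => F (p x) = 0) (fun x hx hx' => by
      simp only [Finset.mem_filter, hx, true_and] at hx'
      exact lt_of_le_of_ne (hpos x hx) (Ne.symm hx'))
  have key : ∀ x ∈ X, (x ∈ s ∧ (K • F + φ) (p x) = 0) ∨ (x ∉ s ∧ 0 < (K • F + φ) (p x)) := by
    intro x hx
    by_cases hz : F (p x) = 0
    · have := hφ x (by simp [hx, hz])
      by_cases hxs : x ∈ s
      · left; simp [hxs, hz, this]
      · right; simp [hxs, hz, this]
    · right
      refine ⟨fun h => hz (h0 x h), ?_⟩
      have := hK' x hx (by simp [hz])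
      simpa using this
  refine ⟨hs, K • F + φ, ?_, ?_, ?_⟩
  · intro h
    apply hF
    apply hC.span
    intro x hx
    rcases key x hx with h1 | h1
    · exact h0 x h1.1
    · rw [h] at h1; simp at h1
  · intro x hx
    rcases key x hx with h1 | h1
    · exact h1.2.ge
    · exact h1.2.le
  · intro x hx
    rcases key x hx with h1 | h1
    · exact ⟨fun _ => h1.1, fun _ => h1.2⟩
    · exact ⟨fun h => absurd h h1.2.ne', fun h => absurd h h1.1⟩

lemma Cfg.mono (hC : Cfg X p) {s t : Finset ι} (hs : Fc X p s) (hts : t ⊆ s) : Fc X p t := by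
  obtain ⟨hsX, F, hF, hpos, hz⟩ := hs
  exact hC.Fc_of_sub hF hpos (hts.trans hsX) (fun x hx => (hz x (hsX (hts hx))).2 (hts hx))

lemma Cfg.Fc_indep (hC : Cfg X p) {s : Finset ι} (hs : Fc X p s) :
    LinearIndepOn ℝ p (s : Set ι) := by
  obtain ⟨hsX, F, hF, hpos, hz⟩ := hs
  exact hC.indep hF hpos hsX (fun x hx => (hz x (hsX hx)).2 hx)

lemma Cfg.Fc_card (hC : Cfg X p) {s : Finset ι} (hs : Fc X p s) :
    s.card + 1 ≤ Module.finrank ℝ U := by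
  have h := hC.Fc_indep hs
  obtain ⟨hsX, F, hF, hpos, hz⟩ := hs
  exact card_lt_of_kill h hF (fun x hx => (hz x (hsX hx)).2 hx)

/-- `η` exposes the face `G`. -/
structure Exposes (X : Finset ι) (p : ι → U) (G : Finset ι) (η : Module.Dual ℝ U) : Prop where
  sub : G ⊆ X
  ne : η ≠ 0
  zero : ∀ x ∈ G, η (p x) = 0
  pos : ∀ x ∈ X, x ∉ G → 0 < η (p x)

lemma Exposes.nonneg {G : Finset ι} {η : Module.Dual ℝ U} (h : Exposes X p G η) :
    ∀ x ∈ X, 0 ≤ η (p x) := by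
  intro x hx
  by_cases hxG : x ∈ G
  · exact (h.zero x hxG).ge
  · exact (h.pos x hx hxG).le

lemma Fc.exposes {G : Finset ι} (h : Fc X p G) : ∃ η, Exposes X p G η := by
  obtain ⟨hsX, F, hF, hpos, hz⟩ := h
  exact ⟨F, hsX, hF, fun x hx => (hz x (hsX hx)).2 hx, fun x hx hxG =>
    lt_of_le_of_ne (hpos x hx) (fun h => hxG ((hz x hx).1 h.symm))⟩

lemma Exposes.Fc {G : Finset ι} {η : Module.Dual ℝ U} (h : Exposes X p G η) : Fc X p G :=
  ⟨h.sub, η, h.ne, h.nonneg, fun x hx => ⟨fun h0 => by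
    by_contra hxG; exact (h.pos x hx hxG).ne' h0, h.zero x⟩⟩

lemma Cfg.exists_not_mem (hC : Cfg X p) {G : Finset ι} {η : Module.Dual ℝ U}
    (h : Exposes X p G η) : ∃ x ∈ X, x ∉ G := by
  by_contra hcon
  push Not at hcon
  exact h.ne (hC.span η (fun x hx => h.zero x (hcon x hx)))

/-- master lemma: minimise `F/η`. -/
lemma Cfg.min_ratio (hC : Cfg X p) {G : Finset ι} {η : Module.Dual ℝ U}
    (h : Exposes X p G η) {F : Module.Dual ℝ U} (hF : ∀ x ∈ G, F (p x) = 0)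
    (hne : ∀ c : ℝ, F ≠ c • η) :
    ∃ x ∈ X, x ∉ G ∧ Fc X p (insert x G) ∧
      ∀ y ∈ X, y ∉ G → F (p x) / η (p x) ≤ F (p y) / η (p y) := by
  obtain ⟨z, hz, hzG⟩ := hC.exists_not_mem h
  obtain ⟨x, hx, hmin⟩ := Finset.exists_min_image (X \ G) (fun y => F (p y) / η (p y))
    ⟨z, Finset.mem_sdiff.2 ⟨hz, hzG⟩⟩
  rw [Finset.mem_sdiff] at hx
  refine ⟨x, hx.1, hx.2, ?_, fun y hy hyG => hmin y (Finset.mem_sdiff.2 ⟨hy, hyG⟩)⟩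
  set r := F (p x) / η (p x) with hr
  refine hC.Fc_of_sub (F := F - r • η) ?_ ?_ ?_ ?_
  · intro h0
    exact hne r (sub_eq_zero.1 h0)
  · intro y hy
    by_cases hyG : y ∈ G
    · simp [hF y hyG, h.zero y hyG]
    · have h1 := hmin y (Finset.mem_sdiff.2 ⟨hy, hyG⟩)
      have h2 := h.pos y hy hyG
      rw [le_div_iff₀ h2] at h1
      simp
      exact h1
  · exact Finset.insert_subset hx.1 h.sub
  · intro y hy
    rw [Finset.mem_insert] at hy
    rcases hy with rfl | hy
    · have h2 := h.pos y hx.1 hx.2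
      simp [hr]
      field_simp
      simp
    · simp [hF y hy, h.zero y hy]

lemma Cfg.LP (hC : Cfg X p) {G : Finset ι} (hG : Fc X p G)
    (hc : G.card + 2 ≤ Module.finrank ℝ U) {F : Module.Dual ℝ U} (hF : ∀ x ∈ G, F (p x) = 0)
    (hpos : ∀ x ∈ X, x ∉ G → Fc X p (insert x G) → 0 ≤ F (p x)) :
    ∀ x ∈ X, 0 ≤ F (p x) := by
  obtain ⟨η, hη⟩ := hG.exposes
  by_cases hm : ∃ c : ℝ, F = c • η
  · obtain ⟨c, rfl⟩ := hm
    obtain ⟨F', hF', hne⟩ := exists_not_multiple (p := p) hc η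
    obtain ⟨x, hx, hxG, hxF, -⟩ := hC.min_ratio hη hF' hne
    have h1 := hpos x hx hxG hxF
    have h2 := hη.pos x hx hxG
    simp at h1
    have h3 : 0 ≤ c := by
      by_contra hc; push Not at hc
      nlinarith
    intro y hy
    have := hη.nonneg y hy
    simp; positivity
  · push Not at hm
    obtain ⟨x, hx, hxG, hxF, hmin⟩ := hC.min_ratio hη hF hm
    have h1 := hpos x hx hxG hxF
    have h2 := hη.pos x hx hxG
    intro y hy
    by_cases hyG : y ∈ G
    · exact (hF y hyG).ge
    · have h3 := hmin y hy hyG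
      have h4 : 0 ≤ F (p x) / η (p x) := by positivity
      have h5 := hη.pos y hy hyG
      have h6 := h4.trans h3
      have h7 := mul_nonneg h6 h5.le
      rwa [div_mul_cancel₀ _ h5.ne'] at h7

lemma Cfg.extend (hC : Cfg X p) {G : Finset ι} (hG : Fc X p G)
    (hc : G.card + 2 ≤ Module.finrank ℝ U) : ∃ x ∈ X, x ∉ G ∧ Fc X p (insert x G) := by
  obtain ⟨η, hη⟩ := hG.exposes
  obtain ⟨F', hF', hne⟩ := exists_not_multiple (p := p) hc η
  obtain ⟨x, hx, hxG, hxF, -⟩ := hC.min_ratio hη hF' hne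
  exact ⟨x, hx, hxG, hxF⟩

lemma Cfg.extend_to (hC : Cfg X p) {k : ℕ} (hk : k + 1 ≤ Module.finrank ℝ U) {G : Finset ι}
    (hG : Fc X p G) (hGk : G.card ≤ k) : ∃ σ, G ⊆ σ ∧ Fc X p σ ∧ σ.card = k := by
  induction hn : k - G.card generalizing G with
  | zero => exact ⟨G, subset_rfl, hG, by omega⟩
  | succ n ih =>
    obtain ⟨x, hx, hxG, hxF⟩ := hC.extend hG (by omega)
    have hcard : (insert x G).card = G.card + 1 := Finset.card_insert_of_notMem hxG
    obtain ⟨σ, h1, h2, h3⟩ := ih hxF (by omega) (by omega)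
    exact ⟨σ, (Finset.subset_insert x G).trans h1, h2, h3⟩

lemma Cfg.exists_facet (hC : Cfg X p) {G : Finset ι}
    (hG : Fc X p G) : ∃ σ, G ⊆ σ ∧ Fc X p σ ∧ σ.card + 1 = Module.finrank ℝ U := by
  have h := hC.Fc_card hG
  obtain ⟨σ, h1, h2, h3⟩ := hC.extend_to (k := Module.finrank ℝ U - 1) (by omega) hG (by omega)
  exact ⟨σ, h1, h2, by omega⟩

lemma Cfg.empty (hC : Cfg X p) (hX : X.Nonempty) : Fc X p ∅ := by
  obtain ⟨x, hx⟩ := hX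
  exact hC.mono (hC.vert x hx) (Finset.empty_subset _)

/-- Two functionals vanishing on a codimension-two face: at most two facets. -/
lemma Cfg.hinge_three (hC : Cfg X p) {G : Finset ι} (hc : G.card + 2 = Module.finrank ℝ U)
    {a b c : ι} (hab : a ≠ b) (hac : a ≠ c) (hbc : b ≠ c)
    (ha : a ∉ G) (hb : b ∉ G) (hcG : c ∉ G)
    (hFa : Fc X p (insert a G)) (hFb : Fc X p (insert b G)) (hFc : Fc X p (insert c G)) :
    False := by
  obtain ⟨ρa, h1⟩ := hFa.exposes
  obtain ⟨ρb, h2⟩ := hFb.exposes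
  obtain ⟨ρc, h3⟩ := hFc.exposes
  have haX : a ∈ X := h1.sub (Finset.mem_insert_self _ _)
  have hbX : b ∈ X := h2.sub (Finset.mem_insert_self _ _)
  have hcX : c ∈ X := h3.sub (Finset.mem_insert_self _ _)
  have hab' : 0 < ρa (p b) := h1.pos b hbX (by simp [hab.symm, hb])
  have hba' : 0 < ρb (p a) := h2.pos a haX (by simp [hab, ha])
  have hca : 0 < ρc (p a) := h3.pos a haX (by simp [hac, ha])
  have hcb : 0 < ρc (p b) := h3.pos b hbX (by simp [hbc, hb])
  have hac' : 0 < ρa (p c) := h1.pos c hcX (by simp [hac.symm, hcG])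
  have hbc' : 0 < ρb (p c) := h2.pos c hcX (by simp [hbc.symm, hcG])
  have haa : ρa (p a) = 0 := h1.zero a (Finset.mem_insert_self _ _)
  have hbb : ρb (p b) = 0 := h2.zero b (Finset.mem_insert_self _ _)
  have hcc : ρc (p c) = 0 := h3.zero c (Finset.mem_insert_self _ _)
  have hi : LinearIndepOn ℝ p ((insert b (insert a G) : Finset ι) : Set ι) :=
    indep_insert (hC.Fc_indep hFa) h1.zero hab'.ne'
  have hcard : (insert b (insert a G)).card = Module.finrank ℝ U := by
    rw [Finset.card_insert_of_notMem (by simp [hab.symm, hb]), Finset.card_insert_of_notMem ha]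
    omega
  have h0 : ρc - (ρc (p b) / ρa (p b)) • ρa - (ρc (p a) / ρb (p a)) • ρb = 0 := by
    apply dual_eq_zero_of_full hi hcard
    intro x hx
    simp only [Finset.mem_insert] at hx
    rcases hx with rfl | rfl | hx
    · simp [hbb, hab'.ne']
    · simp [haa, hba'.ne']
    · simp [h1.zero x (Finset.mem_insert_of_mem hx), h2.zero x (Finset.mem_insert_of_mem hx),
        h3.zero x (Finset.mem_insert_of_mem hx)]
  have h4 := LinearMap.congr_fun h0 (p c)
  simp [hcc] at h4
  have : 0 < ρc (p b) / ρa (p b) * ρa (p c) := by positivity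
  have : 0 < ρc (p a) / ρb (p a) * ρb (p c) := by positivity
  linarith

lemma Cfg.hinge (hC : Cfg X p) {G : Finset ι} (hG : Fc X p G)
    (hc : G.card + 2 = Module.finrank ℝ U) :
    ∃ a b, a ≠ b ∧ a ∉ G ∧ b ∉ G ∧ Fc X p (insert a G) ∧ Fc X p (insert b G) ∧
      ∀ c, c ∉ G → Fc X p (insert c G) → c = a ∨ c = b := by
  obtain ⟨η, hη⟩ := hG.exposes
  obtain ⟨F', hF', hne⟩ := exists_not_multiple (p := p) hc.le η
  obtain ⟨a, haX, haG, haF, hamin⟩ := hC.min_ratio hη hF' hne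
  obtain ⟨b, hbX, hbG, hbF, hbmin⟩ := hC.min_ratio hη (F := -F') (fun x hx => by simp [hF' x hx])
    (fun c hc => hne (-c) (LinearMap.ext fun x => by
      have := LinearMap.congr_fun hc x
      simp at this ⊢
      linarith))
  have hab : a ≠ b := by
    rintro rfl
    apply hne (F' (p a) / η (p a))
    rw [← sub_eq_zero]
    apply hC.span
    intro x hx
    by_cases hxG : x ∈ G
    · simp [hF' x hxG, hη.zero x hxG]
    · have h1 := hamin x hx hxG
      have h2 := hbmin x hx hxG
      simp only [LinearMap.neg_apply, neg_div, neg_le_neg_iff] at h2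
      have h3 := le_antisymm h1 h2
      have h4 := hη.pos x hx hxG
      simp only [LinearMap.sub_apply, LinearMap.smul_apply, smul_eq_mul]
      rw [h3, div_mul_cancel₀ _ h4.ne', sub_self]
  refine ⟨a, b, hab, haG, hbG, haF, hbF, fun c hcG hcF => ?_⟩
  by_contra hcon
  push Not at hcon
  exact hC.hinge_three hc hab (Ne.symm hcon.1) (Ne.symm hcon.2) haG hbG hcG haF hbF hcF

/-- Connectivity of the positive part of the link. -/
lemma Cfg.conn_max (hC : Cfg X p) {G : Finset ι} {η : Module.Dual ℝ U}
    (h : Exposes X p G η) (hc : G.card + 3 ≤ Module.finrank ℝ U)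
    {F : Module.Dual ℝ U} (hF : ∀ x ∈ G, F (p x) = 0)
    (Q : ι → Prop)
    (hQ : ∀ a b, a ∉ G → b ∉ G → a ≠ b → 0 < F (p a) → 0 < F (p b) →
      Fc X p (insert a (insert b G)) → Q a → Q b)
    {a : ι} (haG : a ∉ G) (ha : Fc X p (insert a G)) (hapos : 0 < F (p a)) (hQa : Q a) :
    ∃ c ∈ X, c ∉ G ∧ 0 < F (p c) ∧ Q c ∧
      ∀ y ∈ X, y ∉ G → F (p y) / η (p y) ≤ F (p c) / η (p c) := by
  set T := X.filter (fun c => c ∉ G ∧ Fc X p (insert c G) ∧ 0 < F (p c) ∧ Q c) with hT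
  have haX : a ∈ X := ha.1 (Finset.mem_insert_self _ _)
  obtain ⟨c, hcT, hmax⟩ := Finset.exists_max_image T (fun y => F (p y) / η (p y))
    ⟨a, by simp [hT, haX, haG, ha, hapos, hQa]⟩
  simp only [hT, Finset.mem_filter] at hcT
  obtain ⟨hcX, hcG, hcF, hcpos, hcQ⟩ := hcT
  refine ⟨c, hcX, hcG, hcpos, hcQ, ?_⟩
  set r := F (p c) / η (p c) with hr
  have hηc := h.pos c hcX hcG
  have hrpos : 0 < r := by positivity
  have hLP := hC.LP hcF (F := r • η - F) (by
    rw [Finset.card_insert_of_notMem hcG]; omega) (by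
    intro x hx
    rw [Finset.mem_insert] at hx
    rcases hx with rfl | hx
    · simp [hr, hηc.ne']
    · simp [hF x hx, h.zero x hx]) (by
    intro x hx hxG hxF
    by_contra hcon
    push Not at hcon
    simp at hcon
    simp only [Finset.mem_insert, not_or] at hxG
    have hηx := h.pos x hx hxG.2
    have hxpos : 0 < F (p x) := lt_trans (by positivity) hcon
    have hxT : x ∈ T := by
      simp only [hT, Finset.mem_filter]
      refine ⟨hx, hxG.2, hC.mono hxF ?_, hxpos, ?_⟩
      · exact Finset.insert_subset_insert _ (Finset.subset_insert _ _)
      · exact hQ c x hcG hxG.2 (Ne.symm hxG.1) hcpos hxpos (by rwa [Finset.insert_comm]) hcQ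
    have := hmax x hxT
    rw [div_le_iff₀ hηx] at this
    linarith)
  intro y hy hyG
  have h1 := hLP y hy
  simp at h1
  rw [div_le_iff₀ (h.pos y hy hyG)]
  linarith

lemma Cfg.conn_pos (hC : Cfg X p) {G : Finset ι} {η : Module.Dual ℝ U}
    (h : Exposes X p G η) (hc : G.card + 3 ≤ Module.finrank ℝ U)
    {F : Module.Dual ℝ U} (hF : ∀ x ∈ G, F (p x) = 0) (hne : ∀ c : ℝ, F ≠ c • η)
    (Q : ι → Prop)
    (hQ : ∀ a b, a ∉ G → b ∉ G → a ≠ b → 0 < F (p a) → 0 < F (p b) →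
      Fc X p (insert a (insert b G)) → Q a → Q b)
    {a b : ι} (haG : a ∉ G) (ha : Fc X p (insert a G)) (hapos : 0 < F (p a)) (hQa : Q a)
    (hbG : b ∉ G) (hb : Fc X p (insert b G)) (hbpos : 0 < F (p b)) : Q b := by
  by_contra hQb
  obtain ⟨c, hcX, hcG, hcpos, hcQ, hcmax⟩ := hC.conn_max h hc hF Q hQ haG ha hapos hQa
  obtain ⟨c', hcX', hcG', hcpos', hcQ', hcmax'⟩ := hC.conn_max h hc hF (fun x => ¬ Q x)
    (fun x y hx hy hxy hxp hyp hf hq hq' => hq (hQ y x hy hx hxy.symm hyp hxp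
      (by rwa [Finset.insert_comm]) hq')) hbG hb hbpos hQb
  have hcc : c ≠ c' := by rintro rfl; exact hcQ' hcQ
  refine hcQ' (hQ c c' hcG hcG' hcc hcpos hcpos' ?_ hcQ)
  have heq := le_antisymm (hcmax c' hcX' hcG') (hcmax' c hcX hcG)
  set r := F (p c) / η (p c) with hr
  have hηc := h.pos c hcX hcG
  have hηc' := h.pos c' hcX' hcG'
  refine hC.Fc_of_sub (F := r • η - F) ?_ ?_ ?_ ?_
  · intro h0
    exact hne r (sub_eq_zero.1 h0).symm
  · intro y hy
    by_cases hyG : y ∈ G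
    · simp [hF y hyG, h.zero y hyG]
    · have h1 := hcmax y hy hyG
      rw [div_le_iff₀ (h.pos y hy hyG)] at h1
      simp; linarith
  · exact Finset.insert_subset hcX (Finset.insert_subset hcX' h.sub)
  · intro x hx
    simp only [Finset.mem_insert] at hx
    rcases hx with rfl | rfl | hx
    · simp [hr, hηc.ne']
    · simp [← heq, hηc'.ne']
    · simp [hF x hx, h.zero x hx]

/-- The link of `G` minus the vertices of a face of the link is connected. -/
lemma Cfg.conn (hC : Cfg X p) {G S : Finset ι} (hGS : Fc X p (G ∪ S))
    (hc : G.card + 3 ≤ Module.finrank ℝ U) (Q : ι → Prop)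
    (hQ : ∀ a b, a ∉ G ∪ S → b ∉ G ∪ S → a ≠ b → Fc X p (insert a (insert b G)) → Q a → Q b)
    {a b : ι} (haG : a ∉ G ∪ S) (ha : Fc X p (insert a G)) (hQa : Q a)
    (hbG : b ∉ G ∪ S) (hb : Fc X p (insert b G)) : Q b := by
  have hG : Fc X p G := hC.mono hGS Finset.subset_union_left
  obtain ⟨η, hη⟩ := hG.exposes
  obtain ⟨ρ, hρ⟩ := hGS.exposes
  have haX : a ∈ X := ha.1 (Finset.mem_insert_self _ _)
  have hbX : b ∈ X := hb.1 (Finset.mem_insert_self _ _)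
  have hnG : ∀ {x}, x ∉ G ∪ S → x ∉ G := fun hx h => hx (Finset.mem_union_left _ h)
  have key : ∃ F : Module.Dual ℝ U, (∀ x ∈ G, F (p x) = 0) ∧ (∀ c : ℝ, F ≠ c • η) ∧
      (∀ x ∈ X, x ∉ G ∪ S → 0 < F (p x)) ∧ (∀ x, x ∉ G → 0 < F (p x) → x ∈ X → x ∉ G ∪ S) := by
    by_cases hm : ∃ c : ℝ, ρ = c • η
    · obtain ⟨c, hcρ⟩ := hm
      have hS : ∀ x ∈ X, x ∉ G → x ∉ G ∪ S := by
        intro x hx hxG hxS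
        have h1 := hρ.zero x hxS
        have h2 := hη.pos x hx hxG
        rw [hcρ] at h1
        simp [h2.ne'] at h1
        exact hρ.ne (by rw [hcρ, h1, zero_smul])
      obtain ⟨F', hF', hne⟩ := exists_not_multiple (p := p) (s := G) (by omega) η
      obtain ⟨K, hK, hK'⟩ := big_K X (fun x => η (p x)) (fun x => F' (p x)) G
        (fun x hx hxG => hη.pos x hx hxG)
      refine ⟨K • η + F', ?_, ?_, ?_, ?_⟩
      · intro x hx; simp [hF' x hx, hη.zero x hx]
      · intro c h0
        apply hne (c - K)
        refine LinearMap.ext fun x => ?_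
        have := LinearMap.congr_fun h0 x
        simp at this ⊢
        linarith
      · intro x hx hxG
        simpa using hK' x hx (hnG hxG)
      · intro x hxG _ hx; exact hS x hx hxG
    · push Not at hm
      refine ⟨ρ, fun x hx => hρ.zero x (Finset.mem_union_left _ hx), hm, hρ.pos, ?_⟩
      intro x _ hpos _ hxS
      exact hpos.ne' (hρ.zero x hxS)
  obtain ⟨F, hF0, hFne, hFpos, hF'⟩ := key
  refine hC.conn_pos hη hc hF0 hFne Q ?_ (hnG haG) ha (hFpos a haX haG) hQa (hnG hbG) hb
    (hFpos b hbX hbG)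
  intro x y hx hy hxy hxp hyp hf hq
  have hxX : x ∈ X := hf.1 (by simp)
  have hyX : y ∈ X := hf.1 (by simp)
  exact hQ x y (hF' x hx hxp hxX) (hF' y hy hyp hyX) hxy hf hq

end Conf
end R18

namespace R18
section
variable {ι U : Type} [DecidableEq ι] [AddCommGroup U] [Module ℝ U] [FiniteDimensional ℝ U]

structure IsD (p : ι → U) (G : Finset ι) (D : U → U → U →ₗ[ℝ] Module.Dual ℝ U) : Prop where
  d12 : ∀ x y z t, D x y z t = - D y x z t
  d23 : ∀ x y z t, D x y z t = - D x z y t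
  d34 : ∀ x y z t, D x y z t = - D x y t z
  dG : ∀ g ∈ G, ∀ x y z, D x y z (p g) = 0
  dnd : ∀ v w a, v ∉ G → w ∉ G → a ∉ G → v ≠ w → v ≠ a → w ≠ a →
    LinearIndepOn ℝ p ((insert v (insert w (insert a G)) : Finset ι) : Set ι) →
    D (p v) (p w) (p a) ≠ 0
  dsp : ∀ x y, (∀ z t, D x y z t = 0) → ∀ H H' : Module.Dual ℝ U, (∀ g ∈ G, H (p g) = 0) →
    (∀ g ∈ G, H' (p g) = 0) → H x * H' y = H y * H' x

lemma fin4_det_ne {W : Type} [AddCommGroup W] [Module ℝ W] [FiniteDimensional ℝ W]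
    (hW : Module.finrank ℝ W = 4) (b : Module.Basis (Fin 4) ℝ W) {x : Fin 4 → W}
    (hx : LinearIndependent ℝ x) : b.det x ≠ 0 := by
  have h := (b.is_basis_iff_det (v := x)).1 ⟨hx, by
    apply LinearIndependent.span_eq_top_of_card_eq_finrank' hx
    simp [hW]⟩
  exact h.ne_zero

lemma exists_isD {p : ι → U} {G : Finset ι} (hG : LinearIndepOn ℝ p (G : Set ι))
    (hc : G.card + 4 = Module.finrank ℝ U) : ∃ D, IsD p G D := by
  set S := Submodule.span ℝ (p '' (G : Set ι)) with hS
  have hW : Module.finrank ℝ (U ⧸ S) = 4 := by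
    have := Submodule.finrank_quotient_add_finrank S
    have h2 : Module.finrank ℝ S = G.card := finrank_span_indep hG
    omega
  let b := Module.finBasisOfFinrankEq ℝ (U ⧸ S) hW
  let A := b.det.compLinearMap S.mkQ
  have hA : ∀ x, A x = b.det (fun i => S.mkQ (x i)) := fun x => rfl
  have u3 : ∀ x y z t t' : U, ![x, y, z, t'] = Function.update ![x, y, z, t] 3 t' := by
    intro x y z t t'
    ext i; fin_cases i <;> simp [Function.update]
  have u2 : ∀ x y z z' t : U, ![x, y, z', t] = Function.update ![x, y, z, t] 2 z' := by
    intro x y z t t'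
    ext i; fin_cases i <;> simp [Function.update]
  let D : U → U → U →ₗ[ℝ] Module.Dual ℝ U := fun x y =>
    LinearMap.mk₂ ℝ (fun z t => A ![x, y, z, t])
      (fun z z' t => by
        rw [u2 x y z (z + z') t, A.map_update_add, ← u2, ← u2])
      (fun c z t => by
        rw [u2 x y z (c • z) t, A.map_update_smul, ← u2])
      (fun z t t' => by
        rw [u3 x y z t (t + t'), A.map_update_add, ← u3, ← u3])
      (fun c z t => by
        rw [u3 x y z t (c • t), A.map_update_smul, ← u3])
  have hD : ∀ x y z t, D x y z t = A ![x, y, z, t] := fun x y z t => rfl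
  have sw : ∀ (i j : Fin 4) (hij : i ≠ j) (x y : Fin 4 → U), y ∘ Equiv.swap i j = x →
      A x = - A y := by
    intro i j hij x y hxy
    rw [← hxy]; exact A.map_swap y hij
  have mk0 : ∀ g ∈ G, S.mkQ (p g) = 0 := by
    intro g hg
    rw [Submodule.mkQ_apply, Submodule.Quotient.mk_eq_zero]
    exact Submodule.subset_span ⟨g, hg, rfl⟩
  refine ⟨D, ?_, ?_, ?_, ?_, ?_, ?_⟩
  · intro x y z t
    rw [hD, hD]
    exact sw 0 1 (by decide) _ _ (by ext i; fin_cases i <;> rfl)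
  · intro x y z t
    rw [hD, hD]
    exact sw 1 2 (by decide) _ _ (by ext i; fin_cases i <;> rfl)
  · intro x y z t
    rw [hD, hD]
    exact sw 2 3 (by decide) _ _ (by ext i; fin_cases i <;> rfl)
  · intro g hg x y z
    rw [hD, hA]
    exact b.det.map_coord_zero 3 (mk0 g hg)
  · intro v w a hv hw ha hvw hva hwa hi h0
    have h3 : LinearIndependent ℝ ![S.mkQ (p v), S.mkQ (p w), S.mkQ (p a)] := by
      rw [Fintype.linearIndependent_iff]
      intro c hcs
      rw [Fin.sum_univ_three] at hcs
      simp only [Matrix.cons_val_zero, Matrix.cons_val_one, Matrix.cons_val_two] at hcs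
      have hmem : c 0 • p v + c 1 • p w + c 2 • p a ∈ S := by
        rw [← Submodule.Quotient.mk_eq_zero, ← Submodule.mkQ_apply]
        simpa using hcs
      have key : ∀ e : ι → ℝ, (∀ g ∈ G, e g = 0) → c 0 * e v + c 1 * e w + c 2 * e a = 0 := by
        intro e he
        obtain ⟨φ, hφ⟩ := exists_dual hi e
        have h1 := span_le_ker (p := p) (s := G) (F := φ) (fun g hg => by
          rw [hφ g (by simp [hg]), he g hg]) hmem
        simp at h1
        rwa [hφ v (by simp), hφ w (by simp), hφ a (by simp)] at h1
      have nv : ∀ {y}, y ∉ G → ∀ g ∈ G, (if g = y then (1 : ℝ) else 0) = 0 := by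
        intro y hy g hg
        rw [if_neg]; rintro rfl; exact hy hg
      have k0 := key (fun x => if x = v then 1 else 0) (nv hv)
      have k1 := key (fun x => if x = w then 1 else 0) (nv hw)
      have k2 := key (fun x => if x = a then 1 else 0) (nv ha)
      simp [hvw.symm, hva.symm] at k0
      simp [hvw, hwa.symm] at k1
      simp [hva, hwa] at k2
      intro i; fin_cases i <;> assumption
    obtain ⟨t, ht⟩ := exists_linearIndependent_snoc_of_lt_finrank h3 (by omega)
    obtain ⟨t, rfl⟩ := S.mkQ_surjective t
    apply fin4_det_ne hW b ht
    have := LinearMap.congr_fun h0 t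
    rw [hD, hA] at this
    refine Eq.trans ?_ this
    congr 1
    ext i; fin_cases i <;> rfl
  · intro x y h0 H H' hH hH'
    by_contra hne
    have h2 : LinearIndependent ℝ ![S.mkQ x, S.mkQ y] := by
      rw [LinearIndependent.pair_iff]
      intro s t hst
      have hmem : s • x + t • y ∈ S := by
        rw [← Submodule.Quotient.mk_eq_zero, ← Submodule.mkQ_apply]
        simpa using hst
      have h1 := span_le_ker hH hmem
      have h2 := span_le_ker hH' hmem
      simp at h1 h2
      constructor
      · by_contra hs
        apply hne
        have : s * (H x * H' y - H y * H' x) = 0 := by linear_combination H' y * h1 - H y * h2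
        rcases mul_eq_zero.1 this with h | h
        · exact absurd h hs
        · linarith
      · by_contra hs
        apply hne
        have : t * (H x * H' y - H y * H' x) = 0 := by linear_combination H x * h2 - H' x * h1
        rcases mul_eq_zero.1 this with h | h
        · exact absurd h hs
        · linarith
    obtain ⟨z, hz⟩ := exists_linearIndependent_snoc_of_lt_finrank h2 (by omega)
    obtain ⟨z, rfl⟩ := S.mkQ_surjective z
    obtain ⟨t, ht⟩ := exists_linearIndependent_snoc_of_lt_finrank hz (by omega)
    obtain ⟨t, rfl⟩ := S.mkQ_surjective t
    apply fin4_det_ne hW b ht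
    have := h0 z t
    rw [hD, hA] at this
    rw [← this]
    congr 1
    ext i; fin_cases i <;> rfl

/-- extension of an alternating table on an independent set -/
lemma exists_alt {p : ι → U} {σ : Finset ι} (hσ : LinearIndepOn ℝ p (σ : Set ι))
    (M : ι → Module.Dual ℝ U) (hM : ∀ v ∈ σ, ∀ w ∈ σ, M v (p w) + M w (p v) = 0) :
    ∃ B : U →ₗ[ℝ] Module.Dual ℝ U, (∀ x, B x x = 0) ∧ ∀ v ∈ σ, M v = B (p v) := by
  have h := fun v => exists_dual hσ (fun x => if x = v then 1 else 0)
  choose e he using h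
  let B : U →ₗ[ℝ] Module.Dual ℝ U := ∑ v ∈ σ, ((e v).smulRight (M v) - (M v).smulRight (e v))
    - ∑ v ∈ σ, ∑ w ∈ σ, (e v).smulRight (M v (p w) • e w)
  have hB : ∀ x y, B x y = ∑ v ∈ σ, (e v x * M v y - M v x * e v y)
      - ∑ v ∈ σ, ∑ w ∈ σ, e v x * (M v (p w) * e w y) := by
    intro x y
    simp [B, LinearMap.sum_apply, LinearMap.sub_apply]
  refine ⟨B, ?_, ?_⟩
  · intro x
    rw [hB]
    have h1 : ∑ v ∈ σ, (e v x * M v x - M v x * e v x) = 0 :=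
      Finset.sum_eq_zero fun v _ => by ring
    have h2 : ∑ v ∈ σ, ∑ w ∈ σ, e v x * (M v (p w) * e w x) =
        - ∑ v ∈ σ, ∑ w ∈ σ, e v x * (M v (p w) * e w x) := by
      conv_lhs => rw [Finset.sum_comm]
      rw [← Finset.sum_neg_distrib]
      refine Finset.sum_congr rfl fun v hv => ?_
      rw [← Finset.sum_neg_distrib]
      refine Finset.sum_congr rfl fun w hw => ?_
      linear_combination (e v x * e w x) * hM v hv w hw
    linarith
  · intro u hu
    refine LinearMap.ext fun y => ?_
    rw [hB, Finset.sum_sub_distrib]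
    have h1 : ∑ v ∈ σ, e v (p u) * M v y = M u y := by
      rw [Finset.sum_eq_single u]
      · rw [he u u hu]; simp
      · intro v _ hvu; rw [he v u hu, if_neg (Ne.symm hvu)]; simp
      · intro h; exact absurd hu h
    have h2 : ∑ v ∈ σ, ∑ w ∈ σ, e v (p u) * (M v (p w) * e w y)
        = ∑ w ∈ σ, M u (p w) * e w y := by
      rw [Finset.sum_eq_single u]
      · rw [he u u hu]; simp
      · intro v _ hvu; rw [he v u hu, if_neg (Ne.symm hvu)]; simp
      · intro h; exact absurd hu h
    have h3 : ∑ w ∈ σ, M u (p w) * e w y = - ∑ w ∈ σ, M w (p u) * e w y := by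
      rw [← Finset.sum_neg_distrib]
      refine Finset.sum_congr rfl fun w hw => ?_
      linear_combination e w y * hM u hu w hw
    rw [h1, h2, h3]
    ring

lemma alt_swap {B : U →ₗ[ℝ] Module.Dual ℝ U} (hB : ∀ x, B x x = 0) (x y : U) :
    B x y = - B y x := by
  have := hB (x + y)
  simp [hB] at this
  linarith

lemma alt_unique {p : ι → U} {σ : Finset ι} (hσ : LinearIndepOn ℝ p (σ : Set ι))
    (hc : σ.card + 1 = Module.finrank ℝ U)
    {B : U →ₗ[ℝ] Module.Dual ℝ U} (hB : ∀ x, B x x = 0)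
    (h0 : ∀ v ∈ σ, B (p v) = 0) : B = 0 := by
  obtain ⟨F, hF, hF0⟩ := exists_dual_kill (p := p) (s := σ) (by omega)
  have hx : ∀ x, ∃ c : ℝ, B x = c • F := fun x =>
    eq_smul_of_corank_one hσ hc hF0 hF (fun v hv => by rw [alt_swap hB, h0 v hv]; simp)
  obtain ⟨y, hy⟩ : ∃ y, F y ≠ 0 := by
    by_contra hcon; push Not at hcon
    exact hF0 (LinearMap.ext hcon)
  have hBy : B y = 0 := by
    obtain ⟨c, hc⟩ := hx y
    have := hB y
    rw [hc] at this
    simp [hy] at this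
    rw [hc, this, zero_smul]
  refine LinearMap.ext fun x => ?_
  obtain ⟨c, hc⟩ := hx x
  have := alt_swap hB x y
  rw [hBy, hc] at this
  simp [hy] at this
  rw [hc, this, zero_smul]; rfl

end
end R18

namespace R18
section
variable {ι U : Type} [DecidableEq ι] [AddCommGroup U] [Module ℝ U] [FiniteDimensional ℝ U]

def Mot (X : Finset ι) (p : ι → U) (G : Finset ι) (M : ι → Module.Dual ℝ U) : Prop :=
  ∀ v w, Fc X p (insert v (insert w G)) → M v (p w) + M w (p v) = 0

def Triv (X : Finset ι) (p : ι → U) (G : Finset ι) (M : ι → Module.Dual ℝ U) : Prop :=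
  ∃ B : U →ₗ[ℝ] Module.Dual ℝ U, (∀ x, B x x = 0) ∧ ∀ v, Fc X p (insert v G) → M v = B (p v)

variable {X : Finset ι} {p : ι → U}

lemma bil_sub_zero {B B' : U →ₗ[ℝ] Module.Dual ℝ U} (h : B - B' = 0) : B = B' :=
  LinearMap.ext fun x => LinearMap.ext fun y => by
    have := LinearMap.congr_fun (LinearMap.congr_fun h x) y
    simp at this; linarith

lemma Cfg.glue (hC : Cfg X p) {G : Finset ι} (hG : Fc X p G)
    (hc : G.card + 3 ≤ Module.finrank ℝ U) {M : ι → Module.Dual ℝ U}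
    (h : ∀ v, v ∉ G → Fc X p (insert v G) → Triv X p (insert v G) M) : Triv X p G M := by
  obtain ⟨v0, hv0X, hv0G, hv0⟩ := hC.extend hG (by omega)
  obtain ⟨B0, hB0, hB0'⟩ := h v0 hv0G hv0
  have key : ∀ v, v ∉ G → Fc X p (insert v G) →
      (∀ w, Fc X p (insert w (insert v G)) → M w = B0 (p w)) := by
    intro v hvG hv
    refine hC.conn (G := G) (S := ∅) (by simpa using hG) hc
      (fun v => ∀ w, Fc X p (insert w (insert v G)) → M w = B0 (p w)) ?_
      (a := v0) (b := v) (by simpa using hv0G) hv0 hB0' (by simpa using hvG) hv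
    intro a b ha hb hab hfab hQa
    simp only [Finset.union_empty] at ha hb
    obtain ⟨Bb, hBb, hBb'⟩ := h b hb (hC.mono hfab (Finset.subset_insert _ _))
    obtain ⟨σ, hσ1, hσ2, hσ3⟩ := hC.exists_facet hfab
    have hz : Bb - B0 = 0 := by
      refine alt_unique (hC.Fc_indep hσ2) hσ3 (fun x => by simp [hBb, hB0]) ?_
      intro x hx
      have h1 := hBb' x (hC.mono hσ2 (Finset.insert_subset hx
        ((Finset.subset_insert _ _).trans hσ1)))
      have h2 := hQa x (hC.mono hσ2 (Finset.insert_subset hx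
        ((Finset.insert_subset_insert _ (Finset.subset_insert _ _)).trans hσ1)))
      rw [LinearMap.sub_apply, ← h1, ← h2, sub_self]
    intro w hw
    rw [hBb' w hw, bil_sub_zero hz]
  refine ⟨B0, hB0, fun v hv => ?_⟩
  by_cases hvG : v ∈ G
  · exact hB0' v (by rwa [Finset.insert_eq_of_mem (Finset.mem_insert_of_mem hvG)])
  · exact key v hvG hv v (by rwa [Finset.insert_eq_of_mem (Finset.mem_insert_self _ _)])

def tri (G : Finset ι) (v w a : ι) : Finset ι := insert v (insert w (insert a G))

lemma tri12 (G : Finset ι) (v w a : ι) : tri G w v a = tri G v w a := Finset.insert_comm _ _ _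
lemma tri23 (G : Finset ι) (v w a : ι) : tri G v a w = tri G v w a := by
  unfold tri; rw [Finset.insert_comm w a]
lemma mem_tri {G : Finset ι} {v w a x : ι} : x ∈ tri G v w a ↔ x = v ∨ x = w ∨ x = a ∨ x ∈ G := by
  simp [tri]

def Tri (X : Finset ι) (p : ι → U) (G : Finset ι) (v w a : ι) : Prop :=
  (v ∉ G ∧ w ∉ G ∧ a ∉ G) ∧ (v ≠ w ∧ v ≠ a ∧ w ≠ a) ∧ Fc X p (tri G v w a)

lemma Tri12 {G : Finset ι} {v w a : ι} : Tri X p G w v a ↔ Tri X p G v w a := by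
  unfold Tri; rw [tri12]; tauto
lemma Tri23 {G : Finset ι} {v w a : ι} : Tri X p G v a w ↔ Tri X p G v w a := by
  unfold Tri; rw [tri23]; tauto

def Edg (X : Finset ι) (p : ι → U) (G : Finset ι) (v w : ι) : Prop :=
  v ∉ G ∧ w ∉ G ∧ v ≠ w ∧ Fc X p (insert v (insert w G))

lemma Edg.symm {G : Finset ι} {v w : ι} (h : Edg X p G v w) : Edg X p G w v :=
  ⟨h.2.1, h.1, h.2.2.1.symm, by rw [Finset.insert_comm]; exact h.2.2.2⟩

def eps (X : Finset ι) (p : ι → U) (G : Finset ι) (D : U → U → U →ₗ[ℝ] Module.Dual ℝ U)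
    (v w a : ι) : ℝ :=
  if Tri X p G v w a then Real.sign (D (p v) (p w) (p a) (∑ x ∈ X, p x)) else 0

structure Core (X : Finset ι) (p : ι → U) (G : Finset ι) (M : ι → Module.Dual ℝ U)
    (D : U → U → U →ₗ[ℝ] Module.Dual ℝ U) (B : Finset ι → U →ₗ[ℝ] Module.Dual ℝ U) : Prop where
  hC : Cfg X p
  hG : Fc X p G
  hc : G.card + 4 = Module.finrank ℝ U
  hM : Mot X p G M
  M0 : ∀ g ∈ G, M g = 0
  isD : IsD p G D
  Balt : ∀ σ x, B σ x x = 0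
  BM : ∀ σ, Fc X p σ → G ⊆ σ → ∀ x ∈ σ, M x = B σ (p x)

variable {G : Finset ι} {M : ι → Module.Dual ℝ U}
    {D : U → U → U →ₗ[ℝ] Module.Dual ℝ U} {B : Finset ι → U →ₗ[ℝ] Module.Dual ℝ U}

lemma IsD.d33 (h : IsD p G D) (x y z : U) : D x y z z = 0 := by
  have := h.d34 x y z z; linarith
lemma IsD.d22 (h : IsD p G D) (x y z : U) : D x y y z = 0 := by
  have := h.d23 x y y z; linarith
lemma IsD.d24 (h : IsD p G D) (x y z : U) : D x y z y = 0 := by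
  rw [h.d34, h.d22, neg_zero]
lemma IsD.d14 (h : IsD p G D) (x y z : U) : D x y z x = 0 := by
  rw [h.d12, h.d24, neg_zero]
lemma IsD.d13 (h : IsD p G D) (x y z : U) : D x y x z = 0 := by
  rw [h.d34, h.d14, neg_zero]

lemma Core.eps12 (h : Core X p G M D B) (v w a : ι) : eps X p G D w v a = - eps X p G D v w a := by
  unfold eps
  by_cases ht : Tri X p G v w a
  · rw [if_pos ht, if_pos (Tri12.2 ht), h.isD.d12, Real.sign_neg]
  · rw [if_neg ht, if_neg (fun h' => ht (Tri12.1 h')), neg_zero]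

lemma Core.eps23 (h : Core X p G M D B) (v w a : ι) : eps X p G D v a w = - eps X p G D v w a := by
  unfold eps
  by_cases ht : Tri X p G v w a
  · rw [if_pos ht, if_pos (Tri23.2 ht), h.isD.d23, Real.sign_neg]
  · rw [if_neg ht, if_neg (fun h' => ht (Tri23.1 h')), neg_zero]

lemma Tri.card {v w a : ι} (h : Tri X p G v w a) : (tri G v w a).card = G.card + 3 := by
  obtain ⟨⟨h1, h2, h3⟩, ⟨h4, h5, h6⟩, -⟩ := h
  unfold tri
  rw [Finset.card_insert_of_notMem (by simp [h1, h4, h5]),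
    Finset.card_insert_of_notMem (by simp [h2, h6]), Finset.card_insert_of_notMem h3]

lemma Core.eps_pos (h : Core X p G M D B) {v w a x : ι} (ht : Tri X p G v w a) (hx : x ∈ X)
    (hxt : x ∉ tri G v w a) : 0 < eps X p G D v w a * D (p v) (p w) (p a) (p x) := by
  obtain ⟨ρ, hρ⟩ := ht.2.2.exposes
  have hi := h.hC.Fc_indep ht.2.2
  obtain ⟨c, hc⟩ := eq_smul_of_corank_one hi (by rw [ht.card]; have := h.hc; omega) hρ.ne hρ.zero
    (H := D (p v) (p w) (p a)) (by
      intro y hy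
      rcases mem_tri.1 hy with rfl | rfl | rfl | hy
      · exact h.isD.d14 _ _ _
      · exact h.isD.d24 _ _ _
      · exact h.isD.d33 _ _ _
      · exact h.isD.dG y hy _ _ _)
  have hne : D (p v) (p w) (p a) ≠ 0 :=
    h.isD.dnd v w a ht.1.1 ht.1.2.1 ht.1.2.2 ht.2.1.1 ht.2.1.2.1 ht.2.1.2.2 hi
  have hc0 : c ≠ 0 := by rintro rfl; rw [zero_smul] at hc; exact hne hc
  have hρx := hρ.pos x hx hxt
  have ho : 0 < ρ (∑ x ∈ X, p x) := by
    rw [map_sum]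
    exact Finset.sum_pos' (fun y hy => hρ.nonneg y hy) ⟨x, hx, hρx⟩
  unfold eps
  rw [if_pos ht, hc]
  simp only [LinearMap.smul_apply, smul_eq_mul]
  have h1 := Real.sign_mul_pos_of_ne_zero (c * ρ (∑ x ∈ X, p x)) (mul_ne_zero hc0 ho.ne')
  set s := Real.sign (c * ρ (∑ x ∈ X, p x))
  have h2 : 0 < s * c := by
    by_contra hcon; push Not at hcon
    nlinarith
  have := mul_pos h2 hρx
  linarith

lemma Core.exists_out (h : Core X p G M D B) {v w a : ι} (ht : Tri X p G v w a) :
    ∃ x ∈ X, x ∉ tri G v w a := by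
  obtain ⟨ρ, hρ⟩ := ht.2.2.exposes
  exact h.hC.exists_not_mem hρ

lemma Core.eps_or (h : Core X p G M D B) {v w a : ι} (ht : Tri X p G v w a) :
    eps X p G D v w a = 1 ∨ eps X p G D v w a = -1 := by
  obtain ⟨x, hx, hxt⟩ := h.exists_out ht
  have h1 := h.eps_pos ht hx hxt
  unfold eps at h1 ⊢
  rw [if_pos ht] at h1 ⊢
  rcases Real.sign_apply_eq (D (p v) (p w) (p a) (∑ x ∈ X, p x)) with h2 | h2 | h2
  · exact Or.inr h2
  · rw [h2] at h1; simp at h1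
  · exact Or.inl h2

lemma Core.hinge (h : Core X p G M D B) {v w : ι} (he : Edg X p G v w) :
    ∃ a b, a ≠ b ∧ Tri X p G v w a ∧ Tri X p G v w b ∧ (∀ c, Tri X p G v w c → c = a ∨ c = b) ∧
      eps X p G D v w b = - eps X p G D v w a := by
  obtain ⟨hv, hw, hvw, hf⟩ := he
  have hcard : (insert v (insert w G)).card + 2 = Module.finrank ℝ U := by
    rw [Finset.card_insert_of_notMem (by simp [hv, hvw]), Finset.card_insert_of_notMem hw]
    have := h.hc; omega
  obtain ⟨a, b, hab, ha, hb, hfa, hfb, huniq⟩ := h.hC.hinge hf hcard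
  have heq : ∀ c, insert c (insert v (insert w G)) = tri G v w c := by
    intro c; unfold tri
    rw [Finset.insert_comm c v, Finset.insert_comm c w]
  have hT : ∀ c, Tri X p G v w c ↔ c ∉ insert v (insert w G) ∧ Fc X p (insert c (insert v (insert w G))) := by
    intro c
    rw [heq]
    simp only [Tri, Finset.mem_insert, not_or]
    constructor
    · rintro ⟨⟨-, -, h3⟩, ⟨-, h5, h6⟩, h7⟩
      exact ⟨⟨h5.symm, h6.symm, h3⟩, h7⟩
    · rintro ⟨⟨h5, h6, h3⟩, h7⟩
      exact ⟨⟨hv, hw, h3⟩, ⟨hvw, Ne.symm h5, Ne.symm h6⟩, h7⟩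
  have hTa := (hT a).2 ⟨ha, hfa⟩
  have hTb := (hT b).2 ⟨hb, hfb⟩
  refine ⟨a, b, hab, hTa, hTb, fun c hc => huniq c ((hT c).1 hc).1 ((hT c).1 hc).2, ?_⟩
  have haX : a ∈ X := hfa.1 (by simp)
  have hbX : b ∈ X := hfb.1 (by simp)
  simp only [Finset.mem_insert, not_or] at ha hb
  have h1 := h.eps_pos hTa hbX (by rw [mem_tri]; push Not; exact ⟨hb.1, hb.2.1, hab.symm, hb.2.2⟩)
  have h2 := h.eps_pos hTb haX (by rw [mem_tri]; push Not; exact ⟨ha.1, ha.2.1, hab, ha.2.2⟩)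
  rw [h.isD.d34] at h2
  rcases h.eps_or hTa with h3 | h3 <;> rcases h.eps_or hTb with h4 | h4 <;>
    rw [h3] at h1 ⊢ <;> rw [h4] at h2 ⊢ <;> linarith

/-- sums over the two facets of a hinge -/
lemma Core.hinge_sum (h : Core X p G M D B) {v w a b : ι} (hab : a ≠ b)
    (ha : Tri X p G v w a) (hb : Tri X p G v w b) (hu : ∀ c, Tri X p G v w c → c = a ∨ c = b)
    (f : ι → ℝ) : ∑ c ∈ X, eps X p G D v w c * f c
      = eps X p G D v w a * f a + eps X p G D v w b * f b := by
  have haX : a ∈ X := ha.2.2.1 (by rw [mem_tri]; tauto)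
  have hbX : b ∈ X := hb.2.2.1 (by rw [mem_tri]; tauto)
  rw [← Finset.sum_pair hab (f := fun c => eps X p G D v w c * f c)]
  symm
  apply Finset.sum_subset
  · intro x hx; simp at hx; rcases hx with rfl | rfl <;> assumption
  · intro c _ hc
    have : ¬ Tri X p G v w c := fun hT => hc (by simpa using hu c hT)
    simp [eps, this]

lemma Core.Bzero (h : Core X p G M D B) {σ : Finset ι} (hσ : Fc X p σ) (hGσ : G ⊆ σ) {g : ι}
    (hg : g ∈ G) (x : U) : B σ x (p g) = 0 := by
  rw [alt_swap (h.Balt σ), ← h.BM σ hσ hGσ g (hGσ hg), h.M0 g hg]; simp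

lemma sub_tri (G : Finset ι) (v w a : ι) : G ⊆ tri G v w a := by
  intro x hx; rw [mem_tri]; tauto

lemma Core.exists_omega (h : Core X p G M D B) (v w : ι) : ∃ ω : ℝ, (¬ Edg X p G v w → ω = 0) ∧
    ∀ x y, ∑ a ∈ X, eps X p G D v w a * B (tri G v w a) x y = ω * D (p v) (p w) x y := by
  by_cases he : Edg X p G v w
  · obtain ⟨a, b, hab, ha, hb, hu, hs⟩ := h.hinge he
    have haX : a ∈ X := ha.2.2.1 (by rw [mem_tri]; tauto)
    have hbX : b ∈ X := hb.2.2.1 (by rw [mem_tri]; tauto)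
    set K := B (tri G v w a) - B (tri G v w b) with hK
    have hDab : D (p v) (p w) (p a) (p b) ≠ 0 := by
      have := h.eps_pos ha hbX (by
        rw [mem_tri]; push Not
        exact ⟨hb.2.1.2.1.symm, hb.2.1.2.2.symm, hab.symm, hb.1.2.2⟩)
      intro h0; rw [h0, mul_zero] at this; exact lt_irrefl _ this
    set c := K (p a) (p b) / D (p v) (p w) (p a) (p b) with hc
    have hKalt : ∀ x, K x x = 0 := fun x => by simp [hK, h.Balt]
    have hLalt : ∀ x, (K - c • D (p v) (p w)) x x = 0 := fun x => by
      simp [hKalt, h.isD.d33]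
    have hK0 : ∀ x, x = v ∨ x = w ∨ x ∈ G → K (p x) = 0 := by
      intro x hx
      have h1 := h.BM _ ha.2.2 (sub_tri G v w a) x (by rw [mem_tri]; tauto)
      have h2 := h.BM _ hb.2.2 (sub_tri G v w b) x (by rw [mem_tri]; tauto)
      rw [hK, LinearMap.sub_apply, ← h1, ← h2, sub_self]
    have hD0 : ∀ x, x = v ∨ x = w ∨ x ∈ G → D (p v) (p w) (p x) = 0 := by
      intro x hx
      refine LinearMap.ext fun y => ?_
      rcases hx with rfl | rfl | hx
      · exact h.isD.d13 _ _ _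
      · exact h.isD.d22 _ _ _
      · rw [h.isD.d34, h.isD.dG x hx]; simp
    have hL0 : ∀ x, x = v ∨ x = w ∨ x ∈ G → (K - c • D (p v) (p w)) (p x) = 0 := by
      intro x hx
      simp [hK0 x hx, hD0 x hx]
    have hia := h.hC.Fc_indep ha.2.2
    have hcarda := ha.card
    have hL : K - c • D (p v) (p w) = 0 := by
      refine alt_unique hia (by have := h.hc; omega) hLalt ?_
      intro x hx
      rw [mem_tri] at hx
      by_cases hxa : x = a
      · subst hxa
        obtain ⟨ρ, hρ⟩ := ha.2.2.exposes
        have hbt : b ∉ tri G v w x := by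
          rw [mem_tri]; push Not
          exact ⟨hb.2.1.2.1.symm, hb.2.1.2.2.symm, hab.symm, hb.1.2.2⟩
        refine dual_eq_zero_of_full (p := p) (s := insert b (tri G v w x))
          (indep_insert hia hρ.zero (hρ.pos b hbX hbt).ne') (by
          rw [Finset.card_insert_of_notMem hbt, hcarda]; have := h.hc; omega) ?_
        intro y hy
        rw [Finset.mem_insert, mem_tri] at hy
        by_cases hyb : y = b
        · subst hyb
          simp [hc, hDab]
        · by_cases hyx : y = x
          · rw [hyx]; exact hLalt _
          · rw [alt_swap hLalt, hL0 y (by tauto)]; simp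
      · exact hL0 x (by tauto)
    refine ⟨eps X p G D v w a * c, fun h' => absurd he h', fun x y => ?_⟩
    rw [h.hinge_sum hab ha hb hu (fun a => B (tri G v w a) x y), hs]
    have := LinearMap.congr_fun (LinearMap.congr_fun hL x) y
    simp [hK] at this
    linear_combination (eps X p G D v w a) * this
  · refine ⟨0, fun _ => rfl, fun x y => ?_⟩
    rw [zero_mul]
    refine Finset.sum_eq_zero fun a _ => ?_
    have : ¬ Tri X p G v w a := fun ht => he ⟨ht.1.1, ht.1.2.1, ht.2.1.1,
      h.hC.mono ht.2.2 (by intro x hx; rw [mem_tri]; simp at hx; tauto)⟩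
    simp [eps, this]

end
end R18

namespace R18
section
variable {ι U : Type} [DecidableEq ι] [AddCommGroup U] [Module ℝ U] [FiniteDimensional ℝ U]
variable {X : Finset ι} {p : ι → U}
variable {G : Finset ι} {M : ι → Module.Dual ℝ U}
    {D : U → U → U →ₗ[ℝ] Module.Dual ℝ U} {B : Finset ι → U →ₗ[ℝ] Module.Dual ℝ U}

lemma Tri.edg12 {v w a : ι} (hC : Cfg X p) (h : Tri X p G v w a) : Edg X p G v w :=
  ⟨h.1.1, h.1.2.1, h.2.1.1, hC.mono h.2.2 (by intro x hx; rw [mem_tri]; simp at hx; tauto)⟩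
lemma Tri.edg13 {v w a : ι} (hC : Cfg X p) (h : Tri X p G v w a) : Edg X p G v a :=
  (Tri23.2 h).edg12 hC

lemma Core.D0 (h : Core X p G M D B) (v z : ι) {x : ι} (hx : x = v ∨ x = z ∨ x ∈ G) (y : U) :
    D (p v) (p z) y (p x) = 0 := by
  rcases hx with rfl | rfl | hx
  · exact h.isD.d14 _ _ _
  · exact h.isD.d24 _ _ _
  · exact h.isD.dG x hx _ _ _

lemma Core.exists_y0 (h : Core X p G M D B) {v z : ι} (he : Edg X p G v z)
    {ρ : Module.Dual ℝ U} (hρ : ∀ x, x = v ∨ x = z ∨ x ∈ G → ρ (p x) = 0) :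
    ∃ y0, ρ = D (p v) (p z) y0 := by
  obtain ⟨c, -, -, hc, -⟩ := h.hinge he
  have hi := h.hC.Fc_indep hc.2.2
  have hne : D (p v) (p z) (p c) ≠ 0 :=
    h.isD.dnd v z c hc.1.1 hc.1.2.1 hc.1.2.2 hc.2.1.1 hc.2.1.2.1 hc.2.1.2.2 hi
  obtain ⟨y1, hy1⟩ : ∃ y, D (p v) (p z) (p c) y ≠ 0 := by
    by_contra hcon; push Not at hcon
    exact hne (LinearMap.ext hcon)
  have hy1' : D (p v) (p z) y1 (p c) ≠ 0 := by
    rw [h.isD.d34]; exact neg_ne_zero.2 hy1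
  set α := ρ (p c) / D (p v) (p z) y1 (p c) with hα
  obtain ⟨b, hb⟩ := eq_smul_of_corank_one hi (by rw [hc.card]; have := h.hc; omega) hne
    (H := ρ - α • D (p v) (p z) y1) (by
      intro x hx
      rw [mem_tri] at hx
      by_cases hxc : x = c
      · subst hxc; exact h.isD.d33 _ _ _
      · exact h.D0 v z (by tauto) _) (by
      intro x hx
      rw [mem_tri] at hx
      by_cases hxc : x = c
      · subst hxc; simp [hα, hy1']
      · have h1 := h.D0 v z (x := x) (by tauto) y1
        simp [h1, hρ x (by tauto)])
  refine ⟨α • y1 + b • p c, LinearMap.ext fun x => ?_⟩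
  have := LinearMap.congr_fun hb x
  simp at this ⊢
  linarith

lemma Core.plucker (h : Core X p G M D B) {v z : ι} (he : Edg X p G v z) (y0 : U)
    {H : Module.Dual ℝ U} (hH : ∀ x, x = v ∨ x = z ∨ x ∈ G → H (p x) = 0) (w a : ι)
    (hw : D (p v) (p z) y0 (p w) ≠ 0) :
    H (p w) * D (p v) (p z) y0 (p a) - H (p a) * D (p v) (p z) y0 (p w)
      = D (p v) (p z) (p w) (p a) * H y0 := by
  obtain ⟨hv, hz, hvz, hf⟩ := he
  set ρ := D (p v) (p z) y0 with hρ
  have hi0 := h.hC.Fc_indep hf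
  have hwn : w ∉ insert v (insert z G) := by
    intro hmem
    simp only [Finset.mem_insert] at hmem
    exact hw (h.D0 v z hmem y0)
  have hi : LinearIndepOn ℝ p ((insert w (insert v (insert z G)) : Finset ι) : Set ι) :=
    indep_insert hi0 (F := ρ) (fun x hx => h.D0 v z (by simpa using hx) y0) hw
  have hcard : (insert w (insert v (insert z G))).card + 1 = Module.finrank ℝ U := by
    rw [Finset.card_insert_of_notMem hwn, Finset.card_insert_of_notMem (by simp [hv, hvz]),
      Finset.card_insert_of_notMem hz]
    have := h.hc; omega
  have hfy : D (p v) (p z) (p w) y0 = - ρ (p w) := h.isD.d34 _ _ _ _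
  have hne : D (p v) (p z) (p w) ≠ 0 := by
    intro h0
    rw [h0] at hfy
    simp at hfy
    exact hw hfy
  set α := H (p w) / ρ (p w) with hα
  obtain ⟨c, hc⟩ := eq_smul_of_corank_one hi hcard hne (H := H - α • ρ) (by
      intro x hx
      rw [Finset.mem_insert] at hx
      rcases hx with rfl | hx
      · exact h.isD.d33 _ _ _
      · exact h.D0 v z (by simpa using hx) _) (by
      intro x hx
      rw [Finset.mem_insert] at hx
      rcases hx with rfl | hx
      · simp [hα, hw]
      · have hx' : x = v ∨ x = z ∨ x ∈ G := by simpa using hx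
        have h1 : ρ (p x) = 0 := h.D0 v z hx' y0
        simp [h1, hH x hx'])
  have e1 := LinearMap.congr_fun hc (p a)
  have e2 := LinearMap.congr_fun hc y0
  have e3 : H (p w) = α * ρ (p w) := by rw [hα]; field_simp
  have e4 : ρ y0 = 0 := h.isD.d33 _ _ _
  simp [e4, hfy] at e1 e2
  rw [e2, e3]
  linear_combination (-ρ (p w)) * e1

structure OmSpec (X : Finset ι) (p : ι → U) (G : Finset ι)
    (D : U → U → U →ₗ[ℝ] Module.Dual ℝ U) (B : Finset ι → U →ₗ[ℝ] Module.Dual ℝ U)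
    (ω : ι → ι → ℝ) : Prop where
  zero : ∀ v w, ¬ Edg X p G v w → ω v w = 0
  spec : ∀ v w x y, ∑ a ∈ X, eps X p G D v w a * B (tri G v w a) x y = ω v w * D (p v) (p w) x y

lemma Core.exists_om (h : Core X p G M D B) : ∃ ω, OmSpec X p G D B ω := by
  choose ω h1 h2 using h.exists_omega
  exact ⟨ω, h1, h2⟩

lemma OmSpec.symm {ω : ι → ι → ℝ} (ho : OmSpec X p G D B ω) (h : Core X p G M D B) (v w : ι) :
    ω v w = ω w v := by
  by_cases he : Edg X p G v w
  · obtain ⟨c, -, -, hc, -⟩ := h.hinge he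
    have hi := h.hC.Fc_indep hc.2.2
    have hne : D (p v) (p w) (p c) ≠ 0 :=
      h.isD.dnd v w c hc.1.1 hc.1.2.1 hc.1.2.2 hc.2.1.1 hc.2.1.2.1 hc.2.1.2.2 hi
    obtain ⟨y1, hy1⟩ : ∃ y, D (p v) (p w) (p c) y ≠ 0 := by
      by_contra hcon; push Not at hcon
      exact hne (LinearMap.ext hcon)
    have h1 := ho.spec v w (p c) y1
    have h2 := ho.spec w v (p c) y1
    have h3 : ∑ a ∈ X, eps X p G D w v a * B (tri G w v a) (p c) y1 =
        - ∑ a ∈ X, eps X p G D v w a * B (tri G v w a) (p c) y1 := by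
      rw [← Finset.sum_neg_distrib]
      refine Finset.sum_congr rfl fun a _ => ?_
      rw [h.eps12, tri12]; ring
    rw [h3, h1, h.isD.d12 (p w)] at h2
    have h4 : (ω v w - ω w v) * D (p v) (p w) (p c) y1 = 0 := by linarith
    rcases mul_eq_zero.1 h4 with h5 | h5
    · linarith
    · exact absurd h5 hy1
  · rw [ho.zero v w he, ho.zero w v (fun h' => he h'.symm)]

lemma Core.eps_sum (h : Core X p G M D B) (v w : ι) : ∑ a ∈ X, eps X p G D v w a = 0 := by
  by_cases he : Edg X p G v w
  · obtain ⟨a, b, hab, ha, hb, hu, hs⟩ := h.hinge he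
    have := h.hinge_sum hab ha hb hu (fun _ => 1)
    simp only [mul_one] at this
    rw [this, hs]; ring
  · refine Finset.sum_eq_zero fun a _ => ?_
    unfold eps
    rw [if_neg]; exact fun ht => he (ht.edg12 h.hC)

/-- closing condition around `v`. -/
lemma OmSpec.closing {ω : ι → ι → ℝ} (ho : OmSpec X p G D B ω) (h : Core X p G M D B) (v : ι)
    (x y : U) : D (p v) (∑ w ∈ X, ω v w • p w) x y = 0 := by
  have h1 : D (p v) (∑ w ∈ X, ω v w • p w) x y
      = ∑ w ∈ X, ω v w * D (p v) (p w) x y := by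
    rw [h.isD.d23, map_sum, LinearMap.sum_apply, ← Finset.sum_neg_distrib]
    refine Finset.sum_congr rfl fun w _ => ?_
    rw [h.isD.d23 (p v) (p w)]
    simp
  have h2 : ∑ w ∈ X, ω v w * D (p v) (p w) x y
      = ∑ w ∈ X, ∑ a ∈ X, eps X p G D v w a * B (tri G v w a) x y :=
    Finset.sum_congr rfl fun w _ => (ho.spec v w x y).symm
  have h3 : ∑ w ∈ X, ∑ a ∈ X, eps X p G D v w a * B (tri G v w a) x y
      = - ∑ w ∈ X, ∑ a ∈ X, eps X p G D v w a * B (tri G v w a) x y := by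
    conv_lhs => rw [Finset.sum_comm]
    rw [← Finset.sum_neg_distrib]
    refine Finset.sum_congr rfl fun w _ => ?_
    rw [← Finset.sum_neg_distrib]
    refine Finset.sum_congr rfl fun a _ => ?_
    rw [h.eps23, tri23]; ring
  rw [h1, h2]; linarith

lemma Core.Tneg (h : Core X p G M D B) {ω : ι → ι → ℝ} (ho : OmSpec X p G D B ω)
    {v z c : ι} (hc : Tri X p G v z c) :
    let T := ∑ w ∈ X, ω v w * (M w (p z) - B (tri G v z c) (p w) (p z))
    T ≤ 0 ∧ (T = 0 → ∀ w, w ≠ z → ω v w = 0) := by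
  intro T
  have he : Edg X p G v z := hc.edg12 h.hC
  obtain ⟨ρ, hρ⟩ := he.2.2.2.exposes
  obtain ⟨y0, hy0⟩ := h.exists_y0 he (ρ := ρ) (fun x hx => hρ.zero x (by simpa using hx))
  set B1 := B (tri G v z c) with hB1
  set ε := eps X p G D with hε
  set β : ι → ι → ℝ := fun w a => B (tri G v w a) (p z) y0 - B1 (p z) y0 with hβ
  set t : ι → ℝ := fun w => (M w (p z) - B1 (p w) (p z)) / ρ (p w) with ht
  have hzt : M z = B1 (p z) := h.BM _ hc.2.2 (sub_tri _ _ _ _) z (by rw [mem_tri]; tauto)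
  have hvt : M v = B1 (p v) := h.BM _ hc.2.2 (sub_tri _ _ _ _) v (by rw [mem_tri]; tauto)
  have hεT : ∀ {w a}, ¬ Tri X p G v w a → ε v w a = 0 := by
    intro w a hn; simp [hε, eps, hn]
  have hρpos : ∀ {w}, Edg X p G v w → w ≠ z → 0 < ρ (p w) := by
    intro w hw hwz
    exact hρ.pos w (hw.2.2.2.1 (by simp)) (by simp [hwz, hw.2.1, hw.2.2.1.symm])
  have hsum : ∀ w, ω v w * ρ (p w) = ∑ a ∈ X, ε v w a * β w a := by
    intro w
    have h1 := ho.spec v w (p z) y0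
    have h2 : D (p v) (p w) (p z) y0 = ρ (p w) := by
      rw [hy0, h.isD.d23, h.isD.d34]; ring
    rw [h2] at h1
    have h3 : ∑ a ∈ X, ε v w a * B1 (p z) y0 = 0 := by
      rw [← Finset.sum_mul, h.eps_sum, zero_mul]
    simp only [hβ, mul_sub, Finset.sum_sub_distrib]
    rw [h3, h1, sub_zero]
  have hterm : ∀ w, ω v w * (M w (p z) - B1 (p w) (p z)) = ∑ a ∈ X, ε v w a * β w a * t w := by
    intro w
    rw [← Finset.sum_mul, ← hsum]
    by_cases hw : Edg X p G v w
    · by_cases hwz : w = z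
      · subst hwz
        have : M w (p w) - B1 (p w) (p w) = 0 := by rw [hzt, sub_self]
        simp [ht, this]
      · have := (hρpos hw hwz).ne'
        simp only [ht]; field_simp
    · rw [ho.zero v w hw]; ring
  have hβsymm : ∀ w a, β a w = β w a := by
    intro w a; simp only [hβ]; rw [tri23]
  have hT2 : 2 * T = ∑ w ∈ X, ∑ a ∈ X, ε v w a * β w a * (t w - t a) := by
    have e1 : T = ∑ w ∈ X, ∑ a ∈ X, ε v w a * β w a * t w :=
      Finset.sum_congr rfl fun w _ => hterm w
    have e2 : T = ∑ w ∈ X, ∑ a ∈ X, - (ε v w a * β w a * t a) := by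
      rw [e1, Finset.sum_comm]
      refine Finset.sum_congr rfl fun w _ => Finset.sum_congr rfl fun a _ => ?_
      rw [hβsymm, hε, h.eps23]; ring
    rw [two_mul]
    nth_rewrite 1 [e1]
    rw [e2, ← Finset.sum_add_distrib]
    refine Finset.sum_congr rfl fun w _ => ?_
    rw [← Finset.sum_add_distrib]
    exact Finset.sum_congr rfl fun a _ => by ring
  have hβz : ∀ {w a}, Tri X p G v w a → (w = z ∨ a = z) → β w a = 0 := by
    intro w a hT hz
    have := h.BM _ hT.2.2 (sub_tri _ _ _ _) z (by rw [mem_tri]; rcases hz with rfl | rfl <;> tauto)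
    simp only [hβ]
    rw [← this, ← hzt, sub_self]
  have hpair : ∀ {w a}, Tri X p G v w a → w ≠ z → a ≠ z →
      ε v w a * β w a * (t w - t a) =
        - (ε v w a * D (p v) (p w) (p a) (p z) * (β w a) ^ 2 / (ρ (p w) * ρ (p a))) := by
    intro w a hT hwz haz
    have hw := hρpos (hT.edg12 h.hC) hwz
    have ha := hρpos (hT.edg13 h.hC) haz
    set K := B (tri G v w a) - B1 with hK
    have hKalt : ∀ x, K x x = 0 := fun x => by simp [hK, hB1, h.Balt]
    have hH : ∀ x, x = v ∨ x = z ∨ x ∈ G → K (p z) (p x) = 0 := by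
      intro x hx
      rcases hx with rfl | rfl | hx
      · have := h.BM _ hT.2.2 (sub_tri _ _ _ _) x (by rw [mem_tri]; tauto)
        rw [alt_swap hKalt, hK, LinearMap.sub_apply, ← this, ← hvt]; simp
      · exact hKalt _
      · rw [hK]; simp [hB1, h.Bzero hT.2.2 (sub_tri _ _ _ _) hx, h.Bzero hc.2.2 (sub_tri _ _ _ _) hx]
    have hpl := h.plucker he y0 hH w a (by rw [← hy0]; exact hw.ne')
    rw [← hy0] at hpl
    have hKy : K (p z) y0 = β w a := by simp [hK, hβ]
    have hD : D (p v) (p z) (p w) (p a) = D (p v) (p w) (p a) (p z) := by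
      rw [h.isD.d23, h.isD.d34]; ring
    rw [hKy, hD] at hpl
    have hmw : M w (p z) - B1 (p w) (p z) = - K (p z) (p w) := by
      rw [← alt_swap hKalt (p w)]
      have := h.BM _ hT.2.2 (sub_tri _ _ _ _) w (by rw [mem_tri]; tauto)
      rw [this]; simp [hK]
    have hma : M a (p z) - B1 (p a) (p z) = - K (p z) (p a) := by
      rw [← alt_swap hKalt (p a)]
      have := h.BM _ hT.2.2 (sub_tri _ _ _ _) a (by rw [mem_tri]; tauto)
      rw [this]; simp [hK]
    have htt : t w - t a = - (D (p v) (p w) (p a) (p z) * β w a) / (ρ (p w) * ρ (p a)) := by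
      simp only [ht]
      rw [hmw, hma, ← hpl]
      field_simp
      ring
    rw [htt]
    field_simp
  have hzX : z ∈ X := he.2.2.2.1 (by simp)
  have hDpos : ∀ {w a}, Tri X p G v w a → w ≠ z → a ≠ z →
      0 < ε v w a * D (p v) (p w) (p a) (p z) := by
    intro w a hT hwz haz
    refine h.eps_pos hT hzX ?_
    rw [mem_tri]; push Not
    exact ⟨he.2.2.1.symm, hwz.symm, haz.symm, he.2.1⟩
  have hle : ∀ w a, ε v w a * β w a * (t w - t a) ≤ 0 := by
    intro w a
    by_cases hT : Tri X p G v w a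
    · by_cases hz : w = z ∨ a = z
      · rw [hβz hT hz]; simp
      · push Not at hz
        rw [hpair hT hz.1 hz.2]
        have h1 := hDpos hT hz.1 hz.2
        have h2 := hρpos (hT.edg12 h.hC) hz.1
        have h3 := hρpos (hT.edg13 h.hC) hz.2
        have : 0 ≤ ε v w a * D (p v) (p w) (p a) (p z) * (β w a) ^ 2 / (ρ (p w) * ρ (p a)) := by
          positivity
        linarith
    · rw [hεT hT]; simp
  constructor
  · have : 2 * T ≤ 0 := by
      rw [hT2]
      exact Finset.sum_nonpos fun w _ => Finset.sum_nonpos fun a _ => hle w a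
    linarith
  · intro hT0 w hwz
    rw [hT0, mul_zero] at hT2
    by_cases hw : Edg X p G v w
    · have hwX : w ∈ X := hw.2.2.2.1 (by simp)
      have e1 := (Finset.sum_eq_zero_iff_of_nonpos
        (fun w _ => Finset.sum_nonpos fun a _ => hle w a)).1 hT2.symm w hwX
      have e2 := (Finset.sum_eq_zero_iff_of_nonpos (fun a _ => hle w a)).1 e1
      have e3 : ∑ a ∈ X, ε v w a * β w a = 0 := by
        refine Finset.sum_eq_zero fun a ha => ?_
        by_cases hT : Tri X p G v w a
        · by_cases haz : a = z
          · rw [hβz hT (Or.inr haz), mul_zero]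
          · have e4 := e2 a ha
            rw [hpair hT hwz haz] at e4
            have h1 := hDpos hT hwz haz
            have h2 := hρpos (hT.edg12 h.hC) hwz
            have h3 := hρpos (hT.edg13 h.hC) haz
            have : β w a = 0 := by
              by_contra hb
              have : 0 < ε v w a * D (p v) (p w) (p a) (p z) * (β w a) ^ 2 / (ρ (p w) * ρ (p a)) := by
                positivity
              linarith
            rw [this, mul_zero]
        · rw [hεT hT, zero_mul]
      have e5 := hsum w
      rw [e3] at e5
      rcases mul_eq_zero.1 e5 with h5 | h5
      · exact h5
      · exact absurd h5 (hρpos hw hwz).ne'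
    · exact ho.zero v w hw

lemma Core.MG (h : Core X p G M D B) {v : ι} (hv : Fc X p (insert v G)) {g : ι} (hg : g ∈ G) :
    M v (p g) = 0 := by
  have := h.hM v g (by rwa [Finset.insert_eq_of_mem hg])
  rw [h.M0 g hg] at this
  simpa using this

lemma Core.Mself (h : Core X p G M D B) {v : ι} (hv : Fc X p (insert v G)) : M v (p v) = 0 := by
  have := h.hM v v (by rwa [Finset.insert_eq_of_mem (Finset.mem_insert_self _ _)])
  linarith

lemma Core.omega_zero (h : Core X p G M D B) {ω : ι → ι → ℝ} (ho : OmSpec X p G D B ω) (v w : ι) :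
    ω v w = 0 := by
  obtain ⟨η, hη⟩ := h.hG.exposes
  set N : ι → Module.Dual ℝ U := fun v => ∑ w ∈ X, ω v w • (η (p v) • M w - η (p w) • M v) with hN
  have hNapp : ∀ v y, N v y = ∑ w ∈ X, ω v w * (η (p v) * M w y - η (p w) * M v y) := by
    intro v y; simp [hN, LinearMap.sum_apply]
  have hedgf : ∀ {v w}, Edg X p G v w → Fc X p (insert w G) := fun he =>
    h.hC.mono he.2.2.2 (Finset.subset_insert _ _)
  have hedgf' : ∀ {v w}, Edg X p G v w → Fc X p (insert v G) := fun he => hedgf he.symm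
  have hsum : ∀ y, ∑ v ∈ X, N v y = 0 := by
    intro y
    have e1 : ∑ v ∈ X, N v y = ∑ v ∈ X, ∑ w ∈ X, ω v w * (η (p v) * M w y - η (p w) * M v y) :=
      Finset.sum_congr rfl fun v _ => hNapp v y
    have e2 : ∑ v ∈ X, ∑ w ∈ X, ω v w * (η (p v) * M w y - η (p w) * M v y)
        = - ∑ v ∈ X, ∑ w ∈ X, ω v w * (η (p v) * M w y - η (p w) * M v y) := by
      conv_lhs => rw [Finset.sum_comm]
      rw [← Finset.sum_neg_distrib]
      refine Finset.sum_congr rfl fun v _ => ?_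
      rw [← Finset.sum_neg_distrib]
      refine Finset.sum_congr rfl fun w _ => ?_
      rw [ho.symm h w v]; ring
    rw [e1]; linarith
  have hξ : ∀ (v : ι) (F : Module.Dual ℝ U), F (∑ w ∈ X, ω v w • p w) = ∑ w ∈ X, ω v w * F (p w) := by
    intro v F; simp [map_sum]
  have hNz : ∀ {v z c}, Tri X p G v z c → N v (p z) = η (p v) *
      ∑ w ∈ X, ω v w * (M w (p z) - B (tri G v z c) (p w) (p z)) := by
    intro v z c hc
    have h1 := h.isD.dsp (p v) (∑ w ∈ X, ω v w • p w) (fun x y => ho.closing h v x y) η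
      ((B (tri G v z c)).flip (p z)) hη.zero (fun g hg => by
        rw [LinearMap.flip_apply, ← h.BM _ hc.2.2 (sub_tri _ _ _ _) g (sub_tri _ _ _ _ hg), h.M0 g hg]
        simp)
    rw [hξ, hξ] at h1
    simp only [LinearMap.flip_apply] at h1
    rw [← h.BM _ hc.2.2 (sub_tri _ _ _ _) v (by rw [mem_tri]; tauto)] at h1
    have e : ∑ w ∈ X, ω v w * (η (p v) * M w (p z) - η (p w) * M v (p z))
        = η (p v) * ∑ w ∈ X, ω v w * M w (p z) - (∑ w ∈ X, ω v w * η (p w)) * M v (p z) := by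
      rw [Finset.mul_sum, Finset.sum_mul, ← Finset.sum_sub_distrib]
      exact Finset.sum_congr rfl fun w _ => by ring
    have e' : ∑ w ∈ X, ω v w * (M w (p z) - B (tri G v z c) (p w) (p z))
        = ∑ w ∈ X, ω v w * M w (p z) - ∑ w ∈ X, ω v w * B (tri G v z c) (p w) (p z) := by
      rw [← Finset.sum_sub_distrib]
      exact Finset.sum_congr rfl fun w _ => by ring
    rw [hNapp, e, e', mul_sub, h1]
  have hNle : ∀ v ∈ X, ∀ x ∈ X, N v (p x) ≤ 0 := by
    intro v hv x hx
    by_cases hvl : v ∉ G ∧ Fc X p (insert v G)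
    · obtain ⟨hvG, hvF⟩ := hvl
      have hLP := h.hC.LP hvF (F := - N v) (by
        rw [Finset.card_insert_of_notMem hvG]; have := h.hc; omega) (by
        intro y hy
        rw [LinearMap.neg_apply, hNapp, neg_eq_zero]
        rw [Finset.mem_insert] at hy
        rcases hy with rfl | hy
        · have h1 := h.isD.dsp (p y) (∑ w ∈ X, ω y w • p w) (fun x z => ho.closing h y x z) η
            (M y) hη.zero (fun g hg => h.MG hvF hg)
          rw [hξ, h.Mself hvF, mul_zero] at h1
          rw [h.Mself hvF]
          have : ∑ w ∈ X, ω y w * (η (p y) * M w (p y) - η (p w) * 0)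
              = - (η (p y) * ∑ w ∈ X, ω y w * M y (p w)) := by
            rw [Finset.mul_sum, ← Finset.sum_neg_distrib]
            refine Finset.sum_congr rfl fun w _ => ?_
            by_cases he : Edg X p G y w
            · have := h.hM y w he.2.2.2
              linear_combination (ω y w * η (p y)) * this
            · rw [ho.zero y w he]; ring
          rw [this, h1, neg_zero]
        · refine Finset.sum_eq_zero fun w _ => ?_
          by_cases he : Edg X p G v w
          · rw [h.MG hvF hy, h.MG (hedgf he) hy]; ring
          · rw [ho.zero v w he]; ring) (by
        intro z hz hzG hzF
        simp only [Finset.mem_insert, not_or] at hzG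
        have he : Edg X p G v z := ⟨hvG, hzG.2, Ne.symm hzG.1, by rwa [Finset.insert_comm]⟩
        obtain ⟨c, -, -, hc, -⟩ := h.hinge he
        have h1 := (h.Tneg ho hc).1
        rw [LinearMap.neg_apply, hNz hc]
        have h2 := hη.pos v hv hvG
        have := mul_nonpos_of_nonneg_of_nonpos h2.le h1
        linarith)
      have := hLP x hx
      simp at this
      exact this
    · rw [hNapp]
      refine le_of_eq (Finset.sum_eq_zero fun w _ => ?_)
      rw [ho.zero v w, zero_mul]
      intro he
      exact hvl ⟨he.1, hedgf' he⟩
  have hN0 : ∀ v ∈ X, ∀ x ∈ X, N v (p x) = 0 := by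
    intro v hv x hx
    exact (Finset.sum_eq_zero_iff_of_nonpos (fun v hv => hNle v hv x hx)).1 (hsum (p x)) v hv
  by_cases he : Edg X p G v w
  · obtain ⟨z, -, -, hz, -⟩ := h.hinge he
    have hz' : Tri X p G v z w := Tri23.2 hz
    have hvX : v ∈ X := he.2.2.2.1 (by simp)
    have hzX : z ∈ X := hz.2.2.1 (by rw [mem_tri]; tauto)
    have h1 := hN0 v hvX z hzX
    rw [hNz hz'] at h1
    rcases mul_eq_zero.1 h1 with h2 | h2
    · exact absurd h2 (hη.pos v hvX he.1).ne'
    · exact (h.Tneg ho hz').2 h2 w hz.2.1.2.2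
  · exact ho.zero v w he

lemma Core.triv (h : Core X p G M D B) : Triv X p G M := by
  obtain ⟨ω, ho⟩ := h.exists_om
  have hc := h.hc
  refine h.hC.glue h.hG (by omega) fun v hv hvF => ?_
  refine h.hC.glue hvF (by rw [Finset.card_insert_of_notMem hv]; omega) fun w hw hwF => ?_
  simp only [Finset.mem_insert, not_or] at hw
  have he : Edg X p G v w := ⟨hv, hw.2, Ne.symm hw.1, by rwa [Finset.insert_comm]⟩
  obtain ⟨a, b, hab, ha, hb, hu, hs⟩ := h.hinge he
  have hBB : ∀ x y, B (tri G v w a) x y = B (tri G v w b) x y := by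
    intro x y
    have h1 := ho.spec v w x y
    rw [h.omega_zero ho, zero_mul, h.hinge_sum hab ha hb hu (fun a => B (tri G v w a) x y), hs] at h1
    rcases h.eps_or ha with h2 | h2 <;> rw [h2] at h1 <;> linarith
  refine ⟨B (tri G v w a), h.Balt _, fun x hx => ?_⟩
  have hBB' : B (tri G v w a) = B (tri G v w b) := LinearMap.ext fun x => LinearMap.ext fun y => hBB x y
  by_cases hxm : x = v ∨ x = w ∨ x ∈ G
  · exact h.BM _ ha.2.2 (sub_tri _ _ _ _) x (by rw [mem_tri]; tauto)
  · push Not at hxm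
    have heq : insert x (insert w (insert v G)) = tri G v w x := by
      ext y; simp [tri]; tauto
    rw [heq] at hx
    rcases hu x ⟨⟨hv, hw.2, hxm.2.2⟩, ⟨Ne.symm hw.1, Ne.symm hxm.1, Ne.symm hxm.2.1⟩, hx⟩ with rfl | rfl
    · exact h.BM _ ha.2.2 (sub_tri _ _ _ _) x (by rw [mem_tri]; tauto)
    · rw [hBB']
      exact h.BM _ hb.2.2 (sub_tri _ _ _ _) x (by rw [mem_tri]; tauto)

lemma Cfg.core_triv (hC : Cfg X p) (hG : Fc X p G) (hc : G.card + 4 = Module.finrank ℝ U)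
    (hM : Mot X p G M) : Triv X p G M := by
  have ext : ∀ (M : ι → Module.Dual ℝ U), Mot X p G M → ∀ σ : Finset ι, Fc X p σ → G ⊆ σ →
      ∃ B : U →ₗ[ℝ] Module.Dual ℝ U, (∀ x, B x x = 0) ∧ ∀ v ∈ σ, M v = B (p v) := by
    intro M hM σ hσ hGσ
    refine exists_alt (hC.Fc_indep hσ) M fun v hv w hw => hM v w (hC.mono hσ ?_)
    exact Finset.insert_subset hv (Finset.insert_subset hw hGσ)
  obtain ⟨B0, hB0, hB0'⟩ := ext M hM G hG subset_rfl
  set M' : ι → Module.Dual ℝ U := fun v => M v - B0 (p v) with hM'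
  have hMot' : Mot X p G M' := by
    intro v w hvw
    have := hM v w hvw
    simp only [hM', LinearMap.sub_apply]
    rw [alt_swap hB0 (p w)]
    linarith
  have hch : ∀ σ : Finset ι, ∃ B : U →ₗ[ℝ] Module.Dual ℝ U, (∀ x, B x x = 0) ∧
      (Fc X p σ → G ⊆ σ → ∀ v ∈ σ, M' v = B (p v)) := by
    intro σ
    by_cases hσ : Fc X p σ ∧ G ⊆ σ
    · obtain ⟨B, h1, h2⟩ := ext M' hMot' σ hσ.1 hσ.2
      exact ⟨B, h1, fun _ _ => h2⟩
    · exact ⟨0, fun _ => rfl, fun h1 h2 => absurd ⟨h1, h2⟩ hσ⟩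
  choose B hB1 hB2 using hch
  obtain ⟨D, hD⟩ := exists_isD (hC.Fc_indep hG) hc
  have hcore : Core X p G M' D B := ⟨hC, hG, hc, hMot', fun g hg => by
    simp only [hM']; rw [hB0' g hg, sub_self], hD, hB1, hB2⟩
  obtain ⟨B', h1, h2⟩ := hcore.triv
  refine ⟨B' + B0, fun x => by simp [h1, hB0], fun v hv => ?_⟩
  rw [LinearMap.add_apply, ← h2 v hv]
  simp [hM']

theorem Cfg.rigid (hC : Cfg X p) {G : Finset ι} (hG : Fc X p G)
    (hc : G.card + 4 ≤ Module.finrank ℝ U) {M : ι → Module.Dual ℝ U}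
    (hM : Mot X p G M) : Triv X p G M := by
  induction hn : Module.finrank ℝ U - (G.card + 4) generalizing G with
  | zero => exact hC.core_triv hG (by omega) hM
  | succ n ih =>
    refine hC.glue hG (by omega) fun v hv hvF => ?_
    have hcard : (insert v G).card = G.card + 1 := Finset.card_insert_of_notMem hv
    refine ih hvF (by omega) ?_ (by omega)
    intro a b hab
    refine hM a b (hC.mono hab ?_)
    exact Finset.insert_subset_insert _ (Finset.insert_subset_insert _ (Finset.subset_insert _ _))

end
end R18

namespace R18

section
variable {ι U : Type} [DecidableEq ι] [AddCommGroup U] [Module ℝ U] [FiniteDimensional ℝ U]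

/-- Alternating forms vanishing on `S`. -/
def AltS (S : Submodule ℝ U) : Submodule ℝ (U →ₗ[ℝ] Module.Dual ℝ U) where
  carrier := {B | (∀ x, B x x = 0) ∧ ∀ s ∈ S, B s = 0}
  add_mem' := by
    rintro a b ⟨h1, h2⟩ ⟨h3, h4⟩
    exact ⟨fun x => by simp [h1, h3], fun s hs => by simp [h2 s hs, h4 s hs]⟩
  zero_mem' := ⟨fun x => by simp, fun s _ => by simp⟩
  smul_mem' := by
    rintro c a ⟨h1, h2⟩
    exact ⟨fun x => by simp [h1], fun s hs => by simp [h2 s hs]⟩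

instance AltS.grp (S : Submodule ℝ U) : AddCommGroup (AltS S) :=
  Module.addCommMonoidToAddCommGroup ℝ

lemma mem_AltS {S : Submodule ℝ U} {B : U →ₗ[ℝ] Module.Dual ℝ U} :
    B ∈ AltS S ↔ (∀ x, B x x = 0) ∧ ∀ s ∈ S, B s = 0 := Iff.rfl

lemma alt_symm {B : U →ₗ[ℝ] Module.Dual ℝ U} (h : ∀ x, B x x = 0) (x y : U) :
    B x y = - B y x := by
  have h1 := h (x + y)
  simp [h x, h y] at h1
  linarith

lemma AltS_top : AltS (⊤ : Submodule ℝ U) = ⊥ := by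
  rw [eq_bot_iff]
  intro B hB
  rw [Submodule.mem_bot]
  exact LinearMap.ext fun x => hB.2 x trivial

theorem finrank_AltS (S : Submodule ℝ U) :
    Module.finrank ℝ (AltS S) = (Module.finrank ℝ U - Module.finrank ℝ S).choose 2 := by
  induction hk : Module.finrank ℝ U - Module.finrank ℝ S generalizing S with
  | zero =>
    have : S = ⊤ := Submodule.eq_top_of_finrank_eq
      (le_antisymm (Submodule.finrank_le S) (by omega))
    subst this
    rw [AltS_top]; simp
  | succ k ih =>
    have hne : S ≠ ⊤ := by rintro rfl; simp at hk
    obtain ⟨e, he⟩ : ∃ e, e ∉ S := by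
      by_contra hcon; push Not at hcon; exact hne (eq_top_iff.2 fun x _ => hcon x)
    set T : Submodule ℝ U := S ⊔ Submodule.span ℝ {e} with hT
    have hTf : Module.finrank ℝ T = Module.finrank ℝ S + 1 := by
      have h1 := Submodule.finrank_sup_add_finrank_inf_eq S (Submodule.span ℝ {e})
      have h2 : S ⊓ Submodule.span ℝ {e} = ⊥ := by
        rw [eq_bot_iff]
        intro x hx
        obtain ⟨hx1, hx2⟩ := hx
        obtain ⟨c, rfl⟩ := Submodule.mem_span_singleton.1 hx2
        by_cases hc : c = 0
        · simp [hc]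
        · exact absurd ((Submodule.smul_mem_iff S hc).1 hx1) he
      rw [h2, finrank_bot, finrank_span_singleton (by rintro rfl; exact he S.zero_mem)] at h1
      omega
    have ihT := ih T (by omega)
    -- evaluation at e
    let ev : AltS S →ₗ[ℝ] Module.Dual ℝ U :=
      (LinearMap.applyₗ (R := ℝ) e) ∘ₗ (AltS S).subtype
    have hev : ∀ B : AltS S, ev B = B.1 e := fun B => rfl
    have hker : Module.finrank ℝ (LinearMap.ker ev) = Module.finrank ℝ (AltS T) := by
      have hle : AltS T ≤ AltS S := fun B hB =>
        ⟨hB.1, fun s hs => hB.2 s (Submodule.mem_sup_left hs)⟩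
      have : LinearMap.ker ev = Submodule.comap (AltS S).subtype (AltS T) := by
        ext B
        rw [LinearMap.mem_ker, hev, Submodule.mem_comap]
        constructor
        · intro h0
          refine ⟨B.2.1, fun s hs => ?_⟩
          obtain ⟨y, hy, z, hz, rfl⟩ := Submodule.mem_sup.1 hs
          obtain ⟨c, rfl⟩ := Submodule.mem_span_singleton.1 hz
          simp [B.2.2 y hy, h0]
        · intro h0
          exact h0.2 e (Submodule.mem_sup_right (Submodule.mem_span_singleton_self e))
      rw [this]
      exact (Submodule.comapSubtypeEquivOfLe hle).finrank_eq
    have hrange : LinearMap.range ev = T.dualAnnihilator := by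
      apply le_antisymm
      · rintro _ ⟨B, rfl⟩
        rw [Submodule.mem_dualAnnihilator]
        intro w hw
        obtain ⟨y, hy, z, hz, rfl⟩ := Submodule.mem_sup.1 hw
        obtain ⟨c, rfl⟩ := Submodule.mem_span_singleton.1 hz
        rw [hev, map_add, map_smul, B.2.1 e, alt_symm B.2.1 e y, B.2.2 y hy]
        simp
      · intro φ hφ
        rw [Submodule.mem_dualAnnihilator] at hφ
        obtain ⟨ψ, hψe, hψ⟩ := Submodule.exists_le_ker_of_notMem he
        have hψ' : ∀ s ∈ S, ψ s = 0 := fun s hs => hψ hs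
        refine ⟨⟨(ψ e)⁻¹ • (LinearMap.smulRight ψ φ - LinearMap.smulRight φ ψ), ?_, ?_⟩, ?_⟩
        · intro x; simp; right; ring
        · intro s hs
          refine LinearMap.ext fun y => ?_
          simp [hψ' s hs, hφ s (Submodule.mem_sup_left hs)]
        · rw [hev]
          refine LinearMap.ext fun y => ?_
          have : φ e = 0 := hφ e (Submodule.mem_sup_right (Submodule.mem_span_singleton_self e))
          simp [this, hψe]
    have hrn := LinearMap.finrank_range_add_finrank_ker (K := ℝ) (V := AltS S) (V₂ := Module.Dual ℝ U) ev
    rw [hker, ihT, hrange] at hrn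
    have h3 := Subspace.finrank_add_finrank_dualAnnihilator_eq T
    have h4 : (k + 1).choose 2 = k + k.choose 2 := by
      rw [Nat.choose_succ_succ' k 1, Nat.choose_one_right]
    have h5 : Module.finrank ℝ T.dualAnnihilator = k := by omega
    rw [h5] at hrn
    rw [h4]
    exact hrn.symm

/-- Functionals vanishing on `p '' s`. -/
def ann (p : ι → U) (s : Finset ι) : Submodule ℝ (Module.Dual ℝ U) :=
  (Submodule.span ℝ (p '' (s : Set ι))).dualAnnihilator

lemma mem_ann {p : ι → U} {s : Finset ι} {F : Module.Dual ℝ U} :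
    F ∈ ann p s ↔ ∀ x ∈ s, F (p x) = 0 := by
  rw [ann, Submodule.mem_dualAnnihilator]
  constructor
  · intro h x hx; exact h _ (Submodule.subset_span ⟨x, hx, rfl⟩)
  · intro h w hw; exact span_le_ker h hw

lemma finrank_ann {p : ι → U} {s : Finset ι} (h : LinearIndepOn ℝ p (s : Set ι)) :
    s.card + Module.finrank ℝ (ann p s) = Module.finrank ℝ U := by
  rw [← finrank_span_indep h]
  exact Subspace.finrank_add_finrank_dualAnnihilator_eq _

end
end R18

namespace R18

section
variable {ι U : Type} [DecidableEq ι] [AddCommGroup U] [Module ℝ U] [FiniteDimensional ℝ U]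
variable {X : Finset ι} {p : ι → U}

/-- Vertices of the link of `G`. -/
def Nb (X : Finset ι) (p : ι → U) (G : Finset ι) : Finset ι :=
  X.filter fun v => v ∉ G ∧ Fc X p (insert v G)

lemma mem_Nb {G : Finset ι} {v : ι} : v ∈ Nb X p G ↔ v ∉ G ∧ Fc X p (insert v G) := by
  rw [Nb, Finset.mem_filter]
  exact ⟨fun h => h.2, fun h => ⟨h.2.1 (Finset.mem_insert_self _ _), h⟩⟩

lemma Nb_sub {G : Finset ι} : Nb X p G ⊆ X := Finset.filter_subset _ _

lemma Edg.memX {G : Finset ι} {v w : ι} (h : Edg X p G v w) : v ∈ X ∧ w ∈ X :=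
  ⟨h.2.2.2.1 (by simp), h.2.2.2.1 (by simp)⟩

lemma Edg.memNb (hC : Cfg X p) {G : Finset ι} {v w : ι} (h : Edg X p G v w) : w ∈ Nb X p G :=
  mem_Nb.2 ⟨h.2.1, hC.mono h.2.2.2 (Finset.subset_insert _ _)⟩

lemma mem_Nb_insert {G : Finset ι} {v w : ι} (hv : v ∉ G) :
    w ∈ Nb X p (insert v G) ↔ Edg X p G v w := by
  rw [mem_Nb, Edg, Finset.mem_insert, not_or, Finset.insert_comm]
  constructor
  · rintro ⟨⟨h1, h2⟩, h3⟩; exact ⟨hv, h2, fun h => h1 h.symm, h3⟩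
  · rintro ⟨h1, h2, h3, h4⟩; exact ⟨⟨fun h => h3 h.symm, h2⟩, h4⟩

lemma Cfg.deg2 (hC : Cfg X p) {G : Finset ι} (hc : G.card + 3 = Module.finrank ℝ U) {a : ι}
    (ha : a ∈ Nb X p G) : (X.filter fun b => Edg X p G a b).card = 2 := by
  obtain ⟨haG, haF⟩ := mem_Nb.1 ha
  obtain ⟨x, y, hxy, hx, hy, hxF, hyF, hall⟩ := hC.hinge haF (by
    rw [Finset.card_insert_of_notMem haG]; omega)
  have : (X.filter fun b => Edg X p G a b) = {x, y} := by
    ext b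
    rw [Finset.mem_filter, ← mem_Nb_insert haG, mem_Nb,
      Finset.mem_insert (s := {y}), Finset.mem_singleton]
    constructor
    · rintro ⟨_, h1, h2⟩; exact hall b h1 h2
    · rintro (rfl | rfl)
      · exact ⟨hxF.1 (Finset.mem_insert_self _ _), hx, hxF⟩
      · exact ⟨hyF.1 (Finset.mem_insert_self _ _), hy, hyF⟩
  rw [this, Finset.card_pair hxy]

lemma Cfg.up_all (hC : Cfg X p) {G : Finset ι} (hc : G.card + 3 = Module.finrank ℝ U)
    (R : ι → Prop) (hR : ∀ a ∈ Nb X p G, R a) :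
    ((X ×ˢ X).filter fun e => Edg X p G e.1 e.2 ∧ R e.1 ∧ R e.2).card
      = 2 * ((Nb X p G).filter R).card := by
  rw [Finset.card_filter, Finset.sum_product, Finset.filter_true_of_mem hR]
  have h1 : ∀ a ∈ X, (∑ b ∈ X, if Edg X p G a b ∧ R a ∧ R b then 1 else 0)
      = if a ∈ Nb X p G then 2 else 0 := by
    intro a ha
    rw [← Finset.card_filter]
    split_ifs with h
    · rw [← hC.deg2 hc h]
      congr 1
      refine Finset.filter_congr fun b hb => ⟨fun h => h.1, fun h' => ⟨h', hR a h, hR b (h'.memNb hC)⟩⟩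
    · rw [Finset.card_eq_zero, Finset.filter_eq_empty_iff]
      intro b hb hh
      exact h (hh.1.symm.memNb hC)
  rw [Finset.sum_congr rfl h1, ← Finset.sum_filter, Finset.sum_const, smul_eq_mul, mul_comm]
  congr 2
  ext a
  rw [Finset.mem_filter]
  exact ⟨fun h => h.2, fun h => ⟨Nb_sub h, h⟩⟩

lemma Cfg.up_pos (hC : Cfg X p) {G : Finset ι} (hG : Fc X p G)
    (hc : G.card + 3 = Module.finrank ℝ U)
    {F : Module.Dual ℝ U} (hF : ∀ x ∈ G, F (p x) = 0) :
    2 * ((Nb X p G).filter fun a => 0 < F (p a)).card ≤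
    ((X ×ˢ X).filter fun e => Edg X p G e.1 e.2 ∧ 0 < F (p e.1) ∧ 0 < F (p e.2)).card + 2 := by
  obtain ⟨η, hη⟩ := hG.exposes
  by_cases hne : ∃ c : ℝ, F = c • η
  · obtain ⟨c, rfl⟩ := hne
    by_cases hcp : 0 < c
    · have := hC.up_all hc (fun a => 0 < (c • η) (p a)) (by
        intro a ha
        have := hη.pos a (Nb_sub ha) (mem_Nb.1 ha).1
        simp only [LinearMap.smul_apply, smul_eq_mul]
        positivity)
      omega
    · have : ((Nb X p G).filter fun a => 0 < (c • η) (p a)) = ∅ := by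
        rw [Finset.filter_eq_empty_iff]
        intro a ha h
        have h2 := hη.pos a (Nb_sub ha) (mem_Nb.1 ha).1
        simp only [LinearMap.smul_apply, smul_eq_mul] at h
        nlinarith
      rw [this]; simp
  push Not at hne
  set N := (Nb X p G).filter fun a => 0 < F (p a) with hN
  by_cases hemp : N = ∅
  · rw [hemp]; simp
  obtain ⟨a0, ha0⟩ := Finset.nonempty_iff_ne_empty.2 hemp
  have hmem : ∀ {a}, a ∈ N ↔ (a ∉ G ∧ Fc X p (insert a G)) ∧ 0 < F (p a) := by
    intro a; rw [hN, Finset.mem_filter, mem_Nb]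
  let Γ : SimpleGraph {a // a ∈ N} :=
    { Adj := fun a b => Edg X p G a.1 b.1
      symm := ⟨fun a b h => Edg.symm h⟩
      loopless := ⟨fun a h => h.2.2.1 rfl⟩ }
  have hconn : Γ.Connected := by
    have : Nonempty {a // a ∈ N} := ⟨⟨a0, ha0⟩⟩
    refine ⟨fun a b => ?_⟩
    have ha := hmem.1 a.2
    have hb := hmem.1 b.2
    have := hC.conn_pos hη hc.le hF hne (fun x => ∃ hx : x ∈ N, Γ.Reachable a ⟨x, hx⟩) (by
      rintro x y hx hy hxy hxp hyp hf ⟨hxN, hr⟩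
      have hyN : y ∈ N := hmem.2 ⟨⟨hy, hC.mono hf (Finset.subset_insert _ _)⟩, hyp⟩
      refine ⟨hyN, hr.trans (SimpleGraph.Adj.reachable ?_)⟩
      exact ⟨hx, hy, hxy, hf⟩) ha.1.1 ha.1.2 ha.2 ⟨a.2, SimpleGraph.Reachable.refl _⟩
      hb.1.1 hb.1.2 hb.2
    obtain ⟨_, h⟩ := this
    exact h
  have h1 := hconn.card_vert_le_card_edgeSet_add_one
  rw [Nat.card_eq_fintype_card, Fintype.card_coe, Nat.card_eq_fintype_card,
    ← SimpleGraph.edgeFinset_card] at h1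
  have h2 := Γ.dart_card_eq_twice_card_edges
  have h3 : Fintype.card Γ.Dart ≤
      ((X ×ˢ X).filter fun e => Edg X p G e.1 e.2 ∧ 0 < F (p e.1) ∧ 0 < F (p e.2)).card := by
    rw [← Finset.card_univ]
    refine Finset.card_le_card_of_injOn (fun dd => (dd.fst.1, dd.snd.1)) ?_ ?_
    · intro dd _
      have he : Edg X p G dd.fst.1 dd.snd.1 := dd.adj
      simp only [Finset.coe_filter, Finset.mem_product, Set.mem_ofPred_eq]
      exact ⟨he.memX, he, (hmem.1 dd.fst.2).2, (hmem.1 dd.snd.2).2⟩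
    · intro d1 _ d2 _ h
      simp only [Prod.mk.injEq] at h
      exact SimpleGraph.Dart.ext _ _ (Prod.ext (Subtype.ext h.1) (Subtype.ext h.2))
  omega

lemma Cfg.exists_generic (hC : Cfg X p) {G : Finset ι} {η : Module.Dual ℝ U}
    (hη : Exposes X p G η) : ∃ F : Module.Dual ℝ U, (∀ x ∈ G, F (p x) = 0) ∧
      ∀ v ∈ Nb X p G, ∀ w ∈ Nb X p G, v ≠ w → F (p v) / η (p v) ≠ F (p w) / η (p w) := by
  obtain ⟨F, hF, hne⟩ := Module.Dual.exists_forall_mem_ne_zero_of_forall_exists (ann p G)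
    (fun e : {e : ι × ι // e ∈ (Nb X p G).offDiag} =>
      Module.Dual.eval ℝ U (η (p e.1.2) • p e.1.1 - η (p e.1.1) • p e.1.2)) (by
    rintro ⟨⟨v, w⟩, he⟩
    obtain ⟨hv, hw, hvw⟩ := Finset.mem_offDiag.1 he
    obtain ⟨ρ, hρ⟩ := (mem_Nb.1 hv).2.exposes
    refine ⟨ρ, mem_ann.2 fun x hx => hρ.zero x (Finset.mem_insert_of_mem hx), ?_⟩
    have h1 := hρ.zero v (Finset.mem_insert_self _ _)
    have h2 := hρ.pos w (Nb_sub hw) (by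
      rw [Finset.mem_insert, not_or]; exact ⟨fun h => hvw h.symm, (mem_Nb.1 hw).1⟩)
    have h3 := hη.pos v (Nb_sub hv) (mem_Nb.1 hv).1
    rw [Module.Dual.eval_apply]
    simp only [map_sub, map_smul, h1, smul_eq_mul, mul_zero, zero_sub,
      ne_eq, neg_eq_zero, mul_eq_zero, not_or]
    exact ⟨h3.ne', h2.ne'⟩)
  refine ⟨F, mem_ann.1 hF, fun v hv w hw hvw heq => ?_⟩
  have h := hne ⟨(v, w), Finset.mem_offDiag.2 ⟨hv, hw, hvw⟩⟩
  have h3 := hη.pos v (Nb_sub hv) (mem_Nb.1 hv).1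
  have h4 := hη.pos w (Nb_sub hw) (mem_Nb.1 hw).1
  rw [div_eq_div_iff h3.ne' h4.ne'] at heq
  rw [Module.Dual.eval_apply] at h
  simp only [map_sub, map_smul, smul_eq_mul] at h
  apply h; linarith

lemma triple_sum (X : Finset ι) (T : ι → ι → ι → Prop) (r : ι → ℝ)
    (h1 : ∀ a b c, T a b c → T b a c) (h2 : ∀ a b c, T a b c → T a c b)
    (hr : ∀ a b c, T a b c → r a ≠ r b ∧ r a ≠ r c ∧ r b ≠ r c) :
    (∑ a ∈ X, ∑ b ∈ X, ∑ c ∈ X, if T a b c then 1 else 0)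
      = 3 * ∑ a ∈ X, ∑ b ∈ X, ∑ c ∈ X, if T a b c ∧ r a < r b ∧ r a < r c then 1 else 0 := by
  have e1 : ∀ a b c, (if T a b c then 1 else 0) =
      (if T a b c ∧ r a < r b ∧ r a < r c then 1 else 0)
      + (if T b a c ∧ r b < r a ∧ r b < r c then 1 else 0)
      + (if T c a b ∧ r c < r a ∧ r c < r b then 1 else 0) := by
    intro a b c
    by_cases h : T a b c
    · have hb := h1 _ _ _ h
      have hc := h1 _ _ _ (h2 _ _ _ h)
      obtain ⟨n1, n2, n3⟩ := hr _ _ _ h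
      simp only [h, hb, hc, true_and, if_true]
      rcases lt_or_gt_of_ne n1 with g1 | g1 <;> rcases lt_or_gt_of_ne n2 with g2 | g2 <;>
        rcases lt_or_gt_of_ne n3 with g3 | g3 <;>
        first
          | (exfalso; linarith)
          | simp [g1, g2, g3, g1.not_gt, g2.not_gt, g3.not_gt]
    · have hb : ¬ T b a c := fun h' => h (h1 _ _ _ h')
      have hc : ¬ T c a b := fun h' => h (h2 _ _ _ (h1 _ _ _ h'))
      simp [h, hb, hc]
  simp only [e1, Finset.sum_add_distrib]
  have e2 : (∑ a ∈ X, ∑ b ∈ X, ∑ c ∈ X, if T b a c ∧ r b < r a ∧ r b < r c then 1 else 0)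
      = ∑ a ∈ X, ∑ b ∈ X, ∑ c ∈ X, if T a b c ∧ r a < r b ∧ r a < r c then 1 else 0 :=
    Finset.sum_comm
  have e3 : (∑ a ∈ X, ∑ b ∈ X, ∑ c ∈ X, if T c a b ∧ r c < r a ∧ r c < r b then 1 else 0)
      = ∑ a ∈ X, ∑ b ∈ X, ∑ c ∈ X, if T a b c ∧ r a < r b ∧ r a < r c then 1 else 0 := by
    rw [Finset.sum_congr rfl fun a _ => Finset.sum_comm, Finset.sum_comm]
  rw [e2, e3]; ring

lemma pair_sum (X : Finset ι) (T : ι → ι → Prop) (r : ι → ℝ)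
    (h1 : ∀ a b, T a b → T b a) (hr : ∀ a b, T a b → r a ≠ r b) :
    (∑ a ∈ X, ∑ b ∈ X, if T a b then 1 else 0)
      = 2 * ∑ a ∈ X, ∑ b ∈ X, if T a b ∧ r a < r b then 1 else 0 := by
  have e1 : ∀ a b, (if T a b then 1 else 0) =
      (if T a b ∧ r a < r b then 1 else 0) + (if T b a ∧ r b < r a then 1 else 0) := by
    intro a b
    by_cases h : T a b
    · have hb := h1 _ _ h
      have n1 := hr _ _ h
      simp only [h, hb, true_and, if_true]
      rcases lt_or_gt_of_ne n1 with g1 | g1 <;> simp [g1, g1.not_gt]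
    · have hb : ¬ T b a := fun h' => h (h1 _ _ h')
      simp [h, hb]
  simp only [e1, Finset.sum_add_distrib]
  have e2 : (∑ a ∈ X, ∑ b ∈ X, if T b a ∧ r b < r a then 1 else 0)
      = ∑ a ∈ X, ∑ b ∈ X, if T a b ∧ r a < r b then 1 else 0 := Finset.sum_comm
  rw [e2]; ring

/-- The number of ordered edges of the link of `G`. -/
def Dg (X : Finset ι) (p : ι → U) (G : Finset ι) : ℕ :=
  ((X ×ˢ X).filter fun e => Edg X p G e.1 e.2).card

theorem Cfg.euler (hC : Cfg X p) {G : Finset ι} (hG : Fc X p G)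
    (hc : G.card + 4 = Module.finrank ℝ U) : Dg X p G + 12 ≤ 6 * (Nb X p G).card := by
  obtain ⟨η, hη⟩ := hG.exposes
  obtain ⟨F, hF, hgen⟩ := hC.exists_generic hη
  set r : ι → ℝ := fun v => F (p v) / η (p v) with hr
  have hcard : ∀ {v}, v ∈ Nb X p G → (insert v G).card + 3 = Module.finrank ℝ U := by
    intro v hv; rw [Finset.card_insert_of_notMem (mem_Nb.1 hv).1]; omega
  -- triples
  obtain ⟨T, hT0⟩ : ∃ T : ι → ι → ι → Prop, ∀ a b c, T a b c ↔ a ∈ Nb X p G ∧ Edg X p (insert a G) b c :=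
    ⟨_, fun _ _ _ => Iff.rfl⟩
  have hT : ∀ a b c, T a b c ↔ a ∉ G ∧ b ∉ G ∧ c ∉ G ∧ a ≠ b ∧ a ≠ c ∧ b ≠ c ∧
      Fc X p (insert a (insert b (insert c G))) := by
    intro a b c
    simp only [hT0, mem_Nb, Edg, Finset.mem_insert, not_or]
    constructor
    · rintro ⟨⟨h1, h2⟩, ⟨h3, h4⟩, ⟨h5, h6⟩, h7, h8⟩
      refine ⟨h1, h4, h6, fun h => h3 h.symm, fun h => h5 h.symm, h7, ?_⟩
      rwa [Finset.insert_comm c a, Finset.insert_comm b a] at h8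
    · rintro ⟨h1, h2, h3, h4, h5, h6, h7⟩
      refine ⟨⟨h1, hC.mono h7 ?_⟩, ⟨fun h => h4 h.symm, h2⟩, ⟨fun h => h5 h.symm, h3⟩, h6, ?_⟩
      · intro x; simp only [Finset.mem_insert]; tauto
      · rwa [Finset.insert_comm c a, Finset.insert_comm b a]
  have hTN : ∀ a b c, T a b c → a ∈ Nb X p G ∧ b ∈ Nb X p G ∧ c ∈ Nb X p G ∧ a ≠ b ∧ a ≠ c ∧ b ≠ c := by
    intro a b c h
    obtain ⟨h1, h2, h3, h4, h5, h6, h7⟩ := (hT a b c).1 h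
    refine ⟨((hT0 a b c).1 h).1, mem_Nb.2 ⟨h2, hC.mono h7 ?_⟩, mem_Nb.2 ⟨h3, hC.mono h7 ?_⟩, h4, h5, h6⟩ <;>
    · intro x; simp only [Finset.mem_insert]; tauto
  have htri := triple_sum X T r (by
    intro a b c h
    rw [hT] at h ⊢
    obtain ⟨h1, h2, h3, h4, h5, h6, h7⟩ := h
    exact ⟨h2, h1, h3, h4.symm, h6, h5, by rwa [Finset.insert_comm]⟩) (by
    intro a b c h
    rw [hT] at h ⊢
    obtain ⟨h1, h2, h3, h4, h5, h6, h7⟩ := h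
    exact ⟨h1, h3, h2, h5, h4, h6.symm, by rwa [Finset.insert_comm c b]⟩) (by
    intro a b c h
    obtain ⟨h1, h2, h3, h4, h5, h6⟩ := hTN a b c h
    exact ⟨hgen a h1 b h2 h4, hgen a h1 c h3 h5, hgen b h2 c h3 h6⟩)
  have hpair := pair_sum X (fun a b => Edg X p G a b) r (fun a b h => h.symm) (by
    intro a b h
    exact hgen a (h.symm.memNb hC) b (h.memNb hC) h.2.2.1)
  -- D
  have hD : Dg X p G = ∑ a ∈ X, ∑ b ∈ X, if Edg X p G a b then 1 else 0 := by
    rw [Dg, Finset.card_filter, Finset.sum_product]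
  have hnb : ∀ v ∈ Nb X p G, ((Nb X p (insert v G)).card : ℕ) = ∑ b ∈ X, if Edg X p G v b then 1 else 0 := by
    intro v hv
    rw [← Finset.card_filter]
    congr 1
    ext w
    rw [mem_Nb_insert (mem_Nb.1 hv).1, Finset.mem_filter]
    exact ⟨fun h => ⟨h.memX.2, h⟩, fun h => h.2⟩
  have hzero : ∀ v, v ∉ Nb X p G → ∀ b, ¬ Edg X p G v b := fun v hv b h => hv (h.symm.memNb hC)
  have hFv : ∀ v ∈ Nb X p G, ∀ x ∈ insert v G, (F - r v • η) (p x) = 0 := by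
    intro v hv x hx
    rw [Finset.mem_insert] at hx
    have h3 := hη.pos v (Nb_sub hv) (mem_Nb.1 hv).1
    rcases hx with rfl | hx
    · simp [hr, h3.ne']
    · simp [hF x hx, hη.zero x hx]
  have hFpos : ∀ v ∈ Nb X p G, ∀ w ∈ Nb X p G, (0 < (F - r v • η) (p w) ↔ r v < r w) := by
    intro v hv w hw
    have h3 := hη.pos w (Nb_sub hw) (mem_Nb.1 hw).1
    simp only [LinearMap.sub_apply, LinearMap.smul_apply, smul_eq_mul, sub_pos]
    rw [show r w = F (p w) / η (p w) from rfl, lt_div_iff₀ h3]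
  have hNbi : ∀ v ∈ Nb X p G, ∀ w ∈ Nb X p (insert v G), w ∈ Nb X p G := by
    intro v hv w hw
    exact ((mem_Nb_insert (mem_Nb.1 hv).1).1 hw).memNb hC
  have hupn : ∀ v ∈ Nb X p G, ((Nb X p (insert v G)).filter fun a => r v < r a).card
      = ∑ b ∈ X, if Edg X p G v b ∧ r v < r b then 1 else 0 := by
    intro v hv
    rw [← Finset.card_filter]
    congr 1
    ext w
    rw [Finset.mem_filter, mem_Nb_insert (mem_Nb.1 hv).1, Finset.mem_filter]
    exact ⟨fun h => ⟨h.1.memX.2, h⟩, fun h => h.2⟩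
  have hupt : ∀ v ∈ Nb X p G, ((X ×ˢ X).filter fun e => Edg X p (insert v G) e.1 e.2 ∧
      r v < r e.1 ∧ r v < r e.2).card
      = ∑ b ∈ X, ∑ c ∈ X, if T v b c ∧ r v < r b ∧ r v < r c then 1 else 0 := by
    intro v hv
    rw [Finset.card_filter, Finset.sum_product]
    simp only [hT0, hv, true_and]
  -- T = 2 D
  have hTD : (∑ a ∈ X, ∑ b ∈ X, ∑ c ∈ X, if T a b c then 1 else 0) = 2 * Dg X p G := by
    rw [hD, Finset.mul_sum]
    refine Finset.sum_congr rfl fun v hvX => ?_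
    by_cases hv : v ∈ Nb X p G
    · have := hC.up_all (hcard hv) (fun _ => True) (fun _ _ => trivial)
      rw [Finset.filter_true, hnb v hv, Finset.card_filter, Finset.sum_product] at this
      simp only [and_true] at this
      rw [← this]
      simp only [hT0, hv, true_and]
    · simp [hT0, hv, hzero v hv]
  -- each vertex
  have hgen_v : ∀ v ∈ Nb X p G,
      2 * (∑ b ∈ X, if Edg X p G v b ∧ r v < r b then 1 else 0) ≤
        (∑ b ∈ X, ∑ c ∈ X, if T v b c ∧ r v < r b ∧ r v < r c then 1 else 0) + 2 := by
    intro v hv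
    rw [← hupn v hv, ← hupt v hv]
    have := hC.up_pos (mem_Nb.1 hv).2 (hcard hv) (hFv v hv)
    rw [Finset.filter_congr (q := fun a => r v < r a) (fun a ha => hFpos v hv a (hNbi v hv a ha)),
      Finset.filter_congr (q := fun e : ι × ι => Edg X p (insert v G) e.1 e.2 ∧ r v < r e.1 ∧ r v < r e.2)] at this
    · exact this
    · intro e he
      refine and_congr_right fun hE => ?_
      rw [hFpos v hv _ (hNbi v hv _ (hE.symm.memNb hC)), hFpos v hv _ (hNbi v hv _ (hE.memNb hC))]
  have hne : (Nb X p G).Nonempty := by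
    obtain ⟨x, hx, hxG, hxF⟩ := hC.extend hG (by omega)
    exact ⟨x, mem_Nb.2 ⟨hxG, hxF⟩⟩
  obtain ⟨v0, hv0, hmin⟩ := Finset.exists_min_image (Nb X p G) r hne
  obtain ⟨v1, hv1, hmax⟩ := Finset.exists_max_image (Nb X p G) r hne
  have hv01 : v0 ≠ v1 := by
    rintro rfl
    obtain ⟨x, hx, hxG, hxF⟩ := hC.extend (mem_Nb.1 hv0).2 (by have := hcard hv0; omega)
    have hxN := (mem_Nb_insert (mem_Nb.1 hv0).1).1 (mem_Nb.2 ⟨hxG, hxF⟩)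
    exact hgen _ hv0 _ (hxN.memNb hC) hxN.2.2.1
      (le_antisymm (hmin _ (hxN.memNb hC)) (hmax _ (hxN.memNb hC)))
  have hmin' : 2 * (∑ b ∈ X, if Edg X p G v0 b ∧ r v0 < r b then 1 else 0) =
        (∑ b ∈ X, ∑ c ∈ X, if T v0 b c ∧ r v0 < r b ∧ r v0 < r c then 1 else 0) := by
    rw [← hupn v0 hv0, ← hupt v0 hv0]
    exact (hC.up_all (hcard hv0) (fun a => r v0 < r a) (by
      intro a ha
      have h1 := (mem_Nb_insert (mem_Nb.1 hv0).1).1 ha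
      exact lt_of_le_of_ne (hmin _ (h1.memNb hC)) (hgen _ hv0 _ (h1.memNb hC) h1.2.2.1))).symm
  have hmax' : (∑ b ∈ X, if Edg X p G v1 b ∧ r v1 < r b then 1 else 0) = 0 := by
    refine Finset.sum_eq_zero fun b hb => if_neg ?_
    rintro ⟨h1, h2⟩
    exact absurd (hmax _ (h1.memNb hC)) (not_le.2 h2)
  -- total
  have hsumN : ∀ f : ι → ℕ, (∀ v ∈ X, v ∉ Nb X p G → f v = 0) → ∑ v ∈ X, f v = ∑ v ∈ Nb X p G, f v := by
    intro f hf
    exact (Finset.sum_subset Nb_sub (fun v hv hv' => hf v hv hv')).symm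
  rw [← hD] at hpair
  rw [hTD] at htri
  rw [hsumN _ (fun v _ hv => by simp [hzero v hv])] at hpair
  rw [hsumN _ (fun v _ hv => by simp [hT0, hv])] at htri
  have hpt : ∀ v ∈ Nb X p G,
      2 * (∑ b ∈ X, if Edg X p G v b ∧ r v < r b then 1 else 0) +
        (if v = v0 ∨ v = v1 then 2 else 0) ≤
        (∑ b ∈ X, ∑ c ∈ X, if T v b c ∧ r v < r b ∧ r v < r c then 1 else 0) + 2 := by
    intro v hv
    split_ifs with h
    · rcases h with rfl | rfl
      · rw [hmin']
      · rw [hmax']; omega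
    · exact hgen_v v hv
  have hs := Finset.sum_le_sum hpt
  rw [Finset.sum_add_distrib, Finset.sum_add_distrib, ← Finset.mul_sum, Finset.sum_const,
    smul_eq_mul, ← Finset.sum_filter, Finset.sum_const, smul_eq_mul] at hs
  have h4 : ((Nb X p G).filter fun v => v = v0 ∨ v = v1) = {v0, v1} := by
    ext v
    rw [Finset.mem_filter, Finset.mem_insert, Finset.mem_singleton]
    exact ⟨fun h => h.2, fun h => ⟨by rcases h with rfl | rfl <;> assumption, h⟩⟩
  rw [h4, Finset.card_pair hv01] at hs
  omega

end
end R18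

namespace R18

section
variable {ι U : Type} [DecidableEq ι] [AddCommGroup U] [Module ℝ U] [FiniteDimensional ℝ U]
variable {X : Finset ι} {p : ι → U}

lemma rank_nullity {V W : Type} [AddCommMonoid V] [Module ℝ V] [AddCommMonoid W] [Module ℝ W]
    [Module.Finite ℝ V] (f : V →ₗ[ℝ] W) :
    Module.finrank ℝ (LinearMap.range f) + Module.finrank ℝ (LinearMap.ker f) =
      Module.finrank ℝ V := by
  let _ : AddCommGroup V := Module.addCommMonoidToAddCommGroup ℝ
  let _ : AddCommGroup W := Module.addCommMonoidToAddCommGroup ℝ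
  exact LinearMap.finrank_range_add_finrank_ker f

lemma eq_zero_of_finrank {V : Type} [AddCommMonoid V] [Module ℝ V] [Module.Finite ℝ V]
    (h : Module.finrank ℝ V = 0) (x : V) : x = 0 := by
  let _ : AddCommGroup V := Module.addCommMonoidToAddCommGroup ℝ
  have := Module.finrank_zero_iff.1 h
  exact Subsingleton.elim _ _

lemma AltS_eq_zero {S : Submodule ℝ U} (h : Module.finrank ℝ U ≤ Module.finrank ℝ S + 1)
    {B : U →ₗ[ℝ] Module.Dual ℝ U} (hB : B ∈ AltS S) : B = 0 := by
  have h2 := finrank_AltS S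
  rw [Nat.choose_eq_zero_of_lt (by omega)] at h2
  exact congr_arg Subtype.val (eq_zero_of_finrank h2 ⟨B, hB⟩)

lemma finrank_mono' {V : Type} [AddCommMonoid V] [Module ℝ V]
    [Module.Finite ℝ V] {S T : Submodule ℝ V} (h : S ≤ T) :
    Module.finrank ℝ S ≤ Module.finrank ℝ T := by
  let _ : AddCommGroup V := Module.addCommMonoidToAddCommGroup ℝ
  exact Submodule.finrank_mono h

lemma finrank_range_le' {V W : Type} [AddCommMonoid V] [Module ℝ V] [AddCommMonoid W] [Module ℝ W]
    [Module.Finite ℝ V] (f : V →ₗ[ℝ] W) :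
    Module.finrank ℝ (LinearMap.range f) ≤ Module.finrank ℝ V := by
  have := rank_nullity f; omega

lemma inj_of_ker {V W : Type} [AddCommMonoid V] [Module ℝ V] [AddCommMonoid W] [Module ℝ W]
    (f : V →ₗ[ℝ] W) (h : ∀ x, f x = 0 → x = 0) : Function.Injective f := by
  let _ : AddCommGroup V := Module.addCommMonoidToAddCommGroup ℝ
  let _ : AddCommGroup W := Module.addCommMonoidToAddCommGroup ℝ
  exact (injective_iff_map_eq_zero f).2 h

lemma surj_of_finrank {V W : Type} [AddCommMonoid V] [Module ℝ V] [AddCommMonoid W] [Module ℝ W]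
    [Module.Finite ℝ V] [Module.Finite ℝ W] (f : V →ₗ[ℝ] W)
    (h : Module.finrank ℝ W + Module.finrank ℝ (LinearMap.ker f) ≤ Module.finrank ℝ V) :
    Function.Surjective f := by
  let _ : AddCommGroup V := Module.addCommMonoidToAddCommGroup ℝ
  let _ : AddCommGroup W := Module.addCommMonoidToAddCommGroup ℝ
  have h1 := rank_nullity f
  rw [← LinearMap.range_eq_top]
  apply Submodule.eq_top_of_finrank_eq
  apply le_antisymm (Submodule.finrank_le _)
  omega

lemma finrank_range_surj {V W : Type} [AddCommMonoid V] [Module ℝ V] [AddCommMonoid W] [Module ℝ W]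
    (f : V →ₗ[ℝ] W) (h : Function.Surjective f) :
    Module.finrank ℝ (LinearMap.range f) = Module.finrank ℝ W := by
  rw [LinearMap.range_eq_top.2 h, finrank_top]

lemma finrank_range_inj {V W : Type} [AddCommMonoid V] [Module ℝ V] [AddCommMonoid W] [Module ℝ W]
    (f : V →ₗ[ℝ] W) (h : Function.Injective f) :
    Module.finrank ℝ (LinearMap.range f) = Module.finrank ℝ V :=
  LinearMap.finrank_range_of_inj h

lemma finrank_pi' {J : Type} [Fintype J] {V : J → Type} [∀ i, AddCommMonoid (V i)]
    [∀ i, Module ℝ (V i)] [∀ i, Module.Finite ℝ (V i)] :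
    Module.finrank ℝ (∀ i, V i) = ∑ i, Module.finrank ℝ (V i) := by
  let _ : ∀ i, AddCommGroup (V i) := fun i => Module.addCommMonoidToAddCommGroup ℝ
  exact Module.finrank_pi_fintype ℝ

lemma exists_rank (X : Finset ι) : ∃ r : ι → ℝ, ∀ v ∈ X, ∀ w ∈ X, v ≠ w → r v ≠ r w := by
  refine ⟨fun v => if h : v ∈ X then ((X.equivFin ⟨v, h⟩ : ℕ) : ℝ) else 0, ?_⟩
  intro v hv w hw hvw h
  simp only [hv, hw, dif_pos, Nat.cast_inj] at h
  have := X.equivFin.injective (Fin.ext h)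
  exact hvw (Subtype.mk.inj this)

abbrev Wsp (p : ι → U) (G Y : Finset ι) : Type := (v : {x // x ∈ Y}) → ann p (insert v.1 G)

lemma finrank_Wsp {G Y : Finset ι} {k : ℕ}
    (h : ∀ v ∈ Y, LinearIndepOn ℝ p ((insert v G : Finset ι) : Set ι))
    (hk : ∀ v ∈ Y, (insert v G).card + k = Module.finrank ℝ U) :
    Module.finrank ℝ (Wsp p G Y) = Y.card * k := by
  rw [finrank_pi']
  have : ∀ v : {x // x ∈ Y}, Module.finrank ℝ (ann p (insert v.1 G)) = k := by
    intro v
    have h1 := finrank_ann (h v.1 v.2)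
    have h2 := hk v.1 v.2
    omega
  simp [this]

/-- Extension by zero. -/
def Wext {G Y : Finset ι} (M : Wsp p G Y) (v : ι) : Module.Dual ℝ U :=
  if h : v ∈ Y then (M ⟨v, h⟩).1 else 0

lemma Wext_of {G Y : Finset ι} (M : Wsp p G Y) {v : ι} (h : v ∈ Y) : Wext M v = (M ⟨v, h⟩).1 :=
  dif_pos h

lemma Wext_not {G Y : Finset ι} (M : Wsp p G Y) {v : ι} (h : v ∉ Y) : Wext M v = 0 :=
  dif_neg h

lemma Wext_kill {G Y : Finset ι} (M : Wsp p G Y) (v : ι) {x : ι} (hx : x ∈ insert v G) :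
    Wext M v (p x) = 0 := by
  by_cases h : v ∈ Y
  · rw [Wext_of M h]; exact mem_ann.1 (M ⟨v, h⟩).2 x hx
  · rw [Wext_not M h]; simp

lemma Wext_add {G Y : Finset ι} (M M' : Wsp p G Y) (v : ι) :
    Wext (M + M') v = Wext M v + Wext M' v := by
  by_cases h : v ∈ Y
  · simp [Wext_of _ h]
  · simp [Wext_not _ h]

lemma Wext_smul {G Y : Finset ι} (c : ℝ) (M : Wsp p G Y) (v : ι) :
    Wext (c • M) v = c • Wext M v := by
  by_cases h : v ∈ Y
  · simp [Wext_of _ h]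
  · simp [Wext_not _ h]

/-- The rigidity map. -/
def Rmap (G Y : Finset ι) (E : Finset (ι × ι)) : Wsp p G Y →ₗ[ℝ] ({e // e ∈ E} → ℝ) where
  toFun M e := Wext M e.1.1 (p e.1.2) + Wext M e.1.2 (p e.1.1)
  map_add' M M' := by
    funext e; simp only [Wext_add, LinearMap.add_apply, Pi.add_apply]; ring
  map_smul' c M := by
    funext e; simp only [Wext_smul, LinearMap.smul_apply, Pi.smul_apply, smul_eq_mul, RingHom.id_apply]; ring

/-- Trivial motions. -/
def Theta (p : ι → U) (G Y : Finset ι) : AltS (Submodule.span ℝ (p '' (G : Set ι))) →ₗ[ℝ] Wsp p G Y where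
  toFun B v := ⟨B.1 (p v.1), mem_ann.2 (by
    intro x hx
    rw [Finset.mem_insert] at hx
    rcases hx with rfl | hx
    · exact B.2.1 _
    · rw [alt_symm B.2.1, B.2.2 _ (Submodule.subset_span ⟨x, hx, rfl⟩)]; simp)⟩
  map_add' B B' := by funext v; apply Subtype.ext; simp
  map_smul' c B := by funext v; apply Subtype.ext; simp

lemma finrank_AltG {G : Finset ι} (h : LinearIndepOn ℝ p (G : Set ι)) :
    Module.finrank ℝ (AltS (Submodule.span ℝ (p '' (G : Set ι))))
      = (Module.finrank ℝ U - G.card).choose 2 := by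
  rw [finrank_AltS, finrank_span_indep h]

theorem Cfg.ind (hC : Cfg X p) {G : Finset ι} (hG : Fc X p G)
    (hc : G.card + 4 = Module.finrank ℝ U) {Y : Finset ι} (hY : Y ⊆ Nb X p G)
    (hsp : Module.finrank ℝ U ≤
      Module.finrank ℝ (Submodule.span ℝ (p '' ((G ∪ Y : Finset ι) : Set ι))) + 1) :
    ((Y ×ˢ Y).filter fun e => Edg X p G e.1 e.2).card + 12 ≤ 6 * Y.card := by
  obtain ⟨r, hr⟩ := exists_rank X
  set N := Nb X p G with hN
  let E : Finset ι → Finset (ι × ι) := fun Z =>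
    (Z ×ˢ Z).filter fun e => Edg X p G e.1 e.2 ∧ r e.1 < r e.2
  have hE : ∀ Z, ((Z ×ˢ Z).filter fun e => Edg X p G e.1 e.2).card = 2 * (E Z).card := by
    intro Z
    have := pair_sum Z (fun a b => Edg X p G a b) r (fun a b h => h.symm)
      (fun a b h => hr a h.memX.1 b h.memX.2 h.2.2.1)
    rw [Finset.card_filter, Finset.sum_product, this, Finset.card_filter, Finset.sum_product]
  have hind : ∀ v ∈ N, LinearIndepOn ℝ p ((insert v G : Finset ι) : Set ι) :=
    fun v hv => hC.Fc_indep (mem_Nb.1 hv).2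
  have hk : ∀ v ∈ N, (insert v G).card + 3 = Module.finrank ℝ U := by
    intro v hv; rw [Finset.card_insert_of_notMem (mem_Nb.1 hv).1]; omega
  have hWN := finrank_Wsp (p := p) hind hk
  have hWY := finrank_Wsp (p := p) (Y := Y) (fun v hv => hind v (hY hv)) (fun v hv => hk v (hY hv))
  have hAlt := finrank_AltG (hC.Fc_indep hG)
  rw [show Module.finrank ℝ U - G.card = 4 by omega, show Nat.choose 4 2 = 6 by decide] at hAlt
  -- kernel on N
  have hkerN : LinearMap.ker (Rmap (p := p) G N (E N)) ≤ LinearMap.range (Theta p G N) := by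
    intro M hM
    rw [LinearMap.mem_ker] at hM
    have hMe : ∀ v w, Edg X p G v w → Wext M v (p w) + Wext M w (p v) = 0 := by
      intro v w h
      rcases lt_or_gt_of_ne (hr v h.memX.1 w h.memX.2 h.2.2.1) with hl | hl
      · have h0 : (v, w) ∈ E N := Finset.mem_filter.2
          ⟨Finset.mem_product.2 ⟨h.symm.memNb hC, h.memNb hC⟩, h, hl⟩
        exact congr_fun hM ⟨(v, w), h0⟩
      · have h0 : (w, v) ∈ E N := Finset.mem_filter.2
          ⟨Finset.mem_product.2 ⟨h.memNb hC, h.symm.memNb hC⟩, h.symm, hl⟩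
        rw [add_comm]
        exact congr_fun hM ⟨(w, v), h0⟩
    have hG0 : ∀ g ∈ G, Wext M g = 0 := fun g hg => Wext_not M fun h => (mem_Nb.1 h).1 hg
    have hmot : Mot X p G (Wext M) := by
      intro v w hf
      by_cases hv : v ∈ G
      · rw [hG0 v hv, Wext_kill M w (Finset.mem_insert_of_mem hv)]; simp
      by_cases hw : w ∈ G
      · rw [hG0 w hw, Wext_kill M v (Finset.mem_insert_of_mem hw)]; simp
      by_cases hvw : v = w
      · subst hvw; rw [Wext_kill M v (Finset.mem_insert_self _ _)]; simp
      exact hMe v w ⟨hv, hw, hvw, hf⟩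
    obtain ⟨B, hB, hBM⟩ := hC.rigid hG hc.le hmot
    refine ⟨⟨B, hB, ?_⟩, ?_⟩
    · intro s hs
      have : Submodule.span ℝ (p '' (G : Set ι)) ≤ LinearMap.ker B := by
        rw [Submodule.span_le]
        rintro _ ⟨g, hg, rfl⟩
        have h1 := hBM g (by rwa [Finset.insert_eq_of_mem hg])
        rw [hG0 g hg] at h1
        exact h1.symm
      exact this hs
    · funext v
      apply Subtype.ext
      have h1 := hBM v.1 (mem_Nb.1 v.2).2
      rw [Wext_of M v.2] at h1
      exact h1.symm
  have hkN : Module.finrank ℝ (LinearMap.ker (Rmap (p := p) G N (E N))) ≤ 6 := by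
    rw [← hAlt]
    exact (finrank_mono' hkerN).trans (finrank_range_le' _)
  have hsurjN : Function.Surjective (Rmap (p := p) G N (E N)) := by
    apply surj_of_finrank
    rw [hWN]
    have h2 := hC.euler hG hc
    rw [← hN] at h2
    have h3 : Dg X p G = 2 * (E N).card := by
      rw [← hE]
      rw [Dg]
      congr 1
      ext e
      simp only [Finset.mem_filter, Finset.mem_product]
      exact ⟨fun h => ⟨⟨h.2.symm.memNb hC, h.2.memNb hC⟩, h.2⟩, fun h => ⟨h.2.memX, h.2⟩⟩
    rw [Module.finrank_fintype_fun_eq_card, Fintype.card_coe]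
    omega
  have hsurjY : Function.Surjective (Rmap (p := p) G Y (E Y)) := by
    intro t
    obtain ⟨M, hM⟩ := hsurjN (fun e => if h : e.1 ∈ E Y then t ⟨e.1, h⟩ else 0)
    refine ⟨fun v => M ⟨v.1, hY v.2⟩, ?_⟩
    funext e
    have he := e.2
    obtain ⟨h1, h2⟩ := Finset.mem_filter.1 he
    obtain ⟨h3, h4⟩ := Finset.mem_product.1 h1
    have h5 : e.1 ∈ E N := Finset.mem_filter.2 ⟨Finset.mem_product.2 ⟨hY h3, hY h4⟩, h2⟩
    have h6 := congr_fun hM ⟨e.1, h5⟩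
    simp only [he, dif_pos] at h6
    rw [← h6]
    change Wext _ _ _ + Wext _ _ _ = Wext _ _ _ + Wext _ _ _
    rw [Wext_of _ h3, Wext_of _ h4, Wext_of _ (hY h3), Wext_of _ (hY h4)]
  have hrangeY : LinearMap.range (Theta p G Y) ≤ LinearMap.ker (Rmap (p := p) G Y (E Y)) := by
    rintro _ ⟨B, rfl⟩
    rw [LinearMap.mem_ker]
    funext e
    obtain ⟨h3, h4⟩ := Finset.mem_product.1 (Finset.mem_filter.1 e.2).1
    change Wext _ _ _ + Wext _ _ _ = 0
    rw [Wext_of _ h3, Wext_of _ h4]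
    change B.1 _ _ + B.1 _ _ = 0
    rw [alt_symm B.2.1]; ring
  have hinj : Function.Injective (Theta p G Y) := by
    refine inj_of_ker _ fun B hB => ?_
    have h1 : B.1 ∈ AltS (Submodule.span ℝ (p '' ((G ∪ Y : Finset ι) : Set ι))) := by
      refine ⟨B.2.1, fun s hs => ?_⟩
      have : Submodule.span ℝ (p '' ((G ∪ Y : Finset ι) : Set ι)) ≤ LinearMap.ker B.1 := by
        rw [Submodule.span_le]
        rintro _ ⟨g, hg, rfl⟩
        rw [Finset.mem_coe, Finset.mem_union] at hg
        rcases hg with hg | hg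
        · exact B.2.2 _ (Submodule.subset_span ⟨g, hg, rfl⟩)
        · exact congr_arg Subtype.val (congr_fun hB ⟨g, hg⟩)
      exact this hs
    exact Subtype.ext (AltS_eq_zero hsp h1)
  have h1 := rank_nullity (Rmap (p := p) G Y (E Y))
  have h1' := finrank_range_surj _ hsurjY
  rw [Module.finrank_fintype_fun_eq_card, Fintype.card_coe] at h1'
  rw [h1', hWY] at h1
  have h2 := finrank_mono' hrangeY
  rw [finrank_range_inj _ hinj, hAlt] at h2
  have h3 := hE Y
  omega

end
end R18

namespace R18

section
variable {ι U : Type} [DecidableEq ι] [AddCommGroup U] [Module ℝ U] [FiniteDimensional ℝ U]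
variable {X : Finset ι} {p : ι → U}
variable {ν : ι → ι} {o : U} {ε : Module.Dual ℝ U}

structure CS (X : Finset ι) (p : ι → U) (ν : ι → ι) (o : U) (ε : Module.Dual ℝ U) : Prop where
  cfg : Cfg X p
  inv : ∀ x, ν (ν x) = x
  memX : ∀ x ∈ X, ν x ∈ X
  eo : ε o = 1
  ep : ∀ x, ε (p x) = 1
  pn : ∀ x, p (ν x) = (2 : ℝ) • o - p x

/-- The reflection. -/
def sg (o : U) (ε : Module.Dual ℝ U) : U →ₗ[ℝ] U :=
  (2 : ℝ) • LinearMap.smulRight ε o - LinearMap.id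

lemma sg_apply (x : U) : sg o ε x = (2 * ε x) • o - x := by
  simp [sg, smul_smul]

lemma CS.sg_p (h : CS X p ν o ε) (x : ι) : sg o ε (p x) = p (ν x) := by
  rw [sg_apply, h.ep, h.pn]; simp

lemma CS.sg_o (h : CS X p ν o ε) : sg o ε o = o := by
  rw [sg_apply, h.eo]; module

lemma CS.sg_sg (h : CS X p ν o ε) (x : U) : sg o ε (sg o ε x) = x := by
  rw [sg_apply, sg_apply]
  simp only [map_sub, map_smul, h.eo, smul_eq_mul]
  module

lemma CS.nu_inj (h : CS X p ν o ε) : Function.Injective ν := fun a b hab => by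
  rw [← h.inv a, hab, h.inv]

lemma CS.memX_iff (h : CS X p ν o ε) {x : ι} : ν x ∈ X ↔ x ∈ X :=
  ⟨fun hx => h.inv x ▸ h.memX _ hx, h.memX x⟩

lemma CS.mem_image (h : CS X p ν o ε) {x : ι} {s : Finset ι} : x ∈ s.image ν ↔ ν x ∈ s := by
  rw [Finset.mem_image]
  constructor
  · rintro ⟨a, ha, rfl⟩; rwa [h.inv]
  · intro hx; exact ⟨ν x, hx, h.inv x⟩

lemma CS.image_image (h : CS X p ν o ε) (s : Finset ι) : (s.image ν).image ν = s := by
  ext x; rw [h.mem_image, h.mem_image, h.inv]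

lemma CS.Fc_nu (h : CS X p ν o ε) {s : Finset ι} (hs : Fc X p s) : Fc X p (s.image ν) := by
  obtain ⟨hsX, F, hF, h1, h2⟩ := hs
  refine ⟨?_, F ∘ₗ sg o ε, ?_, ?_, ?_⟩
  · intro x hx; rw [h.mem_image] at hx; exact h.memX_iff.1 (hsX hx)
  · intro h0
    apply hF
    refine LinearMap.ext fun x => ?_
    have := LinearMap.congr_fun h0 (sg o ε x)
    simpa [h.sg_sg] using this
  · intro x hx
    rw [LinearMap.comp_apply, h.sg_p]; exact h1 _ (h.memX x hx)
  · intro x hx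
    rw [LinearMap.comp_apply, h.sg_p, h2 _ (h.memX x hx), h.mem_image]

lemma CS.Fc_nu_iff (h : CS X p ν o ε) {s : Finset ι} : Fc X p (s.image ν) ↔ Fc X p s :=
  ⟨fun hs => h.image_image s ▸ h.Fc_nu hs, h.Fc_nu⟩

lemma CS.Fo_pos (h : CS X p ν o ε) {F : Module.Dual ℝ U} (hF : F ≠ 0)
    (hpos : ∀ x ∈ X, 0 ≤ F (p x)) : 0 < F o := by
  by_contra hcon
  apply hF
  apply h.cfg.span
  intro x hx
  have h1 := hpos x hx
  have h2 := hpos _ (h.memX x hx)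
  rw [h.pn, map_sub, map_smul, smul_eq_mul] at h2
  linarith

lemma CS.F_nu_pos (h : CS X p ν o ε) {F : Module.Dual ℝ U} (hF : F ≠ 0)
    (hpos : ∀ x ∈ X, 0 ≤ F (p x)) {v : ι} (hv : F (p v) = 0) : 0 < F (p (ν v)) := by
  have := h.Fo_pos hF hpos
  rw [h.pn, map_sub, map_smul, smul_eq_mul, hv]; linarith

lemma CS.anti (h : CS X p ν o ε) {s : Finset ι} (hs : Fc X p s) {v : ι} (hv : v ∈ s) : ν v ∉ s := by
  intro hv'
  obtain ⟨η, hη⟩ := hs.exposes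
  have h1 := h.F_nu_pos hη.ne hη.nonneg (hη.zero v hv)
  rw [hη.zero _ hv'] at h1
  exact lt_irrefl _ h1

lemma CS.nu_ne (h : CS X p ν o ε) {v : ι} (hv : v ∈ X) : ν v ≠ v := by
  intro h0
  exact h.anti (h.cfg.vert v hv) (Finset.mem_singleton_self v) (by rw [h0]; simp)

lemma CS.Edg_nu (h : CS X p ν o ε) {v w : ι} (he : Edg X p ∅ v w) : Edg X p ∅ (ν v) (ν w) := by
  refine ⟨by simp, by simp, fun h0 => he.2.2.1 (h.nu_inj h0), ?_⟩
  have := h.Fc_nu he.2.2.2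
  simpa [Finset.image_insert] using this

lemma CS.Edg_ne (h : CS X p ν o ε) {G : Finset ι} {v w : ι} (he : Edg X p G v w) : w ≠ ν v := by
  rintro rfl
  exact h.anti he.2.2.2 (v := v) (by simp) (by simp)

structure Odd (X : Finset ι) (ν : ι → ι) (f : ι → ℝ) : Prop where
  inj : ∀ v ∈ X, ∀ w ∈ X, v ≠ w → f v ≠ f w
  odd : ∀ v, f (ν v) = - f v

lemma CS.exists_odd (h : CS X p ν o ε) : ∃ f : ι → ℝ, Odd X ν f := by
  obtain ⟨F, hF, hne⟩ := Module.Dual.exists_forall_mem_ne_zero_of_forall_exists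
    (⊤ : Submodule ℝ (Module.Dual ℝ U))
    (fun e : {e : ι × ι // e ∈ X.offDiag} => Module.Dual.eval ℝ U (p e.1.1 - p e.1.2)) (by
    rintro ⟨⟨v, w⟩, he⟩
    obtain ⟨hv, hw, hvw⟩ := Finset.mem_offDiag.1 he
    obtain ⟨ρ, hρ⟩ := (h.cfg.vert v hv).exposes
    refine ⟨ρ, trivial, ?_⟩
    have h1 := hρ.zero v (Finset.mem_singleton_self _)
    have h2 := hρ.pos w hw (by rw [Finset.mem_singleton]; exact fun h => hvw h.symm)
    rw [Module.Dual.eval_apply]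
    simp only [map_sub, h1, zero_sub, ne_eq, neg_eq_zero]
    exact h2.ne')
  refine ⟨fun v => F (p v) - F o, ?_, ?_⟩
  · intro v hv w hw hvw heq
    have h := hne ⟨(v, w), Finset.mem_offDiag.2 ⟨hv, hw, hvw⟩⟩
    rw [Module.Dual.eval_apply] at h
    simp only [map_sub] at h
    apply h; linarith
  · intro v
    rw [h.pn, map_sub, map_smul, smul_eq_mul]; ring

variable {f : ι → ℝ}

lemma Odd.ne_zero (hf : Odd X ν f) (h : CS X p ν o ε) {v : ι} (hv : v ∈ X) : f v ≠ 0 := by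
  intro h0
  apply hf.inj v hv (ν v) (h.memX v hv) (h.nu_ne hv).symm
  rw [hf.odd, h0, neg_zero]

lemma Odd.abs_ne (hf : Odd X ν f) (h : CS X p ν o ε) {v w : ι} (hv : v ∈ X) (hw : w ∈ X)
    (h1 : v ≠ w) (h2 : w ≠ ν v) : |f w| ≠ |f v| := by
  intro h0
  rcases abs_eq_abs.1 h0 with h3 | h3
  · exact hf.inj v hv w hw h1 h3.symm
  · rw [← hf.odd] at h3
    exact hf.inj w hw (ν v) (h.memX v hv) h2 h3

lemma Odd.half (hf : Odd X ν f) (h : CS X p ν o ε) {C : Finset ι} (hC : C ⊆ X)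
    (hCn : ∀ c ∈ C, ν c ∈ C) : C.card = 2 * (C.filter fun c => 0 < f c).card := by
  have h1 := Finset.card_filter_add_card_filter_not (s := C) (fun c => 0 < f c)
  have h2 : (C.filter fun c => ¬ 0 < f c).card = (C.filter fun c => 0 < f c).card := by
    apply Finset.card_nbij' ν ν
    · intro c hc
      simp only [Finset.coe_filter, Set.mem_ofPred_eq] at hc ⊢
      refine ⟨hCn c hc.1, ?_⟩
      rw [hf.odd]
      have := hf.ne_zero h (hC hc.1)
      rcases lt_or_gt_of_ne this with h3 | h3
      · linarith
      · exact absurd h3 hc.2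
    · intro c hc
      simp only [Finset.coe_filter, Set.mem_ofPred_eq] at hc ⊢
      refine ⟨hCn c hc.1, ?_⟩
      rw [hf.odd]; linarith [hc.2]
    · intro c _; exact h.inv c
    · intro c _; exact h.inv c
  omega

lemma Odd.quarter (hf : Odd X ν f) (h : CS X p ν o ε) {T : Finset (ι × ι)}
    (h1 : ∀ a b, (a, b) ∈ T → (b, a) ∈ T) (h2 : ∀ a b, (a, b) ∈ T → (ν a, ν b) ∈ T) :
    4 * (T.filter fun e => |f e.2| < f e.1).card ≤ T.card := by
  have e1 : (T.filter fun e => |f e.2| < - f e.1).card = (T.filter fun e => |f e.2| < f e.1).card := by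
    apply Finset.card_nbij' (fun e => (ν e.1, ν e.2)) (fun e => (ν e.1, ν e.2))
    · rintro ⟨a, b⟩ hc
      simp only [Finset.coe_filter, Set.mem_ofPred_eq] at hc ⊢
      refine ⟨h2 _ _ hc.1, ?_⟩
      rw [hf.odd, hf.odd, abs_neg]; exact hc.2
    · rintro ⟨a, b⟩ hc
      simp only [Finset.coe_filter, Set.mem_ofPred_eq] at hc ⊢
      refine ⟨h2 _ _ hc.1, ?_⟩
      rw [hf.odd, hf.odd, abs_neg, neg_neg]; exact hc.2
    · rintro ⟨a, b⟩ _; simp [h.inv]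
    · rintro ⟨a, b⟩ _; simp [h.inv]
  have sw : ∀ s : ℝ, (T.filter fun e => |f e.1| < s * f e.2).card
      = (T.filter fun e => |f e.2| < s * f e.1).card := by
    intro s
    apply Finset.card_nbij' Prod.swap Prod.swap
    · rintro ⟨a, b⟩ hc
      simp only [Finset.coe_filter, Set.mem_ofPred_eq, Prod.swap] at hc ⊢
      exact ⟨h1 _ _ hc.1, hc.2⟩
    · rintro ⟨a, b⟩ hc
      simp only [Finset.coe_filter, Set.mem_ofPred_eq, Prod.swap] at hc ⊢
      exact ⟨h1 _ _ hc.1, hc.2⟩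
    · rintro ⟨a, b⟩ _; simp
    · rintro ⟨a, b⟩ _; simp
  have e2 := sw 1
  have e3 := sw (-1)
  simp only [one_mul, neg_one_mul] at e2 e3
  have key : (T.filter fun e => |f e.2| < f e.1).card + (T.filter fun e => |f e.2| < - f e.1).card
      + (T.filter fun e => |f e.1| < f e.2).card + (T.filter fun e => |f e.1| < - f e.2).card
      ≤ T.card := by
    simp only [Finset.card_filter, Finset.card_eq_sum_ones T, ← Finset.sum_add_distrib]
    apply Finset.sum_le_sum
    rintro ⟨a, b⟩ _
    have := abs_nonneg (f a)
    have := abs_nonneg (f b)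
    have := le_abs_self (f a)
    have := le_abs_self (f b)
    have := neg_le_abs (f a)
    have := neg_le_abs (f b)
    dsimp only
    split_ifs <;> first | omega | (exfalso; linarith)
  omega

end
end R18

namespace R18

section
variable {ι U : Type} [DecidableEq ι] [AddCommGroup U] [Module ℝ U] [FiniteDimensional ℝ U]
variable {X : Finset ι} {p : ι → U}
variable {ν : ι → ι} {o : U} {ε : Module.Dual ℝ U}
variable {f : ι → ℝ}

lemma Cfg.dual_ext (hC : Cfg X p) {A A' : Module.Dual ℝ U} (h : ∀ x ∈ X, A (p x) = A' (p x)) (y : U) :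
    A y = A' y := by
  have := hC.span (A - A') (fun x hx => by rw [LinearMap.sub_apply, h x hx, sub_self])
  have := LinearMap.congr_fun this y
  simp only [LinearMap.sub_apply, LinearMap.zero_apply] at this
  linarith

/-- Edge functional. -/
def phi (p : ι → U) (M : ι → Module.Dual ℝ U) (v w : ι) : ℝ := M v (p w) + M w (p v)

lemma phi_comm (M : ι → Module.Dual ℝ U) (v w : ι) : phi p M v w = phi p M w v := add_comm _ _

/-- symmetric extension -/
def Sext (ν : ι → ι) (o : U) (ε : Module.Dual ℝ U) {G Y : Finset ι} (y : Wsp p G Y) (v : ι) :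
    Module.Dual ℝ U := Wext y v - (Wext y (ν v)) ∘ₗ sg o ε

lemma Sext_apply {G Y : Finset ι} (y : Wsp p G Y) (v : ι) (x : U) :
    Sext ν o ε y v x = Wext y v x - Wext y (ν v) (sg o ε x) := rfl

lemma CS.Sext_self (h : CS X p ν o ε) {G Y : Finset ι} (y : Wsp p G Y) (v : ι) :
    Sext ν o ε y v (p v) = 0 := by
  rw [Sext_apply, h.sg_p, Wext_kill y v (Finset.mem_insert_self _ _),
    Wext_kill y (ν v) (Finset.mem_insert_self _ _), sub_zero]

lemma CS.Sext_nu (h : CS X p ν o ε) {G Y : Finset ι} (y : Wsp p G Y) (v : ι) (x : U) :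
    Sext ν o ε y (ν v) x = - Sext ν o ε y v (sg o ε x) := by
  rw [Sext_apply, Sext_apply, h.sg_sg, h.inv]; ring

lemma CS.phi_nu (h : CS X p ν o ε) {M : ι → Module.Dual ℝ U}
    (hM : ∀ v x, M (ν v) x = - M v (sg o ε x)) (v w : ι) :
    phi p M (ν v) (ν w) = - phi p M v w := by
  rw [phi, phi, hM, hM, h.sg_p, h.sg_p, h.inv, h.inv]; ring

/-- symmetric rigidity map. -/
def Smap (ν : ι → ι) (o : U) (ε : Module.Dual ℝ U) (Y : Finset ι) (E : Finset (ι × ι)) :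
    Wsp p ∅ Y →ₗ[ℝ] ({e // e ∈ E} → ℝ) where
  toFun y e := phi p (Sext ν o ε y) e.1.1 e.1.2
  map_add' M M' := by
    funext e; simp only [phi, Sext_apply, Wext_add, LinearMap.add_apply, Pi.add_apply]; ring
  map_smul' c M := by
    funext e
    simp only [phi, Sext_apply, Wext_smul, LinearMap.smul_apply, Pi.smul_apply, smul_eq_mul, RingHom.id_apply]
    ring

/-- trivial symmetric motions -/
def Psi (p : ι → U) (ε : Module.Dual ℝ U) (hε : ∀ x, ε (p x) = 1) (Y : Finset ι) :
    Module.Dual ℝ U →ₗ[ℝ] Wsp p ∅ Y where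
  toFun β v := ⟨β - β (p v.1) • ε, mem_ann.2 (by
    intro x hx
    rw [Finset.mem_insert] at hx
    rcases hx with rfl | hx
    · simp [hε]
    · simp at hx)⟩
  map_add' B B' := by
    funext v; apply Subtype.ext
    refine LinearMap.ext fun x => ?_
    change ((B + B') - (B + B') (p v.1) • ε) x = (B - B (p v.1) • ε) x + (B' - B' (p v.1) • ε) x
    simp; ring
  map_smul' c B := by
    funext v; apply Subtype.ext
    refine LinearMap.ext fun x => ?_
    change ((c • B) - (c • B) (p v.1) • ε) x = c * (B - B (p v.1) • ε) x
    simp; ring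

structure Full (X : Finset ι) (p : ι → U) (ν : ι → ι) (o : U) (ε : Module.Dual ℝ U) (d : ℕ) : Prop
    extends CS X p ν o ε where
  d5 : 5 ≤ d
  dim : Module.finrank ℝ U = d + 1
  cnt : Dg X p ∅ + 4 * d ≤ 2 * d * X.card
  ne : X.Nonempty

variable {d : ℕ}

lemma Full.Fc_empty (h : Full X p ν o ε d) : Fc X p ∅ := by
  obtain ⟨x, hx⟩ := h.ne
  exact h.cfg.mono (h.cfg.vert x hx) (by simp)

theorem Full.surj (h : Full X p ν o ε d) (c : ι → ι → ℝ) (hc : ∀ v w, c v w = c w v)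
    (hcn : ∀ v w, c (ν v) (ν w) = - c v w) :
    ∃ M : ι → Module.Dual ℝ U, (∀ v, M v (p v) = 0) ∧ (∀ v x, M (ν v) x = - M v (sg o ε x)) ∧
      ∀ v w, Edg X p ∅ v w → phi p M v w = c v w := by
  obtain ⟨f, hf⟩ := h.exists_odd
  set H := X.filter fun v => 0 < f v with hH
  have hHX : X.card = 2 * H.card := hf.half h.toCS (Finset.Subset.refl X) h.memX
  set T := (X ×ˢ X).filter fun e => Edg X p ∅ e.1 e.2 with hT
  have hTm : ∀ v w, (v, w) ∈ T ↔ Edg X p ∅ v w := by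
    intro v w
    rw [hT, Finset.mem_filter, Finset.mem_product]
    exact ⟨fun h => h.2, fun h => ⟨h.memX, h⟩⟩
  set E := T.filter fun e => |f e.2| < f e.1 with hE
  have hEm : ∀ v w, (v, w) ∈ E ↔ Edg X p ∅ v w ∧ |f w| < f v := by
    intro v w; rw [hE, Finset.mem_filter, hTm]
  have hcard : 4 * E.card ≤ T.card := hf.quarter h.toCS
    (fun a b hab => (hTm _ _).2 ((hTm _ _).1 hab).symm)
    (fun a b hab => (hTm _ _).2 (h.Edg_nu ((hTm _ _).1 hab)))
  have hDg : T.card = Dg X p ∅ := rfl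
  -- reduction of all edges to `E`
  have red : ∀ (M : ι → Module.Dual ℝ U) (c : ι → ι → ℝ), (∀ v w, c v w = c w v) →
      (∀ v w, c (ν v) (ν w) = - c v w) → (∀ v x, M (ν v) x = - M v (sg o ε x)) →
      (∀ v w, (v, w) ∈ E → phi p M v w = c v w) → ∀ v w, Edg X p ∅ v w → phi p M v w = c v w := by
    intro M c h1 h2 h3 h4
    have half : ∀ v w, Edg X p ∅ v w → |f w| < |f v| → phi p M v w = c v w := by
      intro v w he hlt
      by_cases hv : 0 < f v
      · rw [abs_of_pos hv] at hlt
        exact h4 v w ((hEm _ _).2 ⟨he, hlt⟩)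
      · rw [abs_of_nonpos (not_lt.1 hv)] at hlt
        have := h4 (ν v) (ν w) ((hEm _ _).2 ⟨h.Edg_nu he, by rwa [hf.odd, hf.odd, abs_neg]⟩)
        rw [h.phi_nu h3, h2] at this
        linarith
    intro v w he
    rcases lt_or_gt_of_ne (hf.abs_ne h.toCS he.memX.1 he.memX.2 he.2.2.1 (h.Edg_ne he)) with hl | hl
    · exact half v w he hl
    · rw [phi_comm, h1]; exact half w v he.symm hl
  -- kernel
  have hker : LinearMap.ker (Smap (p := p) ν o ε H E) ≤ LinearMap.range (Psi p ε h.ep H) := by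
    intro y hy
    rw [LinearMap.mem_ker] at hy
    have hall := red (Sext ν o ε y) (fun _ _ => 0) (fun _ _ => rfl) (fun _ _ => by simp)
      (h.Sext_nu y) (fun v w hvw => congr_fun hy ⟨(v, w), hvw⟩)
    have hmot : Mot X p ∅ (Sext ν o ε y) := by
      intro v w hvw
      by_cases hne : v = w
      · subst hne; rw [h.Sext_self]; simp
      · exact hall v w ⟨by simp, by simp, hne, hvw⟩
    obtain ⟨B, hB, hBM⟩ := h.cfg.rigid h.Fc_empty (by rw [h.dim]; have := h.d5; simp; omega) hmot
    have hBX : ∀ v ∈ X, ∀ x, Sext ν o ε y v x = B (p v) x := by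
      intro v hv x
      rw [hBM v (by simpa using h.cfg.vert v hv)]
    have hBs : ∀ x z, B (sg o ε x) z = - B x (sg o ε z) := by
      intro x z
      have := h.cfg.dual_ext (A := B.flip z ∘ₗ sg o ε) (A' := - B.flip (sg o ε z)) (by
        intro v hv
        simp only [LinearMap.comp_apply, LinearMap.neg_apply, LinearMap.flip_apply]
        rw [h.sg_p, ← hBX _ (h.memX v hv), ← hBX v hv, h.Sext_nu]) x
      simpa using this
    refine ⟨B o, ?_⟩
    funext v
    apply Subtype.ext
    change B o - (B o (p v.1)) • ε = (y v).1
    have hvX : v.1 ∈ X := (Finset.mem_filter.1 v.2).1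
    have hvf : 0 < f v.1 := (Finset.mem_filter.1 v.2).2
    have hnv : ν v.1 ∉ H := by
      intro h0
      have := (Finset.mem_filter.1 h0).2
      rw [hf.odd] at this; linarith
    refine LinearMap.ext fun x => ?_
    have h1 : Sext ν o ε y v.1 x = (y v).1 x := by
      rw [Sext_apply, Wext_not y hnv, Wext_of y v.2]; simp
    rw [← h1, hBX _ hvX]
    have h2 := hBs (p v.1 - o) (x - ε x • o)
    rw [sg_apply, sg_apply] at h2
    have h3 := hB o
    simp only [map_sub, map_smul, LinearMap.sub_apply, LinearMap.smul_apply, h.ep, h.eo,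
      smul_eq_mul, h3] at h2 ⊢
    have h4 := alt_symm hB (p v.1) o
    simp only [sub_self, mul_one, mul_zero, sub_zero, zero_sub] at h2
    rw [h4] at h2
    linarith
  have hrk : Module.finrank ℝ (LinearMap.range (Psi p ε h.ep H)) ≤ d := by
    have h1 := rank_nullity (Psi p ε h.ep H)
    rw [Subspace.dual_finrank_eq, h.dim] at h1
    have h2 : Module.finrank ℝ (LinearMap.ker (Psi p ε h.ep H)) ≠ 0 := by
      intro h0
      have hmem : ε ∈ LinearMap.ker (Psi p ε h.ep H) := by
        rw [LinearMap.mem_ker]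
        funext v
        apply Subtype.ext
        refine LinearMap.ext fun x => ?_
        change (ε - (ε (p v.1)) • ε) x = 0
        simp [h.ep]
      have := congr_arg Subtype.val (eq_zero_of_finrank h0 ⟨ε, hmem⟩)
      have h3 := h.eo
      have h4 : ε = 0 := this
      rw [h4] at h3; simp at h3
    omega
  have hW : Module.finrank ℝ (Wsp p ∅ H) = H.card * d := by
    apply finrank_Wsp
    · intro v hv
      simpa using h.cfg.Fc_indep (h.cfg.vert v (Finset.mem_filter.1 hv).1)
    · intro v hv; rw [h.dim]; simp; omega
  have hs : Function.Surjective (Smap (p := p) ν o ε H E) := by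
    apply surj_of_finrank
    rw [hW, Module.finrank_fintype_fun_eq_card, Fintype.card_coe]
    have h1 := (finrank_mono' hker).trans hrk
    have h2 := h.cnt
    rw [← hDg, hHX] at h2
    have : 2 * d * (2 * H.card) = 4 * (H.card * d) := by ring
    omega
  obtain ⟨y, hy⟩ := hs (fun e => c e.1.1 e.1.2)
  exact ⟨Sext ν o ε y, h.Sext_self y, h.Sext_nu y, red _ c hc hcn (h.Sext_nu y)
    (fun v w hvw => congr_fun hy ⟨(v, w), hvw⟩)⟩

end
end R18

namespace R18

section
variable {ι U : Type} [DecidableEq ι] [AddCommGroup U] [Module ℝ U] [FiniteDimensional ℝ U]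
variable {X : Finset ι} {p : ι → U}
variable {ν : ι → ι} {o : U} {ε : Module.Dual ℝ U}
variable {f : ι → ℝ} {d : ℕ}

theorem Full.real (h : Full X p ν o ε d) (T : ι → ι → Prop) (g : ι → ι → ℝ)
    (hT : ∀ v w, T v w → T w v) (hg : ∀ v w, g v w = g w v)
    (hTg : ∀ v w, T v w → T (ν v) (ν w) → g v w + g (ν v) (ν w) = 0) :
    ∃ M : ι → Module.Dual ℝ U, (∀ v, M v (p v) = 0) ∧ (∀ v x, M (ν v) x = - M v (sg o ε x)) ∧
      (∀ v w, Edg X p ∅ v w → T v w → phi p M v w = g v w) ∧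
      (∀ v w, Edg X p ∅ v w → ¬ T v w → ¬ T (ν v) (ν w) → phi p M v w = 0) := by
  have hT' : ∀ v w, T v w ↔ T w v := fun v w => ⟨hT v w, hT w v⟩
  obtain ⟨M, h1, h2, h3⟩ := h.surj
    (fun v w => if T v w then g v w else if T (ν v) (ν w) then - g (ν v) (ν w) else 0) (by
      intro v w
      simp only [hT' v w, hT' (ν v), hg v w, hg (ν v)]) (by
      intro v w
      simp only [h.inv]
      by_cases a : T v w <;> by_cases b : T (ν v) (ν w)
      · have := hTg v w a b
        simp only [a, b, if_true]; linarith
      · simp [a, b]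
      · simp [a, b]
      · simp [a, b])
  refine ⟨M, h1, h2, fun v w he ht => ?_, fun v w he ht ht' => ?_⟩
  · rw [h3 v w he]; simp [ht]
  · rw [h3 v w he]; simp [ht, ht']

def Cc (X : Finset ι) (p : ι → U) (ν : ι → ι) (G : Finset ι) : Finset ι :=
  X.filter fun c => Fc X p (insert c G) ∧ Fc X p (insert (ν c) G)

lemma mem_Cc {G : Finset ι} {c : ι} :
    c ∈ Cc X p ν G ↔ Fc X p (insert c G) ∧ Fc X p (insert (ν c) G) := by
  rw [Cc, Finset.mem_filter]
  exact ⟨fun h => h.2, fun h => ⟨h.1.1 (Finset.mem_insert_self _ _), h⟩⟩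

lemma CS.Cc_nu (h : CS X p ν o ε) {G : Finset ι} {c : ι} (hc : c ∈ Cc X p ν G) : ν c ∈ Cc X p ν G := by
  rw [mem_Cc] at hc ⊢
  rw [h.inv]; exact ⟨hc.2, hc.1⟩

lemma CS.Cc_notMem (h : CS X p ν o ε) {G : Finset ι} {c : ι} (hc : c ∈ Cc X p ν G) : c ∉ G := fun hG =>
  h.anti (mem_Cc.1 hc).2 (v := c) (Finset.mem_insert_of_mem hG) (Finset.mem_insert_self _ _)

lemma CS.Cc_sub (h : CS X p ν o ε) {G : Finset ι} : Cc X p ν G ⊆ Nb X p G := fun c hc =>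
  mem_Nb.2 ⟨h.Cc_notMem hc, (mem_Cc.1 hc).1⟩

lemma Cc_subX {G : Finset ι} : Cc X p ν G ⊆ X := Finset.filter_subset _ _

lemma CS.Cc_mono (h : CS X p ν o ε) {G G' : Finset ι} (hG : G' ⊆ G) : Cc X p ν G ⊆ Cc X p ν G' := by
  intro c hc
  rw [mem_Cc] at hc ⊢
  exact ⟨h.cfg.mono hc.1 (Finset.insert_subset_insert _ hG),
    h.cfg.mono hc.2 (Finset.insert_subset_insert _ hG)⟩

def Oc (X : Finset ι) (p : ι → U) (ν : ι → ι) (G : Finset ι) : Finset (ι × ι) :=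
  (Cc X p ν G ×ˢ Cc X p ν G).filter fun e => Edg X p G e.1 e.2 ∧ Edg X p G (ν e.1) (ν e.2)

lemma CS.mem_Oc (h : CS X p ν o ε) {G : Finset ι} {v w : ι} :
    (v, w) ∈ Oc X p ν G ↔ Edg X p G v w ∧ Edg X p G (ν v) (ν w) := by
  rw [Oc, Finset.mem_filter, Finset.mem_product]
  refine ⟨fun h => h.2, fun h0 => ⟨⟨?_, ?_⟩, h0⟩⟩
  · exact mem_Cc.2 ⟨(mem_Nb.1 (h0.1.symm.memNb h.cfg)).2, (mem_Nb.1 (h0.2.symm.memNb h.cfg)).2⟩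
  · exact mem_Cc.2 ⟨(mem_Nb.1 (h0.1.memNb h.cfg)).2, (mem_Nb.1 (h0.2.memNb h.cfg)).2⟩

lemma Fc_swap {G : Finset ι} {v w : ι} (h : Fc X p (insert v (insert w G))) :
    Fc X p (insert w (insert v G)) := by rwa [Finset.insert_comm]

lemma Cfg.edg_down (hC : Cfg X p) {G : Finset ι} {v w : ι} (hvw : v ≠ w)
    (h : Fc X p (insert v (insert w G))) : Edg X p ∅ v w :=
  ⟨by simp, by simp, hvw, hC.mono h (by
    intro x hx; simp only [Finset.mem_insert, Finset.notMem_empty, or_false] at hx ⊢; tauto)⟩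

/-- Lambda. -/
def Lam (ν : ι → ι) (Y : Finset ι) (E : Finset (ι × ι)) :
    Wsp p ∅ Y →ₗ[ℝ] ({e // e ∈ E} → ℝ) where
  toFun y e := phi p (Wext y) e.1.1 e.1.2 + phi p (Wext y) (ν e.1.1) (ν e.1.2)
  map_add' M M' := by
    funext e; simp only [phi, Wext_add, LinearMap.add_apply, Pi.add_apply]; ring
  map_smul' c M := by
    funext e
    simp only [phi, Wext_smul, LinearMap.smul_apply, Pi.smul_apply, smul_eq_mul, RingHom.id_apply]
    ring

/-- restriction of forms -/
def Th2 (p : ι → U) (S : Submodule ℝ U) (Y : Finset ι) : AltS S →ₗ[ℝ] Wsp p ∅ Y where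
  toFun B v := ⟨B.1 (p v.1), mem_ann.2 (by
    intro x hx
    rw [Finset.mem_insert] at hx
    rcases hx with rfl | hx
    · exact B.2.1 _
    · simp at hx)⟩
  map_add' B B' := by
    funext v; apply Subtype.ext
    change (B.1 + B'.1) (p v.1) = B.1 (p v.1) + B'.1 (p v.1)
    rw [LinearMap.add_apply]
  map_smul' c B := by
    funext v; apply Subtype.ext
    change (c • B.1) (p v.1) = c • B.1 (p v.1)
    rw [LinearMap.smul_apply]

theorem Full.eps (h : Full X p ν o ε d) {G : Finset ι} (hG : Fc X p G) (hc : G.card + 3 ≤ d) {k : ℕ}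
    (hk : (Cc X p ν G).card = 2 * k) :
    4 * (k * d) + 4 * (d - k).choose 2 ≤ (Oc X p ν G).card + 4 * d.choose 2 := by
  obtain ⟨f, hf⟩ := h.exists_odd
  set C := Cc X p ν G with hC
  set H := C.filter fun v => 0 < f v with hH
  have hHk : H.card = k := by
    have : C.card = 2 * H.card := hf.half h.toCS Cc_subX (fun c hc => h.Cc_nu hc)
    omega
  set T := Oc X p ν G with hT
  set E := T.filter fun e => |f e.2| < f e.1 with hE
  have hEm : ∀ v w, (v, w) ∈ E ↔ (v, w) ∈ T ∧ |f w| < f v := by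
    intro v w; rw [hE, Finset.mem_filter]
  have hTsw : ∀ a b, (a, b) ∈ T → (b, a) ∈ T := fun a b hab => by
    rw [hT, h.mem_Oc] at hab ⊢; exact ⟨hab.1.symm, hab.2.symm⟩
  have hTnu : ∀ a b, (a, b) ∈ T → (ν a, ν b) ∈ T := fun a b hab => by
    rw [hT, h.mem_Oc] at hab ⊢; rw [h.inv, h.inv]; exact ⟨hab.2, hab.1⟩
  have hcard : 4 * E.card ≤ T.card := hf.quarter h.toCS hTsw hTnu
  have hker : LinearMap.ker (Lam (p := p) ν H E) ≤
      LinearMap.range (Th2 p (Submodule.span ℝ {o}) H) := by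
    intro y hy
    rw [LinearMap.mem_ker] at hy
    have hE0 : ∀ v w, (v, w) ∈ E → phi p (Wext y) v w + phi p (Wext y) (ν v) (ν w) = 0 :=
      fun v w hvw => congr_fun hy ⟨(v, w), hvw⟩
    have hT1 : ∀ v w, (v, w) ∈ T → |f w| < |f v| →
        phi p (Wext y) v w + phi p (Wext y) (ν v) (ν w) = 0 := by
      intro v w hvw hl
      by_cases hv : 0 < f v
      · rw [abs_of_pos hv] at hl
        exact hE0 v w ((hEm _ _).2 ⟨hvw, hl⟩)
      · rw [abs_of_nonpos (not_lt.1 hv)] at hl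
        have := hE0 (ν v) (ν w) ((hEm _ _).2 ⟨hTnu _ _ hvw, by rwa [hf.odd, hf.odd, abs_neg]⟩)
        rw [h.inv, h.inv] at this; linarith
    have hT0 : ∀ v w, (v, w) ∈ T → phi p (Wext y) v w + phi p (Wext y) (ν v) (ν w) = 0 := by
      intro v w hvw
      have he := (h.mem_Oc.1 hvw).1
      rcases lt_or_gt_of_ne (hf.abs_ne h.toCS he.memX.1 he.memX.2 he.2.2.1 (h.Edg_ne he)) with hl | hl
      · exact hT1 v w hvw hl
      · rw [phi_comm, phi_comm _ (ν v)]; exact hT1 w v (hTsw _ _ hvw) hl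
    have hself : ∀ v, phi p (Wext y) v v = 0 := fun v => by
      rw [phi, Wext_kill y v (Finset.mem_insert_self _ _), add_zero]
    obtain ⟨M', m1, m2, m3, -⟩ := h.real (fun v w => Fc X p (insert v (insert w G)))
      (phi p (Wext y)) (fun v w => Fc_swap) (phi_comm _) (by
        intro v w h1 h2
        by_cases hvw : v = w
        · subst hvw; rw [hself, hself, add_zero]
        · have hv : v ∈ C := mem_Cc.2 ⟨h.cfg.mono h1 (by
              intro x hx; simp only [Finset.mem_insert] at hx ⊢; tauto), h.cfg.mono h2 (by
              intro x hx; simp only [Finset.mem_insert] at hx ⊢; tauto)⟩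
          have hw : w ∈ C := mem_Cc.2 ⟨h.cfg.mono h1 (by
              intro x hx; simp only [Finset.mem_insert] at hx ⊢; tauto), h.cfg.mono h2 (by
              intro x hx; simp only [Finset.mem_insert] at hx ⊢; tauto)⟩
          refine hT0 v w (h.mem_Oc.2 ⟨⟨h.Cc_notMem hv, h.Cc_notMem hw, hvw, h1⟩,
            h.Cc_notMem (h.Cc_nu hv), h.Cc_notMem (h.Cc_nu hw), fun h0 => hvw (h.nu_inj h0), h2⟩))
    have hmot : Mot X p G (fun v => Wext y v - M' v) := by
      intro v w hvw
      by_cases hne : v = w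
      · subst hne
        simp only [LinearMap.sub_apply]
        rw [m1, Wext_kill y v (Finset.mem_insert_self _ _)]; simp
      · have := m3 v w (h.cfg.edg_down hne hvw) hvw
        simp only [phi, LinearMap.sub_apply] at this ⊢
        linarith
    obtain ⟨B, hB, hBM⟩ := h.cfg.rigid hG (by rw [h.dim]; omega) hmot
    refine ⟨⟨B + (B.comp (sg o ε)).compl₂ (sg o ε), ?_, ?_⟩, ?_⟩
    · intro x; simp [hB]
    · intro s hs
      obtain ⟨t, rfl⟩ := Submodule.mem_span_singleton.1 hs
      refine LinearMap.ext fun z => ?_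
      simp only [map_smul, LinearMap.smul_apply, LinearMap.add_apply, LinearMap.compl₂_apply,
        LinearMap.comp_apply, h.sg_o, LinearMap.zero_apply]
      rw [sg_apply, map_sub, map_smul, hB]; simp
    · funext v
      apply Subtype.ext
      have hvC := (Finset.mem_filter.1 v.2).1
      have hvf := (Finset.mem_filter.1 v.2).2
      have hnv : ν v.1 ∉ H := by
        intro h0
        have := (Finset.mem_filter.1 h0).2
        rw [hf.odd] at this; linarith
      have b1 := hBM v.1 (mem_Cc.1 hvC).1
      have b2 := hBM (ν v.1) (mem_Cc.1 hvC).2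
      refine LinearMap.ext fun x => ?_
      change B (p v.1) x + B (sg o ε (p v.1)) (sg o ε x) = (y v).1 x
      rw [h.sg_p, ← b1, ← b2]
      dsimp only
      rw [Wext_not y hnv, Wext_of y v.2]
      simp only [LinearMap.sub_apply, LinearMap.zero_apply]
      rw [m2, h.sg_sg]; ring
  have hW : Module.finrank ℝ (Wsp p ∅ H) = k * d := by
    rw [← hHk]
    apply finrank_Wsp
    · intro v hv
      simpa using h.cfg.Fc_indep (h.cfg.vert v (Cc_subX (Finset.mem_filter.1 hv).1))
    · intro v hv; rw [h.dim]; simp; omega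
  -- the kernel of Th2
  set S' : Submodule ℝ U := Submodule.span ℝ ((insert o (H.image p) : Finset U) : Set U) with hS'
  have hSr : Module.finrank ℝ S' ≤ k + 1 := by
    refine (finrank_span_finset_le_card _).trans ((Finset.card_insert_le _ _).trans ?_)
    have := Finset.card_image_le (s := H) (f := p)
    omega
  have hle : AltS S' ≤ AltS (Submodule.span ℝ {o}) := fun B hB => ⟨hB.1, fun s hs => hB.2 s (by
    refine Submodule.span_mono ?_ hs
    intro x hx; simp only [Set.mem_singleton_iff] at hx; subst hx; simp)⟩
  have hkT : (AltS S').comap (AltS (Submodule.span ℝ {o})).subtype ≤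
      LinearMap.ker (Th2 p (Submodule.span ℝ {o}) H) := by
    intro B hB
    rw [LinearMap.mem_ker]
    funext v
    apply Subtype.ext
    exact hB.2 _ (Submodule.subset_span (by
      rw [Finset.coe_insert, Finset.coe_image]
      exact Set.mem_insert_of_mem _ ⟨v.1, v.2, rfl⟩))
  have r1 := finrank_mono' hkT
  rw [(Submodule.comapSubtypeEquivOfLe hle).finrank_eq, finrank_AltS] at r1
  have r2 := rank_nullity (Th2 p (Submodule.span ℝ {o}) H)
  rw [finrank_AltS, finrank_span_singleton (by rintro rfl; have := h.eo; simp at this), h.dim] at r2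
  have r3 := finrank_mono' hker
  have r4 := rank_nullity (Lam (p := p) ν H E)
  rw [hW] at r4
  have r5 : Module.finrank ℝ (LinearMap.range (Lam (p := p) ν H E)) ≤ E.card := by
    have := Submodule.finrank_le (LinearMap.range (Lam (p := p) ν H E))
    rwa [Module.finrank_fintype_fun_eq_card, Fintype.card_coe] at this
  have r6 : (d - k).choose 2 ≤ (Module.finrank ℝ U - Module.finrank ℝ S').choose 2 :=
    Nat.choose_le_choose 2 (by rw [h.dim]; omega)
  simp only [Nat.add_sub_cancel] at r2
  omega

end
end R18

namespace R18

section
variable {ι U : Type} [DecidableEq ι] [AddCommGroup U] [Module ℝ U] [FiniteDimensional ℝ U]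
variable {X : Finset ι} {p : ι → U}
variable {ν : ι → ι} {o : U} {ε : Module.Dual ℝ U}
variable {f : ι → ℝ} {d : ℕ}

lemma ch2 (k : ℕ) : 2 * k.choose 2 + k = k * k := by
  induction k with
  | zero => simp
  | succ k ih => rw [Nat.choose_succ_succ' k 1, Nat.choose_one_right]; nlinarith

lemma Full.eps_le (h : Full X p ν o ε d) {G : Finset ι} (hG : Fc X p G) (hc : G.card + 3 ≤ d) {k : ℕ}
    (hk : (Cc X p ν G).card = 2 * k) (hkd : k ≤ d) : 2 * (k * (k + 1)) ≤ (Oc X p ν G).card := by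
  have h1 := h.eps hG hc hk
  obtain ⟨j, rfl⟩ := Nat.exists_eq_add_of_le hkd
  rw [Nat.add_sub_cancel_left] at h1
  have h2 := ch2 j
  have h3 := ch2 (k + j)
  nlinarith

lemma Full.eps_ge (h : Full X p ν o ε d) {G : Finset ι} (hG : Fc X p G) (hc : G.card + 3 ≤ d) {k : ℕ}
    (hk : (Cc X p ν G).card = 2 * k) : 4 * (k * d) + 2 * d ≤ (Oc X p ν G).card + 2 * (d * d) := by
  have h1 := h.eps hG hc hk
  have h3 := ch2 d
  omega

lemma CS.indep_nu (h : CS X p ν o ε) {s : Finset ι} (hs : Fc X p s) {a : ι} (ha : a ∈ s) :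
    LinearIndepOn ℝ p ((insert (ν a) s : Finset ι) : Set ι) := by
  obtain ⟨η, hη⟩ := hs.exposes
  exact indep_insert (h.cfg.Fc_indep hs) hη.zero (h.F_nu_pos hη.ne hη.nonneg (hη.zero a ha)).ne'

lemma span_ge {s t : Finset ι} (hs : LinearIndepOn ℝ p (s : Set ι)) (hst : s ⊆ t) :
    s.card ≤ Module.finrank ℝ (Submodule.span ℝ (p '' (t : Set ι))) := by
  rw [← finrank_span_indep hs]
  exact finrank_mono' (Submodule.span_mono (Set.image_mono (by exact_mod_cast hst)))

/-- Non-antipodal pairs. -/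
def Ap (ν : ι → ι) (C : Finset ι) : Finset (ι × ι) :=
  (C ×ˢ C).filter fun e => e.2 ≠ e.1 ∧ e.2 ≠ ν e.1

lemma CS.card_Ap (h : CS X p ν o ε) {C : Finset ι} (hC : C ⊆ X) (hCn : ∀ c ∈ C, ν c ∈ C) :
    (Ap ν C).card = C.card * (C.card - 2) := by
  rw [Ap, Finset.card_filter, Finset.sum_product]
  have : ∀ a ∈ C, (∑ b ∈ C, if b ≠ a ∧ b ≠ ν a then 1 else 0) = C.card - 2 := by
    intro a ha
    rw [← Finset.card_filter]
    have e : (C.filter fun b => b ≠ a ∧ b ≠ ν a) = (C.erase a).erase (ν a) := by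
      ext b; simp only [Finset.mem_filter, Finset.mem_erase]; tauto
    rw [e, Finset.card_erase_of_mem (Finset.mem_erase.2 ⟨h.nu_ne (hC ha), hCn a ha⟩),
      Finset.card_erase_of_mem ha]
    omega
  rw [Finset.sum_congr rfl this]; simp

lemma CS.Oc_sub (h : CS X p ν o ε) {G : Finset ι} : Oc X p ν G ⊆ Ap ν (Cc X p ν G) := by
  rintro ⟨a, b⟩ he
  have h1 := h.mem_Oc.1 he
  exact Finset.mem_filter.2 ⟨(Finset.mem_filter.1 he).1, h1.1.2.2.1.symm, h.Edg_ne h1.1⟩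

lemma CS.Cc_even (h : CS X p ν o ε) (G : Finset ι) : ∃ k, (Cc X p ν G).card = 2 * k := by
  obtain ⟨f, hf⟩ := h.exists_odd
  exact ⟨_, hf.half h Cc_subX (fun c hc => h.Cc_nu hc)⟩

theorem Full.oct (h : Full X p ν o ε d) {G : Finset ι} (hG : Fc X p G) (hc : G.card + 3 = d)
    (hne : (Cc X p ν G).Nonempty) : (Cc X p ν G).card = 6 ∧
      ∀ a ∈ Cc X p ν G, ∀ b ∈ Cc X p ν G, a ≠ b → b ≠ ν a → Edg X p G a b := by
  obtain ⟨k, hk⟩ := h.Cc_even G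
  have hk0 : 1 ≤ k := by have := hne.card_pos; omega
  have e1 : k ≤ d → _ := h.eps_le hG hc.le hk
  have e2 := h.eps_ge hG hc.le hk
  have hd := h.d5
  have hO : 1 ≤ (Oc X p ν G).card := by
    rcases le_total k d with hkd | hkd
    · have := e1 hkd; nlinarith
    · nlinarith
  obtain ⟨⟨a, b⟩, hab⟩ := Finset.card_pos.1 hO
  have hab' := (h.mem_Oc.1 hab)
  have hi := h.indep_nu hab'.1.2.2.2 (a := a) (by simp)
  have hcard : (insert (ν a) (insert a (insert b G))).card = d := by
    rw [Finset.card_insert_of_notMem (h.anti hab'.1.2.2.2 (by simp)),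
      Finset.card_insert_of_notMem, Finset.card_insert_of_notMem hab'.1.2.1]
    · exact hc
    · rw [Finset.mem_insert, not_or]; exact ⟨hab'.1.2.2.1, hab'.1.1⟩
  have hpm := (Finset.mem_product.1 (Finset.mem_filter.1 hab).1)
  have hsp := span_ge hi (t := G ∪ Cc X p ν G) (by
    intro x hx
    simp only [Finset.mem_insert, Finset.mem_union] at hx ⊢
    rcases hx with rfl | rfl | rfl | hx
    · right; exact h.Cc_nu hpm.1
    · right; exact hpm.1
    · right; exact hpm.2
    · left; exact hx)
  rw [hcard] at hsp
  have hind := h.cfg.ind hG (by rw [h.dim]; omega) h.Cc_sub (by rw [h.dim]; omega)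
  have hOE : (Oc X p ν G).card ≤
      ((Cc X p ν G ×ˢ Cc X p ν G).filter fun e => Edg X p G e.1 e.2).card := by
    apply Finset.card_le_card
    intro e he
    rw [Oc, Finset.mem_filter] at he
    exact Finset.mem_filter.2 ⟨he.1, he.2.1⟩
  have hAp := h.card_Ap (C := Cc X p ν G) Cc_subX (fun c hc => h.Cc_nu hc)
  have hOA := Finset.card_le_card (h.Oc_sub (G := G))
  rw [hAp, hk] at hOA
  have hk3 : k = 3 := by
    rcases le_total k d with hkd | hkd
    · have h1 := e1 hkd
      have h2 : k * (k + 1) + 6 ≤ 6 * k := by omega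
      have h3 : k ≤ 3 := by nlinarith
      interval_cases k <;> omega
    · exfalso
      have h1 : 4 * (k * d) + 2 * d + 12 ≤ 12 * k + 2 * (d * d) := by omega
      obtain ⟨j, rfl⟩ := Nat.exists_eq_add_of_le hkd
      obtain ⟨i, rfl⟩ := Nat.exists_eq_add_of_le hd
      nlinarith [Nat.zero_le (j * i), Nat.zero_le (i * i)]
  subst hk3
  refine ⟨hk, ?_⟩
  have h24 := e1 (by omega)
  have heq := Finset.eq_of_subset_of_card_le (h.Oc_sub (G := G)) (by rw [hAp, hk]; omega)
  intro a ha b hb h1 h2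
  have : (a, b) ∈ Oc X p ν G := by
    rw [heq]; exact Finset.mem_filter.2 ⟨Finset.mem_product.2 ⟨ha, hb⟩, h1.symm, h2⟩
  exact (h.mem_Oc.1 this).1

/-- an edge with both ends in the star and not in the star has its antipode in the star. -/
theorem Full.edge_or (h : Full X p ν o ε d) {G : Finset ι} (hc : G.card + 3 ≤ d)
    {x y : ι} (hx : Fc X p (insert x G)) (hy : Fc X p (insert y G)) (he : Edg X p ∅ x y) :
    Fc X p (insert x (insert y G)) ∨ Fc X p (insert (ν x) (insert (ν y) G)) := by
  by_contra hcon
  rw [not_or] at hcon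
  obtain ⟨P, hP⟩ : ∃ P : ι → ι → Prop, ∀ v w, P v w ↔ (v = x ∧ w = y) ∨ (v = y ∧ w = x) := ⟨_, fun _ _ => Iff.rfl⟩
  have hPs : ∀ v w, P v w ↔ P w v := fun v w => by rw [hP, hP]; tauto
  have hyx := h.Edg_ne he
  have hxX := he.memX.1
  have hyX := he.memX.2
  obtain ⟨M, m1, -, m3, -⟩ := h.real (fun v w => Fc X p (insert v (insert w G)) ∨ P v w)
    (fun v w => if P v w then 1 else 0) (by
      intro v w hvw
      rcases hvw with hvw | hvw
      · exact Or.inl (Fc_swap hvw)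
      · exact Or.inr ((hPs _ _).1 hvw)) (fun v w => by simp only [hPs v w]) (by
      intro v w h1 h2
      have key : ∀ v w, P v w → ¬ (Fc X p (insert (ν v) (insert (ν w) G)) ∨ P (ν v) (ν w)) := by
        intro v w hvw
        rcases (hP _ _).1 hvw with ⟨rfl, rfl⟩ | ⟨rfl, rfl⟩
        · rw [not_or]
          refine ⟨hcon.2, fun h0 => ?_⟩
          rcases (hP _ _).1 h0 with h0 | h0
          · exact h.nu_ne hxX h0.1
          · exact hyx h0.1.symm
        · rw [not_or]
          refine ⟨fun h0 => hcon.2 (Fc_swap h0), fun h0 => ?_⟩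
          rcases (hP _ _).1 h0 with h0 | h0
          · exact hyx h0.2.symm
          · exact h.nu_ne hxX h0.2
      have n1 : ¬ P v w := fun h0 => key v w h0 h2
      have n2 : ¬ P (ν v) (ν w) := fun h0 => key _ _ h0 (by rw [h.inv, h.inv]; exact h1)
      simp [n1, n2])
  have hmot : Mot X p G M := by
    intro v w hvw
    by_cases hne : v = w
    · subst hne; rw [m1]; simp
    · have := m3 v w (h.cfg.edg_down hne hvw) (Or.inl hvw)
      have hn : ¬ P v w := by
        intro h0
        rcases (hP _ _).1 h0 with ⟨rfl, rfl⟩ | ⟨rfl, rfl⟩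
        · exact hcon.1 hvw
        · exact hcon.1 (Fc_swap hvw)
      simp only [hn, if_false] at this
      exact this
  obtain ⟨B, hB, hBM⟩ := h.cfg.rigid (h.cfg.mono hx (Finset.subset_insert _ _)) (by rw [h.dim]; omega) hmot
  have h1 := m3 x y he (Or.inr ((hP _ _).2 (Or.inl ⟨rfl, rfl⟩)))
  rw [if_pos ((hP _ _).2 (Or.inl ⟨rfl, rfl⟩)), phi, hBM x hx, hBM y hy, alt_symm hB] at h1
  norm_num at h1

theorem Full.L1 (h : Full X p ν o ε d) {G : Finset ι} (hc : G.card + 3 = d)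
    {x y : ι} (hx : Fc X p (insert x G)) (hy : Fc X p (insert y G)) (he : Edg X p ∅ x y) :
    Fc X p (insert x (insert y G)) := by
  rcases h.edge_or hc.le hx hy he with h1 | h1
  · exact h1
  · have hxC : x ∈ Cc X p ν G := mem_Cc.2 ⟨hx, h.cfg.mono h1 (by
      intro z hz; simp only [Finset.mem_insert] at hz ⊢; tauto)⟩
    have hyC : y ∈ Cc X p ν G := mem_Cc.2 ⟨hy, h.cfg.mono h1 (by
      intro z hz; simp only [Finset.mem_insert] at hz ⊢; tauto)⟩
    exact ((h.oct (h.cfg.mono hx (Finset.subset_insert _ _)) hc ⟨x, hxC⟩).2 x hxC y hyC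
      he.2.2.1 (h.Edg_ne he)).2.2.2

end
end R18

namespace R18

section
variable {ι U : Type} [DecidableEq ι] [AddCommGroup U] [Module ℝ U] [FiniteDimensional ℝ U]
variable {X : Finset ι} {p : ι → U}
variable {ν : ι → ι} {o : U} {ε : Module.Dual ℝ U}
variable {f : ι → ℝ} {d : ℕ}

/-- Case A: the links of `u` and its antipode are disjoint; prime. -/
structure CaseA (X : Finset ι) (p : ι → U) (ν : ι → ι) (o : U) (ε : Module.Dual ℝ U) (d : ℕ) (u : ι) : Prop
    extends Full X p ν o ε d where
  hu : u ∈ X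
  prime : ∀ σ : Finset ι, σ ⊆ X → σ.card = d → (∀ τ, τ ⊂ σ → Fc X p τ) → Fc X p σ
  c0 : Cc X p ν {u} = ∅

variable {u : ι}

lemma CaseA.no (h : CaseA X p ν o ε d u) {v : ι} {G : Finset ι} (huG : u ∈ G) (h1 : Fc X p (insert v G))
    (h2 : Fc X p (insert (ν v) G)) : False := by
  have : v ∈ Cc X p ν {u} := h.Cc_mono (Finset.singleton_subset_iff.2 huG) (mem_Cc.2 ⟨h1, h2⟩)
  rw [h.c0] at this
  simp at this

lemma CaseA.real (h : CaseA X p ν o ε d u) (g : ι → ι → ℝ) (hg : ∀ v w, g v w = g w v) :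
    ∃ M : ι → Module.Dual ℝ U, (∀ v, M v (p v) = 0) ∧
      ∀ v w, v ≠ w → Fc X p (insert v (insert w {u})) → phi p M v w = g v w := by
  obtain ⟨M, m1, -, m3, -⟩ := h.toFull.real (fun v w => Fc X p (insert v (insert w {u}))) g
    (fun v w hvw => Fc_swap hvw) hg (by
      intro v w h1 h2
      exact (h.no (G := {u}) (v := v) (Finset.mem_singleton_self _)
        (h.cfg.mono h1 (by intro z hz; simp only [Finset.mem_insert, Finset.mem_singleton] at hz ⊢; tauto))
        (h.cfg.mono h2 (by intro z hz; simp only [Finset.mem_insert, Finset.mem_singleton] at hz ⊢; tauto))).elim)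
  exact ⟨M, m1, fun v w hvw hF => m3 v w (h.cfg.edg_down hvw hF) hF⟩

lemma CaseA.FcX (h : CaseA X p ν o ε d u) : Fc X p {u} := h.cfg.vert u h.hu

/-- cliques of size at most `d-2` in the link of `u` are faces -/
lemma CaseA.clique (h : CaseA X p ν o ε d u) : ∀ (n : ℕ) (K : Finset ι), K.card = n → n + 2 ≤ d →
    K ⊆ Nb X p {u} → (∀ a ∈ K, ∀ b ∈ K, a ≠ b → Edg X p {u} a b) → Fc X p (insert u K) := by
  intro n
  induction n using Nat.strong_induction_on with
  | _ n ih =>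
  intro K hK hn hKN hKc
  by_cases h1 : n ≤ 1
  · rcases Nat.le_one_iff_eq_zero_or_eq_one.1 h1 with h1 | h1
    · rw [h1, Finset.card_eq_zero] at hK
      subst hK
      simpa using h.FcX
    · rw [h1, Finset.card_eq_one] at hK
      obtain ⟨a, rfl⟩ := hK
      have := (mem_Nb.1 (hKN (Finset.mem_singleton_self a))).2
      rwa [Finset.pair_comm] at this
  · obtain ⟨x, hx, y, hy, hxy⟩ := Finset.one_lt_card.1 (by omega : 1 < K.card)
    have sub : ∀ L, L ⊂ K → Fc X p (insert u L) := fun L hL => by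
      have := Finset.card_lt_card hL
      exact ih L.card (by omega) L rfl (by omega) (hL.1.trans hKN)
        (fun a ha b hb hab => hKc a (hL.1 ha) b (hL.1 hb) hab)
    have hcy : ((K.erase x).erase y).card + 2 = n := by
      rw [Finset.card_erase_of_mem (by simp [hy, hxy.symm]), Finset.card_erase_of_mem hx]; omega
    have huK : u ∉ K := fun hu => (mem_Nb.1 (hKN hu)).1 (Finset.mem_singleton_self _)
    have e1 : insert x (insert u ((K.erase x).erase y)) = insert u (K.erase y) := by
      rw [Finset.erase_right_comm, Finset.insert_comm, Finset.insert_erase (by simp [hx, hxy])]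
    have e2 : insert y (insert u ((K.erase x).erase y)) = insert u (K.erase x) := by
      rw [Finset.insert_comm, Finset.insert_erase (by simp [hy, hxy.symm])]
    have e3 : insert x (insert y (insert u ((K.erase x).erase y))) = insert u K := by
      rw [e2, Finset.insert_comm, Finset.insert_erase hx]
    have f1 : Fc X p (insert x (insert u ((K.erase x).erase y))) := by
      rw [e1]; exact sub _ (Finset.erase_ssubset hy)
    have f2 : Fc X p (insert y (insert u ((K.erase x).erase y))) := by
      rw [e2]; exact sub _ (Finset.erase_ssubset hx)
    rcases h.edge_or (by rw [Finset.card_insert_of_notMem (by simp [huK])]; omega) f1 f2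
      (h.cfg.edg_down hxy (hKc x hx y hy hxy).2.2.2) with h3 | h3
    · rwa [e3] at h3
    · exact (h.no (Finset.mem_insert_self _ _) f1 (h.cfg.mono h3 (by
        intro z hz; simp only [Finset.mem_insert] at hz ⊢; tauto))).elim

lemma CaseA.clique' (h : CaseA X p ν o ε d u) (K : Finset ι) (hn : K.card + 1 ≤ d)
    (hKN : K ⊆ Nb X p {u}) (hKc : ∀ a ∈ K, ∀ b ∈ K, a ≠ b → Edg X p {u} a b) : Fc X p (insert u K) := by
  by_cases hle : K.card + 2 ≤ d
  · exact h.clique K.card K rfl hle hKN hKc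
  have hd := h.d5
  have hcard : K.card + 1 = d := by omega
  have huK : u ∉ K := fun hu => (mem_Nb.1 (hKN hu)).1 (Finset.mem_singleton_self _)
  have sub : ∀ z ∈ K, Fc X p (insert u (K.erase z)) := fun z hz => by
    refine h.clique _ _ rfl ?_ ((Finset.erase_subset _ _).trans hKN)
      (fun a ha b hb hab => hKc a (Finset.mem_of_mem_erase ha) b (Finset.mem_of_mem_erase hb) hab)
    rw [Finset.card_erase_of_mem hz]; omega
  have hKf : Fc X p K := by
    obtain ⟨x, hx, y, hy, hxy⟩ := Finset.one_lt_card.1 (by omega : 1 < K.card)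
    have hcy : ((K.erase x).erase y).card + 3 = d := by
      rw [Finset.card_erase_of_mem (by simp [hy, hxy.symm]), Finset.card_erase_of_mem hx]; omega
    have e1 : insert x ((K.erase x).erase y) = K.erase y := by
      rw [Finset.erase_right_comm, Finset.insert_erase (by simp [hx, hxy])]
    have e2 : insert y ((K.erase x).erase y) = K.erase x := by
      rw [Finset.insert_erase (by simp [hy, hxy.symm])]
    have := h.L1 hcy (x := x) (y := y) (by rw [e1]; exact h.cfg.mono (sub y hy) (Finset.subset_insert _ _))
      (by rw [e2]; exact h.cfg.mono (sub x hx) (Finset.subset_insert _ _))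
      (h.cfg.edg_down hxy (hKc x hx y hy hxy).2.2.2)
    rwa [e2, Finset.insert_erase hx] at this
  refine h.prime _ ?_ (by rw [Finset.card_insert_of_notMem huK]; exact hcard) ?_
  · exact Finset.insert_subset h.hu (hKN.trans Nb_sub)
  · intro τ hτ
    obtain ⟨z, hz, hzτ⟩ := Finset.exists_of_ssubset hτ
    rcases Finset.mem_insert.1 hz with rfl | hz
    · refine h.cfg.mono hKf fun a ha => ?_
      rcases Finset.mem_insert.1 (hτ.1 ha) with rfl | h2
      · exact absurd ha hzτ
      · exact h2
    · refine h.cfg.mono (sub z hz) fun a ha => ?_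
      rcases Finset.mem_insert.1 (hτ.1 ha) with rfl | h2
      · simp
      · exact Finset.mem_insert_of_mem (Finset.mem_erase.2 ⟨fun e => hzτ (e ▸ ha), h2⟩)

lemma CaseA.card_Nb (h : CaseA X p ν o ε d u) : d ≤ (Nb X p {u}).card := by
  by_contra hcon
  have hd := h.d5
  obtain ⟨F, hF, hF0⟩ := exists_dual_kill (p := p) (s := insert u (Nb X p {u})) (by
    have := Finset.card_insert_le u (Nb X p {u})
    rw [h.dim]; omega)
  refine hF0 (h.cfg.span F fun x hx => ?_)
  have hc : ({u} : Finset ι).card + 2 ≤ Module.finrank ℝ U := by rw [h.dim]; simp; omega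
  have h1 := h.cfg.LP h.FcX hc (F := F) (fun x hx => hF x (by simp at hx; simp [hx]))
    (fun x hx hxu hf => (hF x (Finset.mem_insert_of_mem (mem_Nb.2 ⟨hxu, hf⟩))).ge) x hx
  have h2 := h.cfg.LP h.FcX hc (F := -F) (fun x hx => by
      rw [LinearMap.neg_apply, hF x (by simp at hx; simp [hx]), neg_zero])
    (fun x hx hxu hf => by
      rw [LinearMap.neg_apply, hF x (Finset.mem_insert_of_mem (mem_Nb.2 ⟨hxu, hf⟩)), neg_zero]) x hx
  rw [LinearMap.neg_apply] at h2
  linarith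

/-- expansion in the basis `insert u T`. -/
lemma CaseA.expand (h : CaseA X p ν o ε d u) (T : Finset ι) (hT : T.card = d)
    (hTN : T ⊆ Nb X p {u}) (hTc : ∀ a ∈ T, ∀ b ∈ T, a ≠ b → Edg X p {u} a b) {w : ι} (hw : w ∈ X) :
    ∃ (l : ι → ℝ) (m : ℝ), (∀ y ∈ T, 0 ≤ l y) ∧ p w = ∑ y ∈ T, l y • p y + m • p u := by
  have huT : u ∉ T := fun hu => (mem_Nb.1 (hTN hu)).1 (Finset.mem_singleton_self _)
  have hface : ∀ x ∈ T, Fc X p (insert u (T.erase x)) := fun x hx =>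
    h.clique' _ (by rw [Finset.card_erase_of_mem hx]; have := h.d5; omega) ((Finset.erase_subset _ _).trans hTN)
      (fun a ha b hb hab => hTc a (Finset.mem_of_mem_erase ha) b (Finset.mem_of_mem_erase hb) hab)
  have hTX : T ⊆ X := hTN.trans Nb_sub
  have hind : LinearIndepOn ℝ p ((insert u T : Finset ι) : Set ι) := by
    obtain ⟨x, hx⟩ : T.Nonempty := Finset.card_pos.1 (by have := h.d5; omega)
    obtain ⟨F, hF⟩ := (hface x hx).exposes
    have := indep_insert (p := p) (x := x) (h.cfg.Fc_indep (hface x hx)) (F := F) hF.zero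
      (hF.pos x (hTX hx) (by simp; rintro rfl; exact huT hx)).ne'
    rw [Finset.insert_comm, Finset.insert_erase hx] at this
    exact this
  have hsp := span_eq_top_of_card hind (by rw [Finset.card_insert_of_notMem huT, h.dim, hT])
  have hwm : p w ∈ Submodule.span ℝ (p '' ((insert u T : Finset ι) : Set ι)) := by rw [hsp]; trivial
  rw [Submodule.mem_span_image_finset_iff_exists_fun'] at hwm
  obtain ⟨l, hl⟩ := hwm
  rw [Finset.sum_insert huT] at hl
  refine ⟨l, l u, fun y hy => ?_, by rw [← hl, add_comm]⟩
  obtain ⟨F, hF⟩ := (hface y hy).exposes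
  have h1 : F (p w) = l y * F (p y) := by
    rw [← hl, map_add, map_smul, hF.zero u (by simp), map_sum, Finset.sum_eq_single y]
    · simp
    · intro b hb hby
      rw [map_smul, hF.zero b (by simp [hb, hby]), smul_zero]
    · exact fun h0 => absurd hy h0
  have h2 : 0 < F (p y) := hF.pos y (hTX hy) (by simp; rintro rfl; exact huT hy)
  have h3 := hF.nonneg w hw
  rw [h1] at h3
  exact nonneg_of_mul_nonneg_left h3 h2

lemma CaseA.simplex (h : CaseA X p ν o ε d u) (T : Finset ι) (hT : T.card = d)
    (hTN : T ⊆ Nb X p {u}) (hTc : ∀ a ∈ T, ∀ b ∈ T, a ≠ b → Edg X p {u} a b) : Nb X p {u} = T := by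
  refine (Finset.Subset.antisymm hTN fun w hw => ?_).symm
  by_contra hwT
  have huT : u ∉ T := fun hu => (mem_Nb.1 (hTN hu)).1 (Finset.mem_singleton_self _)
  obtain ⟨l, m, hl, he⟩ := h.expand T hT hTN hTc (Nb_sub hw)
  obtain ⟨hwu, hwF⟩ := mem_Nb.1 hw
  obtain ⟨F, hF⟩ := hwF.exposes
  have h1 : ∑ y ∈ T, l y * F (p y) = 0 := by
    have := congrArg F he
    rw [hF.zero w (by simp), map_add, map_smul, hF.zero u (by simp), map_sum] at this
    simpa using this.symm
  have hpos : ∀ y ∈ T, 0 < F (p y) := fun y hy => hF.pos y (Nb_sub (hTN hy)) (by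
    simp only [Finset.mem_insert, Finset.mem_singleton, not_or]
    exact ⟨fun e => hwT (e ▸ hy), fun e => huT (e ▸ hy)⟩)
  have h2 := (Finset.sum_eq_zero_iff_of_nonneg (fun y hy => mul_nonneg (hl y hy) (hpos y hy).le)).1 h1
  have h3 : p w = m • p u := by
    rw [he, Finset.sum_eq_zero, zero_add]
    intro y hy
    rw [(mul_eq_zero.1 (h2 y hy)).resolve_right (hpos y hy).ne', zero_smul]
  obtain ⟨F', hF'⟩ := (h.cfg.vert w (Nb_sub hw)).exposes
  have h4 := hF'.zero w (by simp)
  have h5 := hF'.pos u h.hu (by simp at hwu ⊢; exact fun e => hwu e.symm)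
  have h6 := congrArg ε h3
  rw [h.ep, map_smul, h.ep, smul_eq_mul, mul_one] at h6
  rw [h3, ← h6, one_smul] at h4
  exact h5.ne' h4

lemma CaseA.not_complete (h : CaseA X p ν o ε d u) :
    ∃ v ∈ Nb X p {u}, ∃ w ∈ Nb X p {u}, w ≠ v ∧ ¬ Edg X p {u} v w := by
  by_contra hcon
  push Not at hcon
  obtain ⟨T, hTN, hT⟩ := Finset.exists_subset_card_eq h.card_Nb
  have hTc : ∀ a ∈ T, ∀ b ∈ T, a ≠ b → Edg X p {u} a b := fun a ha b hb hab =>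
    hcon a (hTN ha) b (hTN hb) hab.symm
  have huT : u ∉ T := fun hu => (mem_Nb.1 (hTN hu)).1 (Finset.mem_singleton_self _)
  have hTX : T ⊆ X := hTN.trans Nb_sub
  have hface : ∀ x ∈ T, Fc X p (insert u (T.erase x)) := fun x hx =>
    h.clique' _ (by rw [Finset.card_erase_of_mem hx]; have := h.d5; omega) ((Finset.erase_subset _ _).trans hTN)
      (fun a ha b hb hab => hTc a (Finset.mem_of_mem_erase ha) b (Finset.mem_of_mem_erase hb) hab)
  have hTF : Fc X p T := h.prime T hTX hT fun τ hτ => by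
    obtain ⟨z, hz, hzτ⟩ := Finset.exists_of_ssubset hτ
    exact h.cfg.mono (hface z hz) fun a ha => Finset.mem_insert_of_mem
      (Finset.mem_erase.2 ⟨fun e => hzτ (e ▸ ha), hτ.1 ha⟩)
  have hnuX := h.memX u h.hu
  have hnu : ∀ y ∈ insert u T, y ≠ ν u := by
    intro y hy e
    subst e
    rcases Finset.mem_insert.1 hy with e | hy
    · exact h.nu_ne h.hu e
    · exact h.anti (v := u) (mem_Nb.1 (hTN hy)).2 (by simp) (by simp)
  obtain ⟨l, m, hl, he⟩ := h.expand T hT hTN hTc hnuX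
  obtain ⟨η, hη⟩ := hTF.exposes
  have hm : 0 ≤ m := by
    have h1 := congrArg η he
    rw [map_add, map_sum, Finset.sum_eq_zero (fun y hy => by rw [map_smul, hη.zero y hy, smul_zero]), map_smul,
      zero_add, smul_eq_mul] at h1
    have h2 := hη.pos u h.hu huT
    have h3 := hη.nonneg (ν u) hnuX
    rw [h1] at h3
    exact nonneg_of_mul_nonneg_left h3 h2
  obtain ⟨F, hF⟩ := (h.cfg.vert _ hnuX).exposes
  have hpos : ∀ y ∈ insert u T, 0 < F (p y) := fun y hy => hF.pos y (by
    rcases Finset.mem_insert.1 hy with rfl | hy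
    · exact h.hu
    · exact hTX hy) (by simpa using hnu y hy)
  have h1 := congrArg F he
  rw [hF.zero _ (by simp), map_add, map_sum, map_smul, smul_eq_mul] at h1
  have hnn : ∀ y ∈ T, 0 ≤ F (l y • p y) := fun y hy => by
    rw [map_smul]; exact mul_nonneg (hl y hy) (hpos y (Finset.mem_insert_of_mem hy)).le
  have h2 := Finset.sum_nonneg hnn
  have h3 := mul_nonneg hm (hpos u (by simp)).le
  have h4 : ∑ y ∈ T, F (l y • p y) = 0 := by linarith
  have h5 : m = 0 := (mul_eq_zero.1 (by linarith : m * F (p u) = 0)).resolve_right (hpos u (by simp)).ne'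
  have h6 := (Finset.sum_eq_zero_iff_of_nonneg hnn).1 h4
  have h7 : p (ν u) = 0 := by
    rw [he, h5, zero_smul, add_zero]
    refine Finset.sum_eq_zero fun y hy => ?_
    have := h6 y hy
    rw [map_smul, smul_eq_mul] at this
    rw [(mul_eq_zero.1 this).resolve_right (hpos y (Finset.mem_insert_of_mem hy)).ne', zero_smul]
  have h8 := h.ep (ν u)
  rw [h7, map_zero] at h8
  exact zero_ne_one h8

end
end R18

namespace R18

section
variable {ι U : Type} [DecidableEq ι] [AddCommGroup U] [Module ℝ U] [FiniteDimensional ℝ U]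
variable {X : Finset ι} {p : ι → U}
variable {ν : ι → ι} {o : U} {ε : Module.Dual ℝ U}
variable {f : ι → ℝ} {d : ℕ}
variable {u : ι}

lemma Cfg.alt_unique (hC : Cfg X p) {G : Finset ι} (hG : Fc X p G) {B B' : U →ₗ[ℝ] Module.Dual ℝ U}
    (hB : ∀ x, B x x = 0) (hB' : ∀ x, B' x x = 0)
    (hag : ∀ x, Fc X p (insert x G) → B (p x) = B' (p x)) : B = B' := by
  obtain ⟨σ, hGσ, hσ, hc⟩ := hC.exists_facet hG
  refine bil_sub_zero (AltS_eq_zero (S := Submodule.span ℝ (p '' (σ : Set ι))) ?_ (mem_AltS.2 ⟨?_, ?_⟩))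
  · rw [finrank_span_indep (hC.Fc_indep hσ), hc]
  · intro x; simp [hB, hB']
  · intro s hs
    induction hs using Submodule.span_induction with
    | mem x hx =>
      obtain ⟨y, hy, rfl⟩ := hx
      have := hag y (hC.mono hσ (Finset.insert_subset hy hGσ))
      rw [LinearMap.sub_apply, this, sub_self]
    | zero => simp
    | add x y _ _ hx hy => rw [map_add, hx, hy, add_zero]
    | smul c x _ hx => rw [map_smul, hx, smul_zero]

lemma CaseA.glue (h : CaseA X p ν o ε d u) {R : ι → ι → Prop} (hR : ∀ a b, R a b → Edg X p {u} a b)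
    {w0 : ι} (hw0 : w0 ∈ Nb X p {u}) {M : ι → Module.Dual ℝ U}
    (hM : ∀ w, Relation.ReflTransGen R w0 w → Mot X p (insert w {u}) M) :
    ∃ B : U →ₗ[ℝ] Module.Dual ℝ U, (∀ x, B x x = 0) ∧ ∀ w, Relation.ReflTransGen R w0 w →
      ∀ x, Fc X p (insert x (insert w {u})) → M x = B (p x) := by
  have hd := h.d5
  have rig : ∀ w, Relation.ReflTransGen R w0 w → Fc X p (insert w {u}) → Triv X p (insert w {u}) M := by
    intro w hw hF
    refine h.cfg.rigid hF ?_ (hM w hw)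
    have := Finset.card_insert_le w ({u} : Finset ι)
    rw [Finset.card_singleton] at this
    rw [h.dim]; omega
  obtain ⟨B, hB, hBM⟩ := rig w0 .refl (mem_Nb.1 hw0).2
  refine ⟨B, hB, fun w hw => ?_⟩
  induction hw with
  | refl => exact hBM
  | @tail a b ha hab ih =>
    have he := hR _ _ hab
    obtain ⟨B', hB', hBM'⟩ := rig b (ha.tail hab) (mem_Nb.1 (he.memNb h.cfg)).2
    have : B = B' := by
      refine h.cfg.alt_unique he.2.2.2 hB hB' fun x hx => ?_
      rw [← ih x (h.cfg.mono hx ?_), ← hBM' x (h.cfg.mono hx ?_)]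
      all_goals
        intro z hz
        simp only [Finset.mem_insert, Finset.mem_singleton] at hz ⊢
        tauto
    rw [this]
    exact hBM'

theorem CaseA.false (h : CaseA X p ν o ε d u) : False := by
  have hd := h.d5
  obtain ⟨v, hvN, w0, hw0N, hw0v, hvw0⟩ := h.not_complete
  obtain ⟨R, hR⟩ : ∃ R : ι → ι → Prop, ∀ a b, R a b ↔ Edg X p {u} a b ∧ b ≠ v ∧ ¬ Edg X p {u} v b :=
    ⟨_, fun _ _ => Iff.rfl⟩
  obtain ⟨W, hW⟩ : ∃ W : ι → Prop, ∀ a, W a ↔ Relation.ReflTransGen R w0 a := ⟨_, fun _ => Iff.rfl⟩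
  have hRe : ∀ a b, R a b → Edg X p {u} a b := fun a b hab => ((hR a b).1 hab).1
  have hW0 : W w0 := (hW _).2 .refl
  have hWp : ∀ x, W x → x ∈ Nb X p {u} ∧ x ≠ v ∧ ¬ Edg X p {u} v x := by
    intro x hx
    rcases Relation.ReflTransGen.cases_tail ((hW x).1 hx) with rfl | ⟨c, -, hcx⟩
    · exact ⟨hw0N, hw0v, hvw0⟩
    · have := (hR _ _).1 hcx
      exact ⟨this.1.memNb h.cfg, this.2⟩
  obtain ⟨S, hS⟩ : ∃ S : Finset ι, ∀ s, s ∈ S ↔ s ∈ Nb X p {u} ∧ ¬ W s ∧ ∃ w, W w ∧ Edg X p {u} w s :=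
    ⟨(Nb X p {u}).filter fun s => ¬ W s ∧ ∃ w, W w ∧ Edg X p {u} w s, fun s => by rw [Finset.mem_filter]⟩
  have hSv : ∀ s ∈ S, Edg X p {u} v s := by
    intro s hs
    obtain ⟨h1, h2, w, hw, hws⟩ := (hS s).1 hs
    by_contra hcon
    refine h2 ((hW s).2 (((hW w).1 hw).tail ((hR _ _).2 ⟨hws, ?_, hcon⟩)))
    rintro rfl
    exact (hWp w hw).2.2 hws.symm
  have hSN : S ⊆ Nb X p {u} := fun s hs => ((hS s).1 hs).1
  have huS : u ∉ S := fun hu => (mem_Nb.1 (hSN hu)).1 (Finset.mem_singleton_self _)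
  have hvS : v ∉ S := fun hv => (hSv v hv).2.2.1 rfl
  have hvu : v ≠ u := fun e => (mem_Nb.1 hvN).1 (by simp [e])
  have hNu : ∀ {x}, x ∈ Nb X p {u} → x ≠ u := fun hx e => (mem_Nb.1 hx).1 (by simp [e])
  -- structure of the star of `uw`
  have cases : ∀ w, W w → ∀ x, Fc X p (insert x (insert w {u})) → x = u ∨ W x ∨ x ∈ S := by
    intro w hw x hx
    by_cases h1 : x = u
    · exact Or.inl h1
    by_cases h2 : W x
    · exact Or.inr (Or.inl h2)
    have hne : w ≠ x := fun e => h2 (e ▸ hw)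
    have he : Edg X p {u} w x := ⟨by simpa using hNu (hWp w hw).1, by simpa using h1, hne, Fc_swap hx⟩
    exact Or.inr (Or.inr ((hS x).2 ⟨he.memNb h.cfg, h2, w, hw, he⟩))
  have vno : ∀ w, W w → ¬ Fc X p (insert v (insert w {u})) := by
    intro w hw hF
    rcases cases w hw v hF with h1 | h1 | h1
    · exact hvu h1
    · exact (hWp v h1).2.1 rfl
    · exact hvS h1
  obtain ⟨Y, hY⟩ : ∃ Y : Finset ι, Y = insert u S := ⟨_, rfl⟩
  have hYst : ∀ y ∈ Y, ∃ w, W w ∧ Fc X p (insert y (insert w {u})) := by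
    intro y hy
    rw [hY] at hy
    rcases Finset.mem_insert.1 hy with rfl | hy
    · refine ⟨w0, hW0, ?_⟩
      rw [Finset.insert_eq_of_mem (by simp)]
      exact (mem_Nb.1 hw0N).2
    · obtain ⟨h1, h2, w, hw, hws⟩ := (hS y).1 hy
      exact ⟨w, hw, Fc_swap hws.2.2.2⟩
  have hYv : ∀ y ∈ Y, v ≠ y ∧ Fc X p (insert v (insert y {u})) := by
    intro y hy
    rw [hY] at hy
    rcases Finset.mem_insert.1 hy with rfl | hy
    · refine ⟨hvu, ?_⟩
      rw [Finset.insert_eq_of_mem (a := y) (by simp)]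
      exact (mem_Nb.1 hvN).2
    · exact (hSv y hy).2.2
  have subm : ∀ {x y w : ι}, Fc X p (insert x (insert y (insert w {u}))) → Fc X p (insert x (insert w {u})) ∧
      Fc X p (insert y (insert w {u})) ∧ Fc X p (insert x (insert y {u})) := by
    intro x y w hF
    refine ⟨h.cfg.mono hF ?_, h.cfg.mono hF ?_, h.cfg.mono hF ?_⟩
    all_goals
      intro z hz
      simp only [Finset.mem_insert, Finset.mem_singleton] at hz ⊢
      tauto
  -- (a) independence
  have hind : LinearIndepOn ℝ p (Y : Set ι) := by
    rw [linearIndepOn_finset_iff]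
    intro l hl
    obtain ⟨M, m1, m2⟩ := h.real (fun x y => if x = v then l y else if y = v then l x else 0) (by
      intro x y
      split_ifs <;> simp_all)
    obtain ⟨B, hB, hBM⟩ := h.glue (M := M) hRe hw0N (by
      intro w hw x y hF
      have hw' := (hW w).2 hw
      by_cases hxy : x = y
      · subst hxy; rw [m1]; simp
      · obtain ⟨s1, s2, s3⟩ := subm hF
        have := m2 x y hxy s3
        rw [if_neg (by rintro rfl; exact vno w hw' s1), if_neg (by rintro rfl; exact vno w hw' s2)] at this
        exact this)
    have e1 : ∀ y ∈ Y, M v (p y) + B (p y) (p v) = l y := by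
      intro y hy
      obtain ⟨w, hw, hF⟩ := hYst y hy
      have := m2 v y (hYv y hy).1 (hYv y hy).2
      rw [if_pos rfl, phi, hBM w ((hW w).1 hw) y hF] at this
      exact this
    have e2 : ∑ y ∈ Y, l y * l y = 0 := by
      calc ∑ y ∈ Y, l y * l y = ∑ y ∈ Y, l y * (M v (p y) + B (p y) (p v)) :=
            Finset.sum_congr rfl fun y hy => by rw [e1 y hy]
        _ = M v (∑ y ∈ Y, l y • p y) + B (∑ y ∈ Y, l y • p y) (p v) := by
            simp only [map_sum, map_smul, LinearMap.sum_apply, LinearMap.smul_apply, smul_eq_mul, mul_add,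
              Finset.sum_add_distrib]
        _ = 0 := by rw [hl]; simp
    intro i hi
    have := (Finset.sum_eq_zero_iff_of_nonneg (fun y _ => mul_self_nonneg (l y))).1 e2 i hi
    exact mul_self_eq_zero.1 this
  -- (b) `S` is a clique
  have hcl : ∀ a ∈ S, ∀ b ∈ S, a ≠ b → Edg X p {u} a b := by
    intro a ha b hb hab
    by_contra hcon
    obtain ⟨ψ, hψ⟩ := exists_dual hind (fun y => if y = b then 1 else 0)
    have haY : a ∈ Y := by rw [hY]; exact Finset.mem_insert_of_mem ha
    have hbY : b ∈ Y := by rw [hY]; exact Finset.mem_insert_of_mem hb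
    obtain ⟨M0, hM0⟩ : ∃ M0 : ι → Module.Dual ℝ U, ∀ x, M0 x = if x = a then ψ else 0 := ⟨_, fun _ => rfl⟩
    have hM0a : M0 a = ψ := by rw [hM0, if_pos rfl]
    have hM0n : ∀ x, x ≠ a → M0 x = 0 := fun x hx => by rw [hM0, if_neg hx]
    obtain ⟨Tt, hTt⟩ : ∃ Tt : ι → ι → Prop, ∀ x y, Tt x y ↔ Fc X p (insert x (insert y (insert v {u}))) :=
      ⟨_, fun _ _ => Iff.rfl⟩
    obtain ⟨M, m1, m2⟩ := h.real (fun x y => if Tt x y then phi p M0 x y else 0) (by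
      intro x y
      have : Tt x y ↔ Tt y x := by rw [hTt, hTt]; exact ⟨Fc_swap, Fc_swap⟩
      simp only [this, phi_comm (p := p) (M := M0) x y])
    have inY : ∀ w, W w → ∀ x, Fc X p (insert x (insert w {u})) → Fc X p (insert x (insert v {u})) → x ∈ Y := by
      intro w hw x h1 h2
      rw [hY]
      rcases cases w hw x h1 with h3 | h3 | h3
      · exact Finset.mem_insert.2 (Or.inl h3)
      · obtain ⟨q1, q2, q3⟩ := hWp x h3
        exact absurd ⟨by simpa using hvu, by simpa using hNu q1, q2.symm, Fc_swap h2⟩ q3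
      · exact Finset.mem_insert_of_mem h3
    have z0 : ∀ x y, x ≠ y → x ∈ Y → y ∈ Y → Fc X p (insert x (insert y {u})) → M0 x (p y) = 0 := by
      intro x y hxy hx hy hF
      by_cases hxa : x = a
      · subst hxa
        rw [hM0a, hψ y hy, if_neg]
        rintro rfl
        exact hcon ⟨by simpa using hNu (hSN ha), by simpa using hNu (hSN hb), hxy, hF⟩
      · rw [hM0n x hxa]; simp
    obtain ⟨B, hB, hBM⟩ := h.glue (M := M) hRe hw0N (by
      intro w hw x y hF
      have hw' := (hW w).2 hw
      by_cases hxy : x = y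
      · subst hxy; rw [m1]; simp
      · obtain ⟨s1, s2, s3⟩ := subm hF
        have := m2 x y hxy s3
        by_cases hT : Tt x y
        · rw [if_pos hT] at this
          obtain ⟨t1, t2, t3⟩ := subm ((hTt x y).1 hT)
          have hx := inY w hw' x s1 t1
          have hy := inY w hw' y s2 t2
          rw [phi, phi, z0 x y hxy hx hy s3, z0 y x (Ne.symm hxy) hy hx (Fc_swap s3), add_zero] at this
          exact this
        · rw [if_neg hT] at this
          exact this)
    have q1 : phi p M a b = 0 := by
      obtain ⟨w, hw, hF⟩ := hYst a haY
      obtain ⟨w', hw', hF'⟩ := hYst b hbY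
      rw [phi, hBM w ((hW w).1 hw) a hF, hBM w' ((hW w').1 hw') b hF', alt_symm hB, neg_add_cancel]
    have hmot : Mot X p (insert v {u}) (fun x => M x - M0 x) := by
      intro x y hF
      dsimp only
      by_cases hxy : x = y
      · subst hxy
        have : M0 x (p x) = 0 := by
          by_cases hxa : x = a
          · subst hxa; rw [hM0a, hψ x haY, if_neg hab]
          · rw [hM0n x hxa]; simp
        rw [LinearMap.sub_apply, m1, this]; simp
      · have := m2 x y hxy (subm hF).2.2
        rw [if_pos ((hTt x y).2 hF), phi, phi] at this
        rw [LinearMap.sub_apply, LinearMap.sub_apply]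
        linarith
    obtain ⟨B', hB', hBM'⟩ := h.cfg.rigid (mem_Nb.1 hvN).2 (by
      have := Finset.card_insert_le v ({u} : Finset ι)
      rw [Finset.card_singleton] at this
      rw [h.dim]; omega) hmot
    have r1 := LinearMap.congr_fun (hBM' a (Fc_swap (hYv a haY).2)) (p b)
    have r2 := LinearMap.congr_fun (hBM' b (Fc_swap (hYv b hbY).2)) (p a)
    dsimp only at r1 r2
    rw [LinearMap.sub_apply] at r1 r2
    rw [hM0a, hψ b hbY, if_pos rfl] at r1
    rw [hM0n b hab.symm, LinearMap.zero_apply] at r2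
    have r3 := alt_symm hB' (p a) (p b)
    rw [phi] at q1
    linarith
  by_cases hSd : d ≤ S.card
  · obtain ⟨T, hTS, hT⟩ := Finset.exists_subset_card_eq hSd
    have := h.simplex T hT (hTS.trans hSN) (fun a ha b hb hab => hcl a (hTS ha) b (hTS hb) hab)
    rw [this] at hvN
    exact hvS (hTS hvN)
  · have hF := h.clique' S (by omega) hSN hcl
    have hWv : W v := by
      refine h.cfg.conn (G := {u}) (S := S) (by rw [← Finset.insert_eq]; exact hF) (by rw [h.dim]; simp; omega) W
        ?_ (a := w0) ?_ (mem_Nb.1 hw0N).2 hW0 ?_ (mem_Nb.1 hvN).2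
      · intro a b ha hb hab hFab hWa
        rw [← Finset.insert_eq, Finset.mem_insert, not_or] at ha hb
        by_contra hWb
        have he : Edg X p {u} a b := ⟨by simpa using ha.1, by simpa using hb.1, hab, hFab⟩
        exact hb.2 ((hS b).2 ⟨he.memNb h.cfg, hWb, a, hWa, he⟩)
      · rw [← Finset.insert_eq, Finset.mem_insert, not_or]
        exact ⟨hNu hw0N, fun h1 => ((hS w0).1 h1).2.1 hW0⟩
      · rw [← Finset.insert_eq, Finset.mem_insert, not_or]
        exact ⟨hvu, hvS⟩
    exact (hWp v hWv).2.1 rfl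

end
end R18

namespace R18

section
variable {ι U : Type} [DecidableEq ι] [AddCommGroup U] [Module ℝ U] [FiniteDimensional ℝ U]
variable {X : Finset ι} {p : ι → U}
variable {ν : ι → ι} {o : U} {ε : Module.Dual ℝ U}
variable {f : ι → ℝ} {d : ℕ}
variable {u : ι}

/-- Off each other up to sign. -/
def Nap (ν : ι → ι) (a b : ι) : Prop := b ≠ a ∧ b ≠ ν a

lemma CS.nap_symm (h : CS X p ν o ε) {a b : ι} (hab : Nap ν a b) : Nap ν b a :=
  ⟨hab.1.symm, fun e => hab.2 (by rw [e, h.inv])⟩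

lemma CS.nap_nu (h : CS X p ν o ε) {a b : ι} (hab : Nap ν a b) : Nap ν a (ν b) :=
  ⟨fun e => hab.2 (by rw [← e, h.inv]), fun e => hab.1 (h.nu_inj e)⟩

lemma CS.nap_nu' (h : CS X p ν o ε) {a b : ι} (hab : Nap ν a b) : Nap ν (ν a) b :=
  h.nap_symm (h.nap_nu (h.nap_symm hab))

lemma CS.bound (h : CS X p ν o ε) {G : Finset ι}
    (hE : ∀ a ∈ Cc X p ν G, ∀ b ∈ Cc X p ν G, a ≠ b → b ≠ ν a → Edg X p G a b)
    {x y z : ι} (hx : x ∈ Cc X p ν G) (hy : y ∈ Cc X p ν G) (hz : z ∈ Cc X p ν G)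
    (hxy : Nap ν x y) (hxz : Nap ν x z) (hyz : Nap ν y z) {l : ι → ℝ} {a b c e : ℝ}
    (hdep : ∑ g ∈ G, l g • p g + a • p x + b • p y + c • p z + e • o = 0) :
    |a + b| < |c| ∨ (c = 0 ∧ a + b = 0) := by
  have key : ∀ {x y}, x ∈ Cc X p ν G → y ∈ Cc X p ν G → Nap ν x y → Nap ν x z → Nap ν y z →
      ∃ F : Module.Dual ℝ U, 0 < F o ∧ (∀ g ∈ G, F (p g) = 0) ∧ F (p x) = 0 ∧ F (p y) = 0 ∧ 0 < F (p z) ∧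
        F (p z) < 2 * F o := by
    intro x y hx hy hxy hxz hyz
    obtain ⟨F, hF⟩ := (hE x hx y hy hxy.1.symm hxy.2).2.2.2.exposes
    have h1 : 0 < F (p z) := hF.pos z (Cc_subX hz) (by
      simp only [Finset.mem_insert, not_or]; exact ⟨hxz.1, hyz.1, h.Cc_notMem hz⟩)
    have h2 : 0 < F (p (ν z)) := hF.pos _ (h.memX _ (Cc_subX hz)) (by
      simp only [Finset.mem_insert, not_or]
      exact ⟨(h.nap_nu hxz).1, (h.nap_nu hyz).1, h.Cc_notMem (h.Cc_nu hz)⟩)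
    rw [h.pn, map_sub, map_smul, smul_eq_mul] at h2
    exact ⟨F, by linarith, fun g hg => hF.zero g (by simp [hg]), hF.zero x (by simp), hF.zero y (by simp), h1,
      by linarith⟩
  obtain ⟨F, f1, f2, f3, f4, f5, f6⟩ := key hx hy hxy hxz hyz
  obtain ⟨F', g1, g2, g3, g4, g5, g6⟩ := key (h.Cc_nu hx) (h.Cc_nu hy) (h.nap_nu (h.nap_nu' hxy))
    (h.nap_nu' hxz) (h.nap_nu' hyz)
  have e1 := congrArg F hdep
  have e2 := congrArg F' hdep
  rw [h.pn, map_sub, map_smul, smul_eq_mul] at g3 g4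
  simp only [map_add, map_sum, map_smul, smul_eq_mul, map_zero] at e1 e2
  rw [Finset.sum_eq_zero (fun g hg => by rw [f2 g hg, mul_zero]), f3, f4] at e1
  rw [Finset.sum_eq_zero (fun g hg => by rw [g2 g hg, mul_zero]),
    (by linarith : F' (p x) = 2 * F' o), (by linarith : F' (p y) = 2 * F' o)] at e2
  obtain ⟨r, hr⟩ : ∃ r, F (p z) = r * F o := ⟨F (p z) / F o, by field_simp⟩
  obtain ⟨s, hs⟩ : ∃ s, F' (p z) = s * F' o := ⟨F' (p z) / F' o, by field_simp⟩
  rw [hr] at f5 f6 e1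
  rw [hs] at g5 g6 e2
  have r0 : 0 < r := pos_of_mul_pos_left f5 f1.le
  have s0 : 0 < s := pos_of_mul_pos_left g5 g1.le
  have r2 : r < 2 := lt_of_mul_lt_mul_right f6 f1.le
  have s2 : s < 2 := lt_of_mul_lt_mul_right g6 g1.le
  have d1 : c * r + e = 0 := by
    have : (c * r + e) * F o = 0 := by linarith
    exact (mul_eq_zero.1 this).resolve_right f1.ne'
  have d2 : 2 * (a + b) + c * s + e = 0 := by
    have : (2 * (a + b) + c * s + e) * F' o = 0 := by linarith
    exact (mul_eq_zero.1 this).resolve_right g1.ne'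
  have d3 : a + b = c * ((r - s) / 2) := by linarith
  by_cases hc : c = 0
  · right; exact ⟨hc, by rw [d3, hc, zero_mul]⟩
  · left
    rw [d3, abs_mul]
    have : |(r - s) / 2| < 1 := by rw [abs_lt]; constructor <;> linarith
    exact mul_lt_of_lt_one_right (abs_pos.2 hc) this

lemma CS.bound2 (h : CS X p ν o ε) {G : Finset ι}
    (hE : ∀ a ∈ Cc X p ν G, ∀ b ∈ Cc X p ν G, a ≠ b → b ≠ ν a → Edg X p G a b)
    {x y z : ι} (hx : x ∈ Cc X p ν G) (hy : y ∈ Cc X p ν G) (hz : z ∈ Cc X p ν G)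
    (hxy : Nap ν x y) (hxz : Nap ν x z) (hyz : Nap ν y z) {l : ι → ℝ} {a b c e : ℝ}
    (hdep : ∑ g ∈ G, l g • p g + a • p x + b • p y + c • p z + e • o = 0) :
    |a| + |b| < |c| ∨ (c = 0 ∧ a = 0 ∧ b = 0) := by
  have h1 := h.bound hE hx hy hz hxy hxz hyz hdep
  have h2 := h.bound hE hx (h.Cc_nu hy) hz (h.nap_nu hxy) hxz (h.nap_nu' hyz) (l := l) (a := a) (b := -b) (c := c)
    (e := e + 2 * b) (by
      rw [h.pn, ← hdep]
      module)
  rcases h1 with h1 | h1 <;> rcases h2 with h2 | h2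
  · left
    rw [abs_lt] at h1 h2
    rcases abs_cases a with ha | ha <;> rcases abs_cases b with hb | hb <;> linarith
  · rw [h2.1, abs_zero] at h1
    exact absurd h1 (not_lt.2 (abs_nonneg _))
  · rw [h1.1, abs_zero] at h2
    exact absurd h2 (not_lt.2 (abs_nonneg _))
  · right
    exact ⟨h1.1, by linarith, by linarith⟩

lemma CS.oct_indep (h : CS X p ν o ε) {G : Finset ι} (hG : Fc X p G)
    (hE : ∀ a ∈ Cc X p ν G, ∀ b ∈ Cc X p ν G, a ≠ b → b ≠ ν a → Edg X p G a b)
    {x y z : ι} (hx : x ∈ Cc X p ν G) (hy : y ∈ Cc X p ν G) (hz : z ∈ Cc X p ν G)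
    (hxy : Nap ν x y) (hxz : Nap ν x z) (hyz : Nap ν y z) :
    LinearIndepOn ℝ p ((insert x (insert y (insert z (insert (ν x) G))) : Finset ι) : Set ι) := by
  rw [linearIndepOn_finset_iff]
  intro l hl
  have hxG := h.Cc_notMem hx
  have hyG := h.Cc_notMem hy
  have hzG := h.Cc_notMem hz
  have hnG := h.Cc_notMem (h.Cc_nu hx)
  rw [Finset.sum_insert (by
      simp only [Finset.mem_insert, not_or]
      exact ⟨hxy.1.symm, hxz.1.symm, (h.nu_ne (Cc_subX hx)).symm, hxG⟩),
    Finset.sum_insert (by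
      simp only [Finset.mem_insert, not_or]
      exact ⟨hyz.1.symm, hxy.2, hyG⟩),
    Finset.sum_insert (by
      simp only [Finset.mem_insert, not_or]
      exact ⟨hxz.2, hzG⟩), Finset.sum_insert hnG, h.pn] at hl
  have b1 := h.bound2 hE hx hy hz hxy hxz hyz (l := l) (a := l x - l (ν x)) (b := l y) (c := l z)
    (e := 2 * l (ν x)) (by rw [← hl]; module)
  have b2 := h.bound2 hE hy hz hx hyz (h.nap_symm hxy) (h.nap_symm hxz) (l := l) (c := l x - l (ν x)) (a := l y) (b := l z)
    (e := 2 * l (ν x)) (by rw [← hl]; module)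
  have b3 : l z = 0 ∧ l x - l (ν x) = 0 ∧ l y = 0 := by
    rcases b1 with b1 | b1
    · rcases b2 with b2 | b2
      · have := abs_nonneg (l y); linarith
      · exact ⟨b2.2.2, b2.1, b2.2.1⟩
    · exact b1
  obtain ⟨F, hF⟩ := hG.exposes
  have hl2 : ∑ g ∈ G, l g • p g + (2 * l (ν x)) • o = 0 := by
    rw [← hl, b3.1, b3.2.2, (by linarith [b3.2.1] : l x = l (ν x))]; module
  have hFo : 0 < F o := h.Fo_pos hF.ne hF.nonneg
  have hnx : l (ν x) = 0 := by
    have := congrArg F hl2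
    simp only [map_add, map_sum, map_smul, smul_eq_mul, map_zero] at this
    rw [Finset.sum_eq_zero (fun g hg => by rw [hF.zero g hg, mul_zero]), zero_add] at this
    have := (mul_eq_zero.1 this).resolve_right hFo.ne'
    linarith
  have hGi := h.cfg.Fc_indep hG
  rw [linearIndepOn_finset_iff] at hGi
  have hl3 := hGi l (by rw [← hl2, hnx]; simp)
  intro i hi
  simp only [Finset.mem_insert] at hi
  rcases hi with rfl | rfl | rfl | rfl | hi
  · linarith [b3.2.1]
  · exact b3.2.2
  · exact b3.1
  · exact hnx
  · exact hl3 i hi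

/-- one step of the chain -/
lemma Full.step (h : Full X p ν o ε d) {G : Finset ι} (hG : Fc X p G) (hc : G.card + 4 ≤ d)
    (hne : (Cc X p ν G).Nonempty) (hk : (Cc X p ν G).card < 2 * d) :
    ∃ c ∈ Cc X p ν G, (Cc X p ν (insert c G)).Nonempty := by
  by_contra hcon
  push Not at hcon
  obtain ⟨k, hk2⟩ := h.Cc_even G
  have e1 := h.eps_le hG (by omega) hk2 (by omega)
  have hpos := hne.card_pos
  have hk1 : 1 ≤ k := by omega
  have hA := h.card_Ap (C := Cc X p ν G) Cc_subX (fun c hc => h.Cc_nu hc)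
  have himg : ((Oc X p ν G).image fun e => (e.1, ν e.2)) ⊆ Ap ν (Cc X p ν G) := by
    intro e he
    rw [Finset.mem_image] at he
    obtain ⟨⟨a, b⟩, hab, rfl⟩ := he
    have := h.Oc_sub hab
    rw [Ap, Finset.mem_filter, Finset.mem_product] at this ⊢
    have hn := h.nap_nu (a := a) (b := b) this.2
    exact ⟨⟨this.1.1, h.Cc_nu this.1.2⟩, hn⟩
  have hdis : Disjoint (Oc X p ν G) ((Oc X p ν G).image fun e => (e.1, ν e.2)) := by
    rw [Finset.disjoint_left]
    intro e he he'
    rw [Finset.mem_image] at he'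
    obtain ⟨⟨a, b⟩, hab, rfl⟩ := he'
    have q1 := (h.mem_Oc.1 hab).1
    have q2 := (h.mem_Oc.1 he).1
    have haC : a ∈ Cc X p ν G := (Finset.mem_product.1 (Finset.mem_filter.1 hab).1).1
    have hb : b ∈ Cc X p ν (insert a G) := mem_Cc.2 ⟨Fc_swap q1.2.2.2, Fc_swap q2.2.2.2⟩
    rw [hcon a haC] at hb
    simp at hb
  have hcard := Finset.card_le_card (Finset.union_subset h.Oc_sub himg)
  rw [Finset.card_union_of_disjoint hdis, Finset.card_image_of_injective, hA, hk2] at hcard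
  · obtain ⟨j, rfl⟩ := Nat.exists_eq_add_of_le hk1
    have : 2 * (1 + j) - 2 = 2 * j := by omega
    rw [this] at hcard
    nlinarith
  · rintro ⟨a, b⟩ ⟨a', b'⟩ hab
    simp only [Prod.mk.injEq] at hab ⊢
    exact ⟨hab.1, h.nu_inj hab.2⟩

lemma Full.chain (h : Full X p ν o ε d) : ∀ (n : ℕ) (G : Finset ι), n + G.card + 3 = d → Fc X p G → (Cc X p ν G).Nonempty →
    ∃ G', G ⊆ G' ∧ Fc X p G' ∧ (2 * d ≤ (Cc X p ν G').card ∨ (G'.card + 3 = d ∧ (Cc X p ν G').Nonempty)) := by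
  intro n
  induction n with
  | zero => intro G hc hG hne; exact ⟨G, subset_rfl, hG, Or.inr ⟨by omega, hne⟩⟩
  | succ n ih =>
    intro G hc hG hne
    by_cases hk : (Cc X p ν G).card < 2 * d
    · obtain ⟨c, hcC, hcne⟩ := h.step hG (by omega) hne hk
      obtain ⟨G', h1, h2⟩ := ih (insert c G) (by
        rw [Finset.card_insert_of_notMem (h.Cc_notMem hcC)]; omega) (mem_Cc.1 hcC).1 hcne
      exact ⟨G', (Finset.subset_insert _ _).trans h1, h2⟩
    · exact ⟨G, subset_rfl, hG, Or.inl (by omega)⟩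

lemma Full.swap (h : Full X p ν o ε d) {G : Finset ι} (hG : Fc X p G) (hc : G.card + 3 = d)
    (hu : u ∈ G) {x y z : ι} (hE : ∀ a ∈ Cc X p ν G, ∀ b ∈ Cc X p ν G, a ≠ b → b ≠ ν a → Edg X p G a b)
    (hx : x ∈ Cc X p ν G) (hy : y ∈ Cc X p ν G) (hz : z ∈ Cc X p ν G)
    (hxy : Nap ν x y) (hxz : Nap ν x z) (hyz : Nap ν y z) {w : ι} (hw : w ∈ G) (hwu : w ≠ u) :
    w ∈ Cc X p ν {u} := by
  obtain ⟨G', hG'⟩ : ∃ G', G' = insert x (G.erase w) := ⟨_, rfl⟩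
  have hxG := h.Cc_notMem hx
  have hxe : x ∉ G.erase w := fun h0 => hxG (Finset.mem_of_mem_erase h0)
  have hc' : G'.card + 3 = d := by
    have := Finset.card_pos.2 ⟨w, hw⟩
    rw [hG', Finset.card_insert_of_notMem hxe, Finset.card_erase_of_mem hw]; omega
  have huG' : u ∈ G' := by rw [hG']; exact Finset.mem_insert_of_mem (Finset.mem_erase.2 ⟨hwu.symm, hu⟩)
  have hww : ∀ t, insert w (insert t G') = insert t (insert x G) := by
    intro t
    rw [hG', Finset.insert_comm, Finset.insert_comm w x, Finset.insert_erase hw]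
  have hwx : w ≠ x := fun e => hxG (e ▸ hw)
  have hwG' : w ∉ G' := by rw [hG']; simp [hwx]
  have hst : ∀ t ∈ Cc X p ν G, Nap ν x t → Edg X p G' w t := by
    intro t ht hxt
    have htG := h.Cc_notMem ht
    refine ⟨hwG', ?_, fun e => htG (e ▸ hw), ?_⟩
    · rw [hG']
      simp only [Finset.mem_insert, not_or]
      exact ⟨hxt.1, fun h0 => htG (Finset.mem_of_mem_erase h0)⟩
    · rw [hww]
      exact Fc_swap (hE x hx t ht hxt.1.symm hxt.2).2.2.2
  have hCt : ∀ t ∈ Cc X p ν G, Nap ν x t → t ∈ Cc X p ν G' := fun t ht hxt =>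
    mem_Cc.2 ⟨(mem_Nb.1 ((hst t ht hxt).memNb h.cfg)).2,
      (mem_Nb.1 ((hst _ (h.Cc_nu ht) (h.nap_nu hxt)).memNb h.cfg)).2⟩
  have hyC := hCt y hy hxy
  have hzC := hCt z hz hxz
  have hG'F : Fc X p G' := h.cfg.mono (mem_Cc.1 hyC).1 (Finset.subset_insert _ _)
  obtain ⟨o1, o2⟩ := h.oct hG'F hc' ⟨y, hyC⟩
  have hwNb : w ∈ Nb X p G' := (hst y hy hxy).symm.memNb h.cfg
  by_cases hwC : w ∈ Cc X p ν G'
  · exact h.Cc_mono (Finset.singleton_subset_iff.2 huG') hwC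
  exfalso
  have hyzF := (o2 y hyC z hzC hyz.1.symm hyz.2).2.2.2
  have hind := h.indep_nu hyzF (a := y) (by simp)
  have hcl : (insert (ν y) (insert y (insert z G'))).card = d := by
    rw [Finset.card_insert_of_notMem, Finset.card_insert_of_notMem, Finset.card_insert_of_notMem (h.Cc_notMem hzC)]
    · omega
    · simp only [Finset.mem_insert, not_or]; exact ⟨hyz.1.symm, h.Cc_notMem hyC⟩
    · simp only [Finset.mem_insert, not_or]
      exact ⟨h.nu_ne (Cc_subX hy), fun e => hyz.2 e.symm, h.Cc_notMem (h.Cc_nu hyC)⟩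
  have hI := h.cfg.ind hG'F (by rw [h.dim]; omega) (Y := insert w (Cc X p ν G'))
    (Finset.insert_subset hwNb h.Cc_sub) (by
      have := span_ge hind (t := G' ∪ insert w (Cc X p ν G')) (by
        intro t ht
        simp only [Finset.mem_insert, Finset.mem_union] at ht ⊢
        rcases ht with rfl | rfl | rfl | ht
        · exact Or.inr (Or.inr (h.Cc_nu hyC))
        · exact Or.inr (Or.inr hyC)
        · exact Or.inr (Or.inr hzC)
        · exact Or.inl ht)
      rw [h.dim]; omega)
  obtain ⟨Q, hQ⟩ : ∃ Q : Finset ι, Q = {y, ν y, z, ν z} := ⟨_, rfl⟩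
  have hQc : Q.card = 4 := by
    have n1 := h.nu_ne (Cc_subX hy)
    have n2 := h.nu_ne (Cc_subX hz)
    have n3 := (h.nap_nu hyz)
    rw [hQ, Finset.card_insert_of_notMem, Finset.card_insert_of_notMem, Finset.card_insert_of_notMem,
      Finset.card_singleton]
    · simpa using n2.symm
    · simp only [Finset.mem_insert, Finset.mem_singleton, not_or]; exact ⟨hyz.2.symm, n3.2.symm⟩
    · simp only [Finset.mem_insert, Finset.mem_singleton, not_or]; exact ⟨n1.symm, hyz.1.symm, n3.1.symm⟩
  have hQE : ∀ t ∈ Q, t ∈ Cc X p ν G' ∧ Edg X p G' w t := by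
    intro t ht
    rw [hQ] at ht
    simp only [Finset.mem_insert, Finset.mem_singleton] at ht
    rcases ht with rfl | rfl | rfl | rfl
    · exact ⟨hyC, hst _ hy hxy⟩
    · exact ⟨h.Cc_nu hyC, hst _ (h.Cc_nu hy) (h.nap_nu hxy)⟩
    · exact ⟨hzC, hst _ hz hxz⟩
    · exact ⟨h.Cc_nu hzC, hst _ (h.Cc_nu hz) (h.nap_nu hxz)⟩
  have hsub : (Ap ν (Cc X p ν G') ∪ ({w} ×ˢ Q ∪ Q ×ˢ {w})) ⊆
      ((insert w (Cc X p ν G') ×ˢ insert w (Cc X p ν G')).filter fun e => Edg X p G' e.1 e.2) := by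
    rintro ⟨a, b⟩ he
    rw [Finset.mem_filter, Finset.mem_product]
    simp only [Finset.mem_union, Finset.mem_product, Finset.mem_singleton] at he
    rcases he with he | ⟨rfl, hb⟩ | ⟨ha, rfl⟩
    · rw [Ap, Finset.mem_filter, Finset.mem_product] at he
      exact ⟨⟨Finset.mem_insert_of_mem he.1.1, Finset.mem_insert_of_mem he.1.2⟩,
        o2 a he.1.1 b he.1.2 he.2.1.symm he.2.2⟩
    · exact ⟨⟨Finset.mem_insert_self _ _, Finset.mem_insert_of_mem (hQE b hb).1⟩, (hQE b hb).2⟩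
    · exact ⟨⟨Finset.mem_insert_of_mem (hQE a ha).1, Finset.mem_insert_self _ _⟩, (hQE a ha).2.symm⟩
  have hcard := Finset.card_le_card hsub
  have hwQ : w ∉ Q := fun h0 => hwC (hQE w h0).1
  rw [Finset.card_union_of_disjoint, Finset.card_union_of_disjoint, Finset.card_product, Finset.card_product,
    h.card_Ap Cc_subX (fun c hc => h.Cc_nu hc), hQc, o1, Finset.card_singleton] at hcard
  · rw [Finset.card_insert_of_notMem hwC, o1] at hI
    omega
  · rw [Finset.disjoint_left]
    rintro ⟨a, b⟩ h1 h2
    simp only [Finset.mem_product, Finset.mem_singleton] at h1 h2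
    exact hwQ (h1.1 ▸ h2.1)
  · rw [Finset.disjoint_left]
    rintro ⟨a, b⟩ h1 h2
    rw [Ap, Finset.mem_filter, Finset.mem_product] at h1
    simp only [Finset.mem_union, Finset.mem_product, Finset.mem_singleton] at h2
    rcases h2 with h2 | h2
    · exact hwC (h2.1 ▸ h1.1.1)
    · exact hwC (h2.2 ▸ h1.1.2)

theorem Full.caseB (h : Full X p ν o ε d) (hu : u ∈ X)
    (hgen : ∀ s : Finset ι, s ⊆ X → s.card = d → (∀ a ∈ s, ∀ b ∈ s, b ≠ ν a) → LinearIndepOn ℝ p (s : Set ι))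
    (hne : (Cc X p ν {u}).Nonempty) :
    Module.finrank ℝ U ≤ Module.finrank ℝ (Submodule.span ℝ (p '' ((Cc X p ν {u} : Finset ι) : Set ι))) + 1 := by
  have hd := h.d5
  suffices hs : ∃ s : Finset ι, s ⊆ Cc X p ν {u} ∧ s.card = d ∧ LinearIndepOn ℝ p (s : Set ι) by
    obtain ⟨s, h1, h2, h3⟩ := hs
    have := span_ge h3 h1
    rw [h.dim]; omega
  obtain ⟨G, hGu, hG, hk | ⟨hc, hGne⟩⟩ := h.chain (d - 4) {u} (by rw [Finset.card_singleton]; omega)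
    (h.cfg.vert u hu) hne
  · obtain ⟨f, hf⟩ := h.exists_odd
    have h1 := hf.half h.toCS (C := Cc X p ν G) Cc_subX (fun c hc => h.Cc_nu hc)
    obtain ⟨s, hs, hsc⟩ := Finset.exists_subset_card_eq
      (by omega : d ≤ ((Cc X p ν G).filter fun c => 0 < f c).card)
    have hsC : s ⊆ Cc X p ν G := hs.trans (Finset.filter_subset _ _)
    refine ⟨s, hsC.trans (h.Cc_mono hGu), hsc, hgen s (hsC.trans Cc_subX) hsc ?_⟩
    intro a ha b hb e
    have p1 := (Finset.mem_filter.1 (hs ha)).2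
    have p2 := (Finset.mem_filter.1 (hs hb)).2
    rw [e, hf.odd] at p2
    linarith
  · obtain ⟨o1, hE⟩ := h.oct hG hc hGne
    have huG : u ∈ G := hGu (Finset.mem_singleton_self _)
    obtain ⟨x, hx⟩ := hGne
    obtain ⟨y, hy, hy'⟩ := Finset.exists_mem_notMem_of_card_lt_card (s := {x, ν x}) (t := Cc X p ν G) (by
      rw [o1]; exact Finset.card_le_two.trans_lt (by norm_num))
    obtain ⟨z, hz, hz'⟩ := Finset.exists_mem_notMem_of_card_lt_card (s := {x, ν x, y, ν y}) (t := Cc X p ν G) (by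
      rw [o1]; exact Finset.card_le_four.trans_lt (by norm_num))
    simp only [Finset.mem_insert, Finset.mem_singleton, not_or] at hy' hz'
    have hxy : Nap ν x y := hy'
    have hxz : Nap ν x z := ⟨hz'.1, hz'.2.1⟩
    have hyz : Nap ν y z := hz'.2.2
    have hI := h.oct_indep hG hE hx hy hz hxy hxz hyz
    refine ⟨(insert x (insert y (insert z (insert (ν x) G)))).erase u, ?_, ?_, hI.mono (by
      exact_mod_cast Finset.erase_subset _ _)⟩
    · intro t ht
      rw [Finset.mem_erase] at ht
      simp only [Finset.mem_insert] at ht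
      obtain ⟨htu, rfl | rfl | rfl | rfl | ht⟩ := ht
      · exact h.Cc_mono hGu hx
      · exact h.Cc_mono hGu hy
      · exact h.Cc_mono hGu hz
      · exact h.Cc_mono hGu (h.Cc_nu hx)
      · exact h.swap hG hc huG hE hx hy hz hxy hxz hyz ht htu
    · rw [Finset.card_erase_of_mem (by simp [huG]), Finset.card_insert_of_notMem, Finset.card_insert_of_notMem,
        Finset.card_insert_of_notMem, Finset.card_insert_of_notMem (h.Cc_notMem (h.Cc_nu hx))]
      · omega
      · simp only [Finset.mem_insert, not_or]; exact ⟨hxz.2, h.Cc_notMem hz⟩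
      · simp only [Finset.mem_insert, not_or]; exact ⟨hyz.1.symm, hxy.2, h.Cc_notMem hy⟩
      · simp only [Finset.mem_insert, not_or]
        exact ⟨hxy.1.symm, hxz.1.symm, (h.nu_ne (Cc_subX hx)).symm, h.Cc_notMem hx⟩

end
end R18

namespace R18

section
variable {ι U : Type} [DecidableEq ι] [AddCommGroup U] [Module ℝ U] [FiniteDimensional ℝ U]
variable {X : Finset ι} {p : ι → U}
variable {ν : ι → ι} {o : U} {ε : Module.Dual ℝ U}
variable {f : ι → ℝ} {d : ℕ}
variable {u : ι}

theorem Full.final (h : Full X p ν o ε d) (hu : u ∈ X)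
    (hpr : ∀ σ : Finset ι, σ ⊆ X → σ.card = d → (∀ τ, τ ⊂ σ → Fc X p τ) → Fc X p σ)
    (hgen : ∀ s : Finset ι, s ⊆ X → s.card = d → (∀ a ∈ s, ∀ b ∈ s, b ≠ ν a) → LinearIndepOn ℝ p (s : Set ι))
    {M : ι → Module.Dual ℝ U} (hM1 : Mot X p {u} M) (hM2 : Mot X p {ν u} M) :
    ∃ B : U →ₗ[ℝ] Module.Dual ℝ U, (∀ x, B x x = 0) ∧
      ∀ v, (Fc X p (insert v {u}) ∨ Fc X p (insert v {ν u})) → M v = B (p v) := by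
  have hd := h.d5
  have hne : (Cc X p ν {u}).Nonempty := by
    rw [Finset.nonempty_iff_ne_empty]
    intro h0
    exact CaseA.false (X := X) (p := p) (u := u) { h with hu := hu, prime := hpr, c0 := h0 }
  have hdim := h.caseB hu hgen hne
  obtain ⟨B, hB, hBM⟩ := h.cfg.rigid (h.cfg.vert u hu) (by rw [h.dim, Finset.card_singleton]; omega) hM1
  obtain ⟨B', hB', hBM'⟩ := h.cfg.rigid (h.cfg.vert _ (h.memX u hu)) (by rw [h.dim, Finset.card_singleton]; omega) hM2
  have : B = B' := by
    refine bil_sub_zero (AltS_eq_zero hdim (mem_AltS.2 ⟨fun x => by simp [hB, hB'], fun s hs => ?_⟩))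
    induction hs using Submodule.span_induction with
    | mem x hx =>
      obtain ⟨y, hy, rfl⟩ := hx
      have hy' := mem_Cc.1 (Finset.mem_coe.1 hy)
      have h2 := h.Fc_nu hy'.2
      rw [Finset.image_insert, Finset.image_singleton, h.inv] at h2
      rw [LinearMap.sub_apply, ← hBM y hy'.1, ← hBM' y h2, sub_self]
    | zero => simp
    | add x y _ _ hx hy => rw [map_add, hx, hy, add_zero]
    | smul c x _ hx => rw [map_smul, hx, smul_zero]
  subst this
  exact ⟨B, hB, fun v hv => hv.elim (hBM v) (hBM' v)⟩

end
end R18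

namespace R18

section
variable {d : ℕ}

/-- lifting to height one -/
def pp (d : ℕ) (v : Fin d → ℝ) : (Fin d → ℝ) × ℝ := (v, 1)

/-- the functional `c t - f y` -/
def mkF (f : (Fin d → ℝ) →ₗ[ℝ] ℝ) (c : ℝ) : Module.Dual ℝ ((Fin d → ℝ) × ℝ) :=
  c • LinearMap.snd ℝ _ _ - f ∘ₗ LinearMap.fst ℝ _ _

lemma mkF_pp (f : (Fin d → ℝ) →ₗ[ℝ] ℝ) (c : ℝ) (v : Fin d → ℝ) : mkF f c (pp d v) = c - f v := by
  simp [mkF, pp]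

lemma F_pp (F : Module.Dual ℝ ((Fin d → ℝ) × ℝ)) (v : Fin d → ℝ) :
    F (pp d v) = F (0, 1) + (F ∘ₗ LinearMap.inl ℝ _ _) v := by
  have : pp d v = (0, 1) + LinearMap.inl ℝ (Fin d → ℝ) ℝ v := by simp [pp]
  rw [this, map_add]; rfl

lemma lin_of_aff {A : Set (Fin d → ℝ)} (h : AffineIndependent ℝ (fun x : A => (x : Fin d → ℝ))) :
    LinearIndepOn ℝ (pp d) A := by
  change LinearIndependent ℝ (fun x : A => pp d x)
  rw [linearIndependent_iff']
  rw [affineIndependent_iff] at h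
  intro s g hg
  refine h s g ?_ ?_
  · have := congrArg Prod.snd hg
    simpa [pp, Prod.snd_sum] using this
  · have := congrArg Prod.fst hg
    simpa [pp, Prod.fst_sum] using this

lemma F_zero (P : SPolytope d) (F : Module.Dual ℝ ((Fin d → ℝ) × ℝ)) (hF : ∀ x ∈ P.V, F (pp d x) = 0) : F = 0 := by
  have h1 : ∀ y, F (pp d y) = 0 := by
    intro y
    have hy : y ∈ affineSpan ℝ (P.V : Set (Fin d → ℝ)) := by rw [P.span_top]; trivial
    refine affineSpan_induction (p := fun y => F (pp d y) = 0) hy (fun x hx => hF x hx) ?_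
    intro c a b w ha hb hw
    rw [F_pp] at ha hb hw ⊢
    simp only [vsub_eq_sub, vadd_eq_add, map_add, map_smul, map_sub, smul_eq_mul] at *
    have : (F ∘ₗ LinearMap.inl ℝ (Fin d → ℝ) ℝ) a = (F ∘ₗ LinearMap.inl ℝ (Fin d → ℝ) ℝ) b := by linarith
    rw [this]; linarith
  have h0 : F (0, 1) = 0 := h1 0
  refine LinearMap.ext fun z => ?_
  obtain ⟨y, t⟩ := z
  have h2 := h1 y
  rw [F_pp, h0, zero_add] at h2
  have h3 : ((y, t) : (Fin d → ℝ) × ℝ) = LinearMap.inl ℝ (Fin d → ℝ) ℝ y + t • (0, 1) := by simp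
  rw [h3, map_add, map_smul, h0, smul_zero, add_zero]
  exact h2

/-- the supporting set of a nonnegative functional -/
def supp (P : SPolytope d) (F : Module.Dual ℝ ((Fin d → ℝ) × ℝ)) : Set (Fin d → ℝ) :=
  {y ∈ polyBody P.V | F (pp d y) = 0}

lemma supp_proper (P : SPolytope d) {F : Module.Dual ℝ ((Fin d → ℝ) × ℝ)} (hF : F ≠ 0)
    (hpos : ∀ x ∈ P.V, 0 ≤ F (pp d x)) : IsProperFace P.V (supp P F) := by
  refine ⟨⟨-(F ∘ₗ LinearMap.inl ℝ _ _), F (0, 1), ?_, ?_⟩, ?_⟩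
  · intro y hy
    have hconv : Convex ℝ {y | (-(F ∘ₗ LinearMap.inl ℝ (Fin d → ℝ) ℝ)) y ≤ F (0, 1)} :=
      convex_halfSpace_le (LinearMap.isLinear _) _
    refine convexHull_min (fun x hx => ?_) hconv hy
    have := hpos x hx
    rw [F_pp] at this
    rw [Set.mem_ofPred_eq, LinearMap.neg_apply]
    linarith
  · ext y
    rw [supp, Set.mem_ofPred_eq, Set.mem_ofPred_eq, F_pp, LinearMap.neg_apply]
    constructor
    · rintro ⟨h1, h2⟩; exact ⟨h1, by linarith⟩
    · rintro ⟨h1, h2⟩; exact ⟨h1, by linarith⟩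
  · intro he
    refine hF (F_zero P F fun x hx => ?_)
    have : x ∈ supp P F := by rw [he]; exact subset_convexHull ℝ _ hx
    exact this.2

lemma cfg_of (hd : 5 ≤ d) (P : SPolytope d) : Cfg P.V (pp d) := by
  refine ⟨F_zero P, ?_, ?_⟩
  · intro F hF hpos
    have := lin_of_aff (P.simplicial _ (supp_proper P hF hpos)).1
    refine this.mono ?_
    intro x hx
    rw [Finset.mem_coe, Finset.mem_filter] at hx
    exact ⟨hx.1, subset_convexHull ℝ _ hx.1, hx.2⟩
  · intro v hv
    have hcl : IsClosed (convexHull ℝ ((P.V.erase v : Finset (Fin d → ℝ)) : Set (Fin d → ℝ))) :=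
      (Set.Finite.isCompact_convexHull (𝕜 := ℝ) (P.V.erase v).finite_toSet).isClosed
    obtain ⟨f, c, h1, h2⟩ := geometric_hahn_banach_point_closed (convex_convexHull ℝ _) hcl (P.extreme v hv)
    have e0 : ∀ x ∈ P.V, x ≠ v → 0 < mkF (-(f : (Fin d → ℝ) →ₗ[ℝ] ℝ)) (-(f v)) (pp d x) := by
      intro x hx hxv
      have := h2 x (subset_convexHull ℝ _ (by simp [hx, hxv]))
      rw [mkF_pp, LinearMap.neg_apply]
      simp only [ContinuousLinearMap.coe_coe]
      linarith
    have e1 : mkF (-(f : (Fin d → ℝ) →ₗ[ℝ] ℝ)) (-(f v)) (pp d v) = 0 := by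
      rw [mkF_pp, LinearMap.neg_apply]; simp
    refine ⟨by simpa using hv, mkF (-(f : (Fin d → ℝ) →ₗ[ℝ] ℝ)) (-(f v)), ?_, ?_, ?_⟩
    · intro h0
      obtain ⟨F, hF, hF0⟩ := exists_dual_kill (p := pp d) (s := {v}) (by simp; omega)
      refine hF0 (F_zero P F fun x hx => ?_)
      by_cases hxv : x = v
      · exact hF x (by simp [hxv])
      · have := e0 x hx hxv
        rw [h0] at this
        simp at this
    · intro x hx
      by_cases hxv : x = v
      · rw [hxv, e1]
      · exact (e0 x hx hxv).le
    · intro x hx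
      rw [Finset.mem_singleton]
      constructor
      · intro h0
        by_contra hxv
        exact (e0 x hx hxv).ne' h0
      · rintro rfl; exact e1

lemma bface_iff (hd : 5 ≤ d) (P : SPolytope d) (s : Finset (Fin d → ℝ)) : BFace P s ↔ Fc P.V (pp d) s := by
  constructor
  · rintro ⟨hs, F, ⟨⟨f, c, h1, h2⟩, h3⟩, h4⟩
    refine (cfg_of hd P).Fc_of_sub (F := mkF f c) ?_ ?_ hs ?_
    · intro h0
      refine h3 ?_
      rw [h2]
      ext y
      rw [Set.mem_ofPred_eq]
      refine ⟨fun h => h.1, fun h => ⟨h, ?_⟩⟩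
      have := mkF_pp f c y
      rw [h0] at this
      simp at this
      linarith
    · intro x hx
      rw [mkF_pp]
      have := h1 x (subset_convexHull ℝ _ hx)
      linarith
    · intro x hx
      have := h4 hx
      rw [h2] at this
      rw [mkF_pp, this.2, sub_self]
  · rintro ⟨hs, F, hF, hpos, h0⟩
    exact ⟨hs, supp P F, supp_proper P hF hpos, fun x hx =>
      ⟨subset_convexHull ℝ _ (hs hx), (h0 x (hs hx)).2 hx⟩⟩

lemma full_of (hd : 5 ≤ d) (P : SPolytope d) (hcs : IsCS P)
    (hg2 : g2 P = (d.choose 2 : ℤ) - (d : ℤ)) (hne : P.V.Nonempty) :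
    Full P.V (pp d) (fun v => -v) ((0, 1) : (Fin d → ℝ) × ℝ) (LinearMap.snd ℝ (Fin d → ℝ) ℝ) d where
  cfg := cfg_of hd P
  inv := fun x => neg_neg x
  memX := hcs
  eo := rfl
  ep := fun x => rfl
  pn := fun x => by ext <;> simp [pp]; norm_num
  d5 := hd
  dim := by simp
  ne := hne
  cnt := by
    have h1 : Dg P.V (pp d) ∅ ≤ 2 * f1 P := by
      rw [Dg]
      refine (Finset.card_le_mul_card_image (f := fun e : (Fin d → ℝ) × (Fin d → ℝ) => ({e.1, e.2} : Finset (Fin d → ℝ)))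
        _ 2 ?_).trans ?_
      · intro e he
        rw [Finset.mem_image] at he
        obtain ⟨⟨a, b⟩, -, rfl⟩ := he
        refine (Finset.card_le_card (t := {(a, b), (b, a)}) ?_).trans Finset.card_le_two
        rintro ⟨x, y⟩ hxy
        rw [Finset.mem_filter, Finset.mem_filter] at hxy
        have hne := hxy.1.2.2.2.1
        have := hxy.2
        dsimp only at this hne
        have hx : x ∈ ({a, b} : Finset (Fin d → ℝ)) := by rw [← this]; simp
        have hy : y ∈ ({a, b} : Finset (Fin d → ℝ)) := by rw [← this]; simp
        simp only [Finset.mem_insert, Finset.mem_singleton] at hx hy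
        simp only [Finset.mem_insert, Finset.mem_singleton, Prod.mk.injEq]
        rcases hx with rfl | rfl <;> rcases hy with rfl | rfl <;> simp_all
      · refine Nat.mul_le_mul_left 2 (Finset.card_le_card ?_)
        intro e he
        rw [Finset.mem_image] at he
        obtain ⟨⟨a, b⟩, hab, rfl⟩ := he
        rw [Finset.mem_filter, Finset.mem_product] at hab
        obtain ⟨⟨ha, hb⟩, -, -, hne, hF⟩ := hab
        rw [edgeFinset, Finset.mem_filter, Finset.mem_powerset]
        refine ⟨?_, Finset.card_pair hne, (bface_iff hd P _).2 ?_⟩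
        · intro x hx
          simp only [Finset.mem_insert, Finset.mem_singleton] at hx
          rcases hx with rfl | rfl
          · exact ha
          · exact hb
        · simpa using hF
    have h2 : (f1 P : ℤ) = d * P.V.card - 2 * d := by
      have : (d + 1).choose 2 = d + d.choose 2 := by
        rw [Nat.choose_succ_succ' d 1, Nat.choose_one_right]
      rw [g2, f0, this] at hg2
      push_cast at hg2
      linarith
    have h3 : (Dg P.V (pp d) ∅ : ℤ) ≤ 2 * f1 P := by exact_mod_cast h1
    have h4 : (Dg P.V (pp d) ∅ : ℤ) + 4 * d ≤ 2 * d * P.V.card := by rw [h2] at h3; linarith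
    exact_mod_cast h4

/-- the linear functional attached to a velocity -/
def mM (m : (Fin d → ℝ) → Fin d → ℝ) (v : Fin d → ℝ) : Module.Dual ℝ ((Fin d → ℝ) × ℝ) :=
  ∑ i, m v i • ((LinearMap.proj i : (Fin d → ℝ) →ₗ[ℝ] ℝ) ∘ₗ LinearMap.fst ℝ _ _ - v i • LinearMap.snd ℝ _ _)

lemma mM_apply (m : (Fin d → ℝ) → Fin d → ℝ) (v : Fin d → ℝ) (y : Fin d → ℝ) (t : ℝ) :
    mM m v (y, t) = ∑ i, m v i * (y i - v i * t) := by
  simp [mM, LinearMap.sum_apply]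

lemma mot_of (hd : 5 ≤ d) (P : SPolytope d) (u : Fin d → ℝ) (E : FinGraph (Fin d → ℝ))
    (hE : (starGraph P {u}).edges ⊆ E.edges) {m : (Fin d → ℝ) → Fin d → ℝ}
    (hm : IsMotion E (fun x => x) m) : Mot P.V (pp d) {u} (mM m) := by
  intro v w hF
  rw [pp, pp, mM_apply, mM_apply]
  by_cases hvw : v = w
  · subst hvw; simp
  have he : ({v, w} : Finset (Fin d → ℝ)) ∈ (starGraph P {u}).edges := by
    rw [starGraph, Finset.mem_filter, Finset.mem_powerset]
    refine ⟨fun x hx => hF.1 ?_, Finset.card_pair hvw, (bface_iff hd P _).2 ?_⟩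
    · simp only [Finset.mem_insert, Finset.mem_singleton] at hx ⊢; tauto
    · have : ({v, w} ∪ {u} : Finset (Fin d → ℝ)) = insert v (insert w {u}) := by
        ext x; simp only [Finset.mem_insert, Finset.mem_singleton, Finset.mem_union]; tauto
      rw [this]; exact hF
  have h1 := hm _ (hE he) v (by simp) w (by simp)
  rw [dotR] at h1
  rw [← Finset.sum_add_distrib, ← neg_eq_zero, ← h1, ← Finset.sum_neg_distrib]
  refine Finset.sum_congr rfl fun i _ => ?_
  simp only [Pi.sub_apply]
  ring

end
end R18

/-- Let `d ≥ 5` and let `P` be a prime cs simplicial `d`-polytope with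
`g₂(P) = C(d,2) - d`, in general position. Then for every vertex `u`, the framework on
the union of the graphs of `st(u)` and `st(-u)` (with the natural embedding) is
infinitesimally rigid in `ℝ^d`. -/
theorem stmt18 {d : ℕ} (hd : 5 ≤ d) (P : SPolytope d) (hp : IsPrimePoly P) (hcs : IsCS P)
    (hg2 : g2 P = (d.choose 2 : ℤ) - (d : ℤ)) (hgen : GenPos P)
    (u : Fin d → ℝ) (hu : u ∈ P.V) :
    IsInfRigid d
      (⟨(starGraph P {u}).verts ∪ (starGraph P {-u}).verts,
        (starGraph P {u}).edges ∪ (starGraph P {-u}).edges⟩ : FinGraph (Fin d → ℝ))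
      (fun x => x) := by
  intro m hm
  have hfull := R18.full_of hd P hcs hg2 ⟨u, hu⟩
  obtain ⟨B, hB, hBM⟩ := hfull.final hu (by
      intro σ hσX hσ hτ
      by_contra hcon
      exact hp ⟨σ, ⟨hσX, fun h => hcon ((R18.bface_iff hd P σ).1 h), fun τ h =>
        (R18.bface_iff hd P τ).2 (hτ τ h)⟩, hσ⟩) (by
      intro s hs hsd hna
      exact R18.lin_of_aff (A := (s : Set (Fin d → ℝ))) (hgen s hs hsd fun x hx y hy => hna y hy x hx))
    (R18.mot_of hd P u _ Finset.subset_union_left hm) (R18.mot_of hd P (-u) _ Finset.subset_union_right hm)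
  refine ⟨Matrix.of fun i j => B (Pi.single j 1, 0) (Pi.single i 1, 0), fun i => B (0, 1) (Pi.single i 1, 0), ?_, ?_⟩
  · ext i j
    rw [Matrix.transpose_apply, Matrix.neg_apply, Matrix.of_apply, Matrix.of_apply, R18.alt_symm hB]
  · intro v hv
    have h1 : R18.mM m v = B (R18.pp d v) := hBM v (by
      rw [Finset.mem_union, starGraph, starGraph, Finset.mem_filter, Finset.mem_filter] at hv
      exact hv.imp (fun h => (R18.bface_iff hd P _).1 h.2) (fun h => (R18.bface_iff hd P _).1 h.2))
    ext i
    have h2 := LinearMap.congr_fun h1 (Pi.single i 1, 0)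
    rw [R18.mM_apply] at h2
    have h3 : R18.pp d v = ∑ j, v j • ((Pi.single j 1, 0) : (Fin d → ℝ) × ℝ) + (0, 1) := by
      ext k
      · simp [R18.pp, Prod.fst_sum, Finset.sum_apply, Pi.single_apply]
      · simp [R18.pp, Prod.snd_sum]
    rw [h3, map_add, map_sum, LinearMap.add_apply, LinearMap.sum_apply] at h2
    simp only [map_smul, LinearMap.smul_apply, smul_eq_mul] at h2
    simp only [mul_zero, sub_zero, Pi.single_apply, mul_ite, mul_one, Finset.sum_ite_eq', Finset.mem_univ, if_true] at h2
    rw [h2, Pi.add_apply, Matrix.mulVec, dotProduct]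
    congr 1
    refine Finset.sum_congr rfl fun j _ => ?_
    rw [Matrix.of_apply, mul_comm]
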